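/- Let Ω ⊂ ℝ^N (N ≥ 2) be a smooth bounded open set, m ≥ 1, n ≥ 1 and 2 ≤ q ≤ min{n,N} integers, 1 ≤ r ≤ q, β ∈ I(r,n) and 𝛂 = (α^1,…,α^m) with α^j ∈ I(r,N). Then: (i) for every sequence {u_k} ⊂ C^m(Ω̄,ℝ^n) that is Cauchy with respect to the W^{m−m/q,q}(Ω) norm and every ψ ∈ C_c^∞(Ω), the limit lim_{k→∞} ∫_Ω M^β_𝛂(D^m u_k) ψ dx exists; (ii) if {u_k}, {v_k} ⊂ C^m(Ω̄,ℝ^n) are two such Cauchy sequences with ‖u_k − v_k‖_{W^{m−m/q,q}(Ω)} → 0, the two limits coincide; (iii) there is a constant C, depending only on q, r, m, n, N and Ω, such that for any two such Cauchy sequences {u_k}, {v_k} and all ψ ∈ C_c^∞(Ω), | lim_k ∫_Ω M^β_𝛂(D^m u_k) ψ dx − lim_k ∫_Ω M^β_𝛂(D^m v_k) ψ dx | ≤ C L ( M_u^{r−1} + M_v^{r−1} ) ‖D^m ψ‖_{L^∞}, where L = lim sup_k ‖u_k − v_k‖_{W^{m−m/q,q}}, M_u = lim sup_k ‖u_k‖_{W^{m−m/q,q}}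 and M_v = lim sup_k ‖v_k‖_{W^{m−m/q,q}}. -/

import Mathlib

open MeasureTheory Filter Topology Real

noncomputable section

abbrev Euc (N : ℕ) := EuclideanSpace ℝ (Fin N)

/-- The (full signed) determinant of an `m`-dimensional matrix of order `N^m`:
`det A = ∑_{τ_2,…,τ_m ∈ S_N} (∏_{s=2}^m sgn τ_s) ∏_{k=1}^N a_{k τ_2(k) ⋯ τ_m(k)}`. -/
def hyperDet {N : ℕ} : {m : ℕ} → ((Fin m → Fin N) → ℝ) → ℝ
  | 0, A => A finZeroElim
  | m + 1, A =>
      ∑ τ : Fin m → Equiv.Perm (Fin N),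
        (∏ s, ((Equiv.Perm.sign (τ s) : ℤ) : ℝ)) *
          ∏ k : Fin N, A (Fin.cons k fun s => τ s k)

/-- classical partial derivative `∂_i f`. -/
def pderiv' {N : ℕ} (i : Fin N) (f : Euc N → ℝ) : Euc N → ℝ :=
  fun x => fderiv ℝ f x (EuclideanSpace.single i 1)

/-- iterated partial derivative `∂_{l_1} ∂_{l_2} ⋯ f`. -/
def pderivList {N : ℕ} : List (Fin N) → (Euc N → ℝ) → Euc N → ℝ
  | [], f => f
  | i :: l, f => pderiv' i (pderivList l f)

/-- the `m`th-Jacobian `(β,α)`-minor `M^β_α(D^m u)` of `u : Ω → ℝ^n`, i.e. the hyper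
determinant of the `(m+1)`-dimensional matrix of order `r^{m+1}` with entries
`∂_{α^1_{l_1}} ⋯ ∂_{α^m_{l_m}} u^{β_{l_0}}`. -/
def jacMinor {N n : ℕ} (m r : ℕ) (β : Fin r → Fin n) (α : Fin m → Fin r → Fin N)
    (u : Euc N → Fin n → ℝ) (x : Euc N) : ℝ :=
  hyperDet (m := m + 1) fun l : Fin (m + 1) → Fin r =>
    pderivList (List.ofFn fun s : Fin m => α s (l s.succ)) (fun y => u y (β (l 0))) x

/-- the `m`th-Jacobian `α`-minor `M_α(D^m v)` of a scalar function `v`. -/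
def scalMinor {N : ℕ} (m r : ℕ) (α : Fin m → Fin r → Fin N)
    (v : Euc N → ℝ) (x : Euc N) : ℝ :=
  hyperDet (m := m) fun l : Fin m → Fin r =>
    pderivList (List.ofFn fun s : Fin m => α s (l s)) v x

/-- the integer Sobolev norm `‖u‖_{W^{k,p}(Ω)} = ∑_{j ≤ k} ‖D^j u‖_{L^p(Ω)}`. -/
def intSobNorm {N : ℕ} {F : Type*} [NormedAddCommGroup F] [NormedSpace ℝ F]
    (Ω : Set (Euc N)) (k : ℕ) (p : ℝ) (u : Euc N → F) : ℝ :=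
  ∑ j ∈ Finset.range (k + 1), (∫ x in Ω, ‖iteratedFDeriv ℝ j u x‖ ^ p) ^ (1 / p)

open Classical in
/-- the (possibly fractional) Sobolev norm `‖u‖_{W^{s,p}(Ω)}`: for integer `s` the usual
Sobolev norm, for non-integer `s` the `W^{[s],p}` norm plus the Gagliardo seminorm of
`D^{[s]} u` with fractional exponent `s - [s]`. -/
def sobNorm {N : ℕ} {F : Type*} [NormedAddCommGroup F] [NormedSpace ℝ F]
    (Ω : Set (Euc N)) (s p : ℝ) (u : Euc N → F) : ℝ :=
  if ∃ k : ℕ, s = k then intSobNorm Ω ⌊s⌋₊ p u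
  else
    intSobNorm Ω ⌊s⌋₊ p u +
      (∫ x in Ω, ∫ y in Ω,
          ‖iteratedFDeriv ℝ ⌊s⌋₊ u x - iteratedFDeriv ℝ ⌊s⌋₊ u y‖ ^ p /
            ‖x - y‖ ^ ((N : ℝ) + (s - ⌊s⌋₊) * p)) ^ (1 / p)

/-- `‖D^m ψ‖_{L^∞}`, the sup of the `m`-th derivatives of `ψ`. -/
def supDm {N : ℕ} (m : ℕ) (ψ : Euc N → ℝ) : ℝ := ⨆ x, ‖iteratedFDeriv ℝ m ψ x‖

/-- `ψ ∈ C_c^∞(Ω)`. -/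
def IsCinfc {N : ℕ} (Ω : Set (Euc N)) (ψ : Euc N → ℝ) : Prop :=
  ContDiff ℝ (⊤ : ℕ∞) ψ ∧ HasCompactSupport ψ ∧ tsupport ψ ⊆ Ω

/-- `Ω` is a smooth bounded open subset of `ℝ^N`. -/
def IsSmoothDomain {N : ℕ} (Ω : Set (Euc N)) : Prop :=
  IsOpen Ω ∧ Bornology.IsBounded Ω ∧
    ∃ f : Euc N → ℝ, ContDiff ℝ (⊤ : ℕ∞) f ∧ Ω = {x | f x < 0} ∧
      ∀ x ∈ frontier Ω, fderiv ℝ f x ≠ 0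

/-! ### Iterated partial derivatives of smooth functions -/

/-- A smooth scalar function on `ℝ^N`. -/
abbrev IsSmooth {N : ℕ} (f : Euc N → ℝ) : Prop := ContDiff ℝ (⊤ : ℕ∞) f

/-- The `i`-th standard basis vector. -/
abbrev basisVec {N : ℕ} (i : Fin N) : Euc N := EuclideanSpace.single i 1

lemma norm_basisVec {N : ℕ} (i : Fin N) : ‖basisVec i‖ = 1 := by simp [basisVec]

section PartialDerivatives

variable {N : ℕ}

lemma IsSmooth.differentiable {f : Euc N → ℝ} (hf : IsSmooth f) : Differentiable ℝ f :=
  ContDiff.differentiable hf (by simp)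

lemma IsSmooth.pderiv' {f : Euc N → ℝ} (hf : IsSmooth f) (i : Fin N) :
    IsSmooth (pderiv' i f) :=
  (ContDiff.fderiv_right hf (by simp)).clm_apply contDiff_const

lemma IsSmooth.pderivList {f : Euc N → ℝ} (hf : IsSmooth f) (l : List (Fin N)) :
    IsSmooth (pderivList l f) := by
  induction l with
  | nil => exact hf
  | cons i l ih => exact ih.pderiv' i

lemma pderiv'_comm {f : Euc N → ℝ} (hf : IsSmooth f) (i j : Fin N) :
    pderiv' i (pderiv' j f) = pderiv' j (pderiv' i f) := by
  have hd : Differentiable ℝ (fderiv ℝ f) :=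
    (ContDiff.fderiv_right (m := (⊤ : ℕ∞)) hf (by simp)).differentiable (by simp)
  have key : ∀ (k l : Fin N) (x : Euc N), pderiv' k (pderiv' l f) x
      = fderiv ℝ (fderiv ℝ f) x (basisVec k) (basisVec l) := by
    intro k l x
    have h := ((hd x).hasFDerivAt.clm_apply (hasFDerivAt_const (basisVec l) x)).fderiv
    unfold pderiv'
    rw [h]
    simp
  funext x
  rw [key, key]
  have hs : IsSymmSndFDerivAt ℝ f x :=
    ContDiffAt.isSymmSndFDerivAt (contDiff_infty.1 hf 2).contDiffAt (by simp)
  exact hs.eq _ _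

lemma pderivList_append (l l' : List (Fin N)) (f : Euc N → ℝ) :
    pderivList (l ++ l') f = pderivList l (pderivList l' f) := by
  induction l with
  | nil => rfl
  | cons i l ih => simp [pderivList, ih]

lemma pderivList_pderiv' {f : Euc N → ℝ} (hf : IsSmooth f) (l : List (Fin N)) (i : Fin N) :
    pderivList l (pderiv' i f) = pderiv' i (pderivList l f) := by
  induction l with
  | nil => rfl
  | cons j l ih =>
    simp only [pderivList]
    rw [ih, pderiv'_comm (hf.pderivList l)]

lemma tsupport_pderiv'_subset (i : Fin N) (f : Euc N → ℝ) :
    tsupport (pderiv' i f) ⊆ tsupport f := by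
  refine closure_minimal (fun x hx => ?_) (isClosed_tsupport f)
  by_contra hxf
  apply hx
  have h : f =ᶠ[𝓝 x] fun _ => 0 := notMem_tsupport_iff_eventuallyEq.1 hxf
  simp [pderiv', h.fderiv_eq]

lemma tsupport_pderivList_subset (l : List (Fin N)) (f : Euc N → ℝ) :
    tsupport (pderivList l f) ⊆ tsupport f := by
  induction l with
  | nil => exact subset_rfl
  | cons i l ih => exact (tsupport_pderiv'_subset i _).trans ih

end PartialDerivatives

/-! ### The multilinear form behind the Jacobian minors -/

/-- The multilinear differential operator
`(w_1,…,w_r) ↦ ∑_{τ_1,…,τ_m} ∏ sgn τ_s ∏_k ∂_{α^1_{τ_1(k)}} ⋯ ∂_{α^m_{τ_m(k)}} w_k`. -/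
def slotForm {N : ℕ} (m : ℕ) {r : ℕ} (α : Fin m → Fin r → Fin N)
    (w : Fin r → Euc N → ℝ) (x : Euc N) : ℝ :=
  ∑ τ : Fin m → Equiv.Perm (Fin r), (∏ s, ((Equiv.Perm.sign (τ s) : ℤ) : ℝ)) *
    ∏ k, pderivList (List.ofFn fun s => α s (τ s k)) (w k) x

lemma jacMinor_eq_slotForm {N n m r : ℕ} (β : Fin r → Fin n) (α : Fin m → Fin r → Fin N)
    (u : Euc N → Fin n → ℝ) (x : Euc N) :
    jacMinor m r β α u x = slotForm m α (fun k y => u y (β k)) x := by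
  simp [jacMinor, hyperDet, slotForm]

section SlotForm

variable {N m r : ℕ}

lemma slotForm_succ (α : Fin (m + 1) → Fin r → Fin N) {w : Fin r → Euc N → ℝ}
    (hw : ∀ k, IsSmooth (w k)) (x : Euc N) :
    slotForm (m + 1) α w x = ∑ σ : Equiv.Perm (Fin r), ((Equiv.Perm.sign σ : ℤ) : ℝ) *
      slotForm m (Fin.tail α) (fun k => pderiv' (α 0 (σ k)) (w k)) x := by
  simp only [slotForm, Finset.mul_sum]
  rw [← Fintype.sum_prod_type', ← (Fin.consEquiv fun _ => Equiv.Perm (Fin r)).sum_comp]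
  refine Finset.sum_congr rfl fun p _ => ?_
  simp only [Fin.consEquiv_apply, Fin.prod_univ_succ, Fin.cons_zero, Fin.cons_succ, mul_assoc,
    List.ofFn_succ, pderivList, Fin.tail]
  congr 2
  refine Finset.prod_congr rfl fun k _ => ?_
  rw [pderivList_pderiv' (hw k)]

lemma IsSmooth.slotForm (α : Fin m → Fin r → Fin N) {w : Fin r → Euc N → ℝ}
    (hw : ∀ k, IsSmooth (w k)) : IsSmooth (slotForm m α w) := by
  unfold _root_.slotForm
  exact ContDiff.sum fun τ _ => contDiff_const.mul
    (contDiff_prod fun k _ => (hw k).pderivList _)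

lemma pderiv'_slotForm (α : Fin m → Fin r → Fin N) {w : Fin r → Euc N → ℝ}
    (hw : ∀ k, IsSmooth (w k)) (i : Fin N) (x : Euc N) :
    pderiv' i (slotForm m α w) x =
      ∑ k, slotForm m α (Function.update w k (pderiv' i (w k))) x := by
  have hprod : ∀ τ : Fin m → Equiv.Perm (Fin r),
      HasFDerivAt (fun x => ∏ k, pderivList (List.ofFn fun s => α s (τ s k)) (w k) x)
        (∑ k, (∏ j ∈ Finset.univ.erase k, pderivList (List.ofFn fun s => α s (τ s j)) (w j) x) •
          fderiv ℝ (pderivList (List.ofFn fun s => α s (τ s k)) (w k)) x) x := fun τ =>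
    HasFDerivAt.finsetProd fun k _ =>
      (((hw k).pderivList _).differentiable x).hasFDerivAt
  have hsum : HasFDerivAt (slotForm m α w)
      (∑ τ : Fin m → Equiv.Perm (Fin r), (∏ s, ((Equiv.Perm.sign (τ s) : ℤ) : ℝ)) •
        ∑ k, (∏ j ∈ Finset.univ.erase k, pderivList (List.ofFn fun s => α s (τ s j)) (w j) x) •
          fderiv ℝ (pderivList (List.ofFn fun s => α s (τ s k)) (w k)) x) x :=
    HasFDerivAt.fun_sum fun τ _ => (hprod τ).const_mul _
  unfold pderiv'
  rw [hsum.fderiv]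
  simp only [_root_.sum_apply, _root_.smul_apply, smul_eq_mul,
    Finset.mul_sum]
  rw [Finset.sum_comm]
  refine Finset.sum_congr rfl fun k _ => Finset.sum_congr rfl fun τ _ => ?_
  congr 1
  rw [← Finset.mul_prod_erase _ _ (Finset.mem_univ k), mul_comm]
  simp only [Function.update_self]
  congr 1
  · exact congrFun (pderivList_pderiv' (hw k) _ i).symm x
  · refine Finset.prod_congr rfl fun j hj => ?_
    rw [Function.update_of_ne (Finset.ne_of_mem_erase hj)]

lemma IsSmooth.update {w : Fin r → Euc N → ℝ} (hw : ∀ k, IsSmooth (w k)) (k : Fin r)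
    {g : Euc N → ℝ} (hg : IsSmooth g) (j : Fin r) : IsSmooth (Function.update w k g j) := by
  by_cases h : j = k
  · subst h; simpa using hg
  · simpa [Function.update_of_ne h] using hw j

lemma integrable_mul_of_hasCompactSupport {f ψ : Euc N → ℝ} (hf : Continuous f)
    (hψ : Continuous ψ) (hc : HasCompactSupport ψ) : Integrable fun x => f x * ψ x :=
  (hf.mul hψ).integrable_of_hasCompactSupport hc.mul_left

lemma hasCompactSupport_pderivList {ψ : Euc N → ℝ} (hc : HasCompactSupport ψ)
    (l : List (Fin N)) : HasCompactSupport (pderivList l ψ) :=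
  hc.of_isClosed_subset (isClosed_tsupport _) (tsupport_pderivList_subset l ψ)

/-- Integration by parts for the constant-coefficient form `slotForm`. -/
lemma integral_slotForm_mul_pderiv' (α : Fin m → Fin r → Fin N) {w : Fin r → Euc N → ℝ}
    (hw : ∀ k, IsSmooth (w k)) {ψ : Euc N → ℝ} (hψ : IsSmooth ψ) (hc : HasCompactSupport ψ)
    (i : Fin N) :
    ∫ x, slotForm m α w x * pderiv' i ψ x =
      -∑ k, ∫ x, slotForm m α (Function.update w k (pderiv' i (w k))) x * ψ x := by
  have hs := IsSmooth.slotForm α hw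
  have hc' := hasCompactSupport_pderivList hc [i]
  have h := integral_mul_fderiv_eq_neg_fderiv_mul_of_integrable (μ := volume)
    (v := basisVec i) (f := slotForm m α w) (g := ψ)
    (integrable_mul_of_hasCompactSupport (hs.pderiv' i).continuous hψ.continuous hc)
    (integrable_mul_of_hasCompactSupport hs.continuous (hψ.pderiv' i).continuous hc')
    (integrable_mul_of_hasCompactSupport hs.continuous hψ.continuous hc)
    (fun x _ => hs.differentiable x) (fun x _ => hψ.differentiable x)
  refine h.trans ?_
  rw [← integral_finsetSum]
  · congr 1
    refine integral_congr_ae (Eventually.of_forall fun x => ?_)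
    have := pderiv'_slotForm α hw i x
    simp only [pderiv'] at this
    simp only [this, Finset.sum_mul]
  · intro k _
    exact integrable_mul_of_hasCompactSupport
      (IsSmooth.slotForm α (IsSmooth.update hw k ((hw k).pderiv' i))).continuous
      hψ.continuous hc

/-- One determinant factor: the derivative falling on the `κ`-th function can be moved onto the
test function. -/
lemma sum_sign_integral_slotForm (α : Fin m → Fin r → Fin N) (a : Fin r → Fin N)
    {w : Fin r → Euc N → ℝ} (hw : ∀ k, IsSmooth (w k)) {ψ : Euc N → ℝ} (hψ : IsSmooth ψ)
    (hc : HasCompactSupport ψ) (κ : Fin r) :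
    ∑ σ : Equiv.Perm (Fin r), ((Equiv.Perm.sign σ : ℤ) : ℝ) *
        ∫ x, slotForm m α (fun k => pderiv' (a (σ k)) (w k)) x * ψ x =
      -∑ σ : Equiv.Perm (Fin r), ((Equiv.Perm.sign σ : ℤ) : ℝ) *
        ∫ x, slotForm m α
          (Function.update (fun k => pderiv' (a (σ k)) (w k)) κ (w κ)) x *
            pderiv' (a (σ κ)) ψ x := by
  set W : Equiv.Perm (Fin r) → Fin r → Euc N → ℝ := fun σ =>
    Function.update (fun k => pderiv' (a (σ k)) (w k)) κ (w κ) with hW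
  have hWs : ∀ σ k, IsSmooth (W σ k) := fun σ k =>
    IsSmooth.update (fun k => (hw k).pderiv' _) κ (hw κ) k
  set T : Equiv.Perm (Fin r) → Fin r → ℝ := fun σ k =>
    ∫ x, slotForm m α (Function.update (W σ) k (pderiv' (a (σ κ)) (W σ k))) x * ψ x with hT
  have h1 : ∀ σ, ∫ x, slotForm m α (W σ) x * pderiv' (a (σ κ)) ψ x = -∑ k, T σ k := fun σ =>
    integral_slotForm_mul_pderiv' α (hWs σ) hψ hc _
  have h2 : ∀ σ, T σ κ = ∫ x, slotForm m α (fun k => pderiv' (a (σ k)) (w k)) x * ψ x := by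
    intro σ
    have : Function.update (W σ) κ (pderiv' (a (σ κ)) (W σ κ)) =
        fun k => pderiv' (a (σ k)) (w k) := by
      funext k
      by_cases hk : k = κ
      · subst hk; simp [hW]
      · simp [hW, Function.update_of_ne hk]
    simp only [hT, this]
  have h3 : ∀ k, k ≠ κ → ∑ σ : Equiv.Perm (Fin r), ((Equiv.Perm.sign σ : ℤ) : ℝ) * T σ k = 0 := by
    intro k hk
    refine Finset.sum_involution (fun σ _ => σ * Equiv.swap k κ) ?_ ?_ (by simp) ?_
    · intro σ _
      have hupd : Function.update (W (σ * Equiv.swap k κ)) k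
          (pderiv' (a ((σ * Equiv.swap k κ) κ)) (W (σ * Equiv.swap k κ) k)) =
          Function.update (W σ) k (pderiv' (a (σ κ)) (W σ k)) := by
        funext j
        by_cases hj : j = k
        · subst hj
          simp only [Function.update_self, hW, Function.update_of_ne hk, Equiv.Perm.mul_apply,
            Equiv.swap_apply_left, Equiv.swap_apply_right]
          exact pderiv'_comm (hw j) _ _
        · rw [Function.update_of_ne hj, Function.update_of_ne hj]
          by_cases hjκ : j = κ
          · subst hjκ; simp [hW]
          · simp [hW, Function.update_of_ne hjκ, Equiv.swap_apply_of_ne_of_ne hj hjκ]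
      have hTT : T (σ * Equiv.swap k κ) k = T σ k := by simp only [hT, hupd]
      rw [hTT, Equiv.Perm.sign_mul, Equiv.Perm.sign_swap hk]
      push_cast
      ring
    · intro σ _ _ h
      exact hk (by simpa [Equiv.swap_eq_one_iff] using h)
    · intro σ _
      simp [mul_assoc]
  have h4 : ∑ k, ∑ σ : Equiv.Perm (Fin r), ((Equiv.Perm.sign σ : ℤ) : ℝ) * T σ k =
      ∑ σ : Equiv.Perm (Fin r), ((Equiv.Perm.sign σ : ℤ) : ℝ) * T σ κ :=
    Finset.sum_eq_single κ (fun k _ hk => h3 k hk) (by simp)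
  have h5 : ∑ σ : Equiv.Perm (Fin r), ((Equiv.Perm.sign σ : ℤ) : ℝ) *
      ∫ x, slotForm m α (W σ) x * pderiv' (a (σ κ)) ψ x =
      -∑ σ : Equiv.Perm (Fin r), ((Equiv.Perm.sign σ : ℤ) : ℝ) * T σ κ := by
    rw [← h4, Finset.sum_comm, ← Finset.sum_neg_distrib]
    refine Finset.sum_congr rfl fun σ _ => ?_
    rw [h1, mul_neg, Finset.mul_sum]
  rw [h5, neg_neg]
  simp only [h2]

/-- Moving, for every slot `j`, the derivative falling on the factor `κ j` onto `ψ`: it suffices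
to bound the integrals of the resulting products. -/
lemma enorm_integral_slotForm_le {m : ℕ} (α : Fin m → Fin r → Fin N) (κ : Fin m → Fin r)
    {w : Fin r → Euc N → ℝ} (hw : ∀ k, IsSmooth (w k)) {ψ : Euc N → ℝ} (hψ : IsSmooth ψ)
    (hc : HasCompactSupport ψ) (B : ENNReal)
    (hB : ∀ (L : Fin r → List (Fin N)) (L' : List (Fin N)), L'.length = m →
      (∀ k, (L k).length + (Finset.univ.filter fun j => κ j = k).card = m) →
      ‖∫ x, (∏ k, pderivList (L k) (w k) x) * pderivList L' ψ x‖ₑ ≤ B) :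
    ‖∫ x, slotForm m α w x * ψ x‖ₑ ≤ (r.factorial : ENNReal) ^ m * B := by
  induction m generalizing w ψ with
  | zero =>
    have h := hB (fun _ => []) [] rfl (by simp)
    simpa [slotForm, pderivList] using h
  | succ m ih =>
    have hInt : ∀ σ : Equiv.Perm (Fin r), Integrable fun x =>
        ((Equiv.Perm.sign σ : ℤ) : ℝ) * (slotForm m (Fin.tail α)
          (fun k => pderiv' (α 0 (σ k)) (w k)) x * ψ x) := fun σ =>
      (integrable_mul_of_hasCompactSupport
        (IsSmooth.slotForm _ fun k => (hw k).pderiv' _).continuous hψ.continuous hc).const_mul _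
    have h1 : ∫ x, slotForm (m + 1) α w x * ψ x =
        ∑ σ : Equiv.Perm (Fin r), ((Equiv.Perm.sign σ : ℤ) : ℝ) *
          ∫ x, slotForm m (Fin.tail α) (fun k => pderiv' (α 0 (σ k)) (w k)) x * ψ x := by
      simp only [slotForm_succ α hw, Finset.sum_mul, mul_assoc]
      rw [integral_finsetSum _ fun σ _ => hInt σ]
      simp only [integral_const_mul]
    rw [h1, sum_sign_integral_slotForm _ _ hw hψ hc (κ 0), enorm_neg]
    refine (enorm_sum_le _ _).trans ?_
    have h2 : ∀ σ : Equiv.Perm (Fin r), ‖((Equiv.Perm.sign σ : ℤ) : ℝ) *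
        ∫ x, slotForm m (Fin.tail α)
          (Function.update (fun k => pderiv' (α 0 (σ k)) (w k)) (κ 0) (w (κ 0))) x *
            pderiv' (α 0 (σ (κ 0))) ψ x‖ₑ ≤ (r.factorial : ENNReal) ^ m * B := by
      intro σ
      have hsgn : ‖((Equiv.Perm.sign σ : ℤ) : ℝ)‖ₑ = 1 := by
        rcases Int.units_eq_one_or (Equiv.Perm.sign σ) with h | h <;> simp [h]
      rw [enorm_mul, hsgn, one_mul]
      refine ih (Fin.tail α) (Fin.tail κ)
        (IsSmooth.update (fun k => (hw k).pderiv' _) _ (hw _)) (hψ.pderiv' _)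
        (hasCompactSupport_pderivList hc [_]) ?_
      intro L L' hL' hL
      have hcard : ∀ k, (Finset.univ.filter fun j => κ j = k).card =
          (if κ 0 = k then 1 else 0) +
            (Finset.univ.filter fun j => Fin.tail κ j = k).card := by
        intro k
        simp only [Finset.card_filter, Fin.sum_univ_succ]
        rfl
      have h := hB (fun k => if κ 0 = k then L k else L k ++ [α 0 (σ k)])
        (L' ++ [α 0 (σ (κ 0))]) (by simp [hL']) (fun k => by
          rw [hcard]
          have := hL k
          split_ifs
          · omega
          · rw [List.length_append, List.length_singleton]
            omega)
      refine le_trans (le_of_eq ?_) h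
      congr 2
      funext x
      rw [pderivList_append]
      congr 1
      refine Finset.prod_congr rfl fun k _ => ?_
      by_cases hk : κ 0 = k
      · subst hk; simp
      · rw [Function.update_of_ne (Ne.symm hk), if_neg hk, pderivList_append]
        rfl
    refine (Finset.sum_le_sum fun σ _ => h2 σ).trans (le_of_eq ?_)
    rw [Finset.sum_const, Finset.card_univ, Fintype.card_perm, Fintype.card_fin, nsmul_eq_mul]
    ring

end SlotForm

/-! ### Differentiation of integrals over compact sets -/

lemma hasDerivAt_integral_of_continuous {N : ℕ} {Φ Φ' : ℝ → Euc N → ℝ} {K : Set (Euc N)}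
    (hK : IsCompact K) (hΦ : Continuous Φ.uncurry) (hΦ' : Continuous Φ'.uncurry)
    (hΦK : ∀ s, ∀ y ∉ K, Φ s y = 0) (hΦK' : ∀ s, ∀ y ∉ K, Φ' s y = 0)
    (h : ∀ s y, HasDerivAt (fun s => Φ s y) (Φ' s y) s) (s₀ : ℝ) :
    HasDerivAt (fun s => ∫ y, Φ s y) (∫ y, Φ' s₀ y) s₀ := by
  obtain ⟨C, hC⟩ := ((isCompact_closedBall s₀ 1).prod hK).exists_bound_of_continuousOn
    hΦ'.continuousOn
  have hcont : ∀ s, Continuous (Φ s) := fun s => hΦ.comp (by fun_prop : Continuous fun y => (s, y))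
  have hcont' : ∀ s, Continuous (Φ' s) := fun s =>
    hΦ'.comp (by fun_prop : Continuous fun y => (s, y))
  refine (hasDerivAt_integral_of_dominated_loc_of_deriv_le
    (bound := K.indicator fun _ => C) (Metric.ball_mem_nhds s₀ one_pos)
    (Eventually.of_forall fun s => (hcont s).aestronglyMeasurable)
    ((hcont s₀).integrable_of_hasCompactSupport (HasCompactSupport.intro hK (hΦK s₀)))
    (hcont' s₀).aestronglyMeasurable (Eventually.of_forall fun y s hs => ?_) ?_
    (Eventually.of_forall fun y s _ => h s y)).2
  · by_cases hy : y ∈ K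
    · rw [Set.indicator_of_mem hy]
      exact hC (s, y) ⟨Metric.ball_subset_closedBall hs, hy⟩
    · rw [Set.indicator_of_notMem hy, hΦK' s y hy, norm_zero]
  · exact (integrable_indicator_iff hK.measurableSet).2
      (integrableOn_const hK.measure_lt_top.ne)

/-! ### Dilated averages -/

/-- The average `∫ η(y) g(x + t y) dy`. -/
def dilAvg {N : ℕ} (η : Euc N → ℝ) (t : ℝ) (g : Euc N → ℝ) (x : Euc N) : ℝ :=
  ∫ y, η y * g (x + t • y)

section DilAvg

variable {N : ℕ} {η g : Euc N → ℝ}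

lemma contDiff_dilAvg (hη : IsSmooth η) (hc : HasCompactSupport η) (hg : IsSmooth g) :
    ContDiff ℝ (⊤ : ℕ∞) fun p : ℝ × Euc N => dilAvg η p.1 g p.2 := by
  have key := contDiffOn_convolution_right_with_param_comp (μ := (volume : Measure (Euc N)))
    (𝕜 := ℝ) (n := (⊤ : ℕ∞)) (ContinuousLinearMap.mul ℝ ℝ) (s := (Set.univ : Set (ℝ × Euc N)))
    (v := fun _ => (0 : Euc N)) contDiffOn_const (f := fun _ => (1 : ℝ))
    (g := fun p z => η (-z) * g (p.2 + p.1 • (-z)))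
    (k := -tsupport η) isOpen_univ (by simpa using IsCompact.neg hc) (by
      intro p x _ hx
      have : η (-x) = 0 := image_eq_zero_of_notMem_tsupport (by simpa using hx)
      simp [this]) (locallyIntegrable_const _) (by
      apply ContDiff.contDiffOn
      have h1 : ContDiff ℝ (⊤ : ℕ∞) fun p : (ℝ × Euc N) × Euc N => η (-p.2) :=
        hη.comp contDiff_snd.neg
      have h2 : ContDiff ℝ (⊤ : ℕ∞) fun p : (ℝ × Euc N) × Euc N => g (p.1.2 + p.1.1 • (-p.2)) :=
        hg.comp (by fun_prop)
      exact h1.mul h2)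
  rw [contDiffOn_univ] at key
  convert key using 1
  funext p
  simp [dilAvg, MeasureTheory.convolution]

lemma IsSmooth.dilAvg (hη : IsSmooth η) (hc : HasCompactSupport η) (hg : IsSmooth g) (t : ℝ) :
    IsSmooth (dilAvg η t g) :=
  (contDiff_dilAvg hη hc hg).comp (by fun_prop : ContDiff ℝ _ fun x : Euc N => (t, x))

lemma hasDerivAt_dilAvg_line (hη : IsSmooth η) (hc : HasCompactSupport η) (hg : IsSmooth g)
    (t c : ℝ) (x v : Euc N) (s₀ : ℝ) :
    HasDerivAt (fun s => dilAvg η (t + s * c) g (x + s • v))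
      (∫ y, η y * fderiv ℝ g (x + s₀ • v + (t + s₀ * c) • y) (v + c • y)) s₀ := by
  unfold _root_.dilAvg
  have hη0 : ∀ y ∉ tsupport η, η y = 0 := fun y hy => image_eq_zero_of_notMem_tsupport hy
  have hcη := hη.continuous
  have hcg := hg.continuous
  have hdg : Continuous (fderiv ℝ g) := hg.continuous_fderiv (by simp)
  refine hasDerivAt_integral_of_continuous
    (Φ' := fun s y => η y * fderiv ℝ g (x + s • v + (t + s * c) • y) (v + c • y)) hc
    (by fun_prop) (by unfold Function.uncurry; fun_prop)
    (fun s y hy => by simp [hη0 y hy]) (fun s y hy => by simp [hη0 y hy]) (fun s y => ?_) s₀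
  refine HasDerivAt.const_mul _ ?_
  have h1 : HasDerivAt (fun s : ℝ => x + s • v + (t + s * c) • y) (v + c • y) s := by
    have ha := ((hasDerivAt_id s).smul_const v).const_add x
    have hb := ((((hasDerivAt_id s).mul_const c).const_add t).smul_const y)
    simpa using ha.fun_add hb
  exact (hg.differentiable _).hasFDerivAt.comp_hasDerivAt s h1

lemma pderiv'_dilAvg (hη : IsSmooth η) (hc : HasCompactSupport η) (hg : IsSmooth g) (t : ℝ)
    (i : Fin N) : pderiv' i (dilAvg η t g) = dilAvg η t (pderiv' i g) := by
  funext x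
  have h1 := hasDerivAt_dilAvg_line hη hc hg t 0 x (basisVec i) 0
  have h2 : HasDerivAt (fun s : ℝ => x + s • basisVec i) (basisVec i) 0 := by
    simpa using ((hasDerivAt_id (0 : ℝ)).smul_const (basisVec i)).const_add x
  have h3 := (((IsSmooth.dilAvg hη hc hg t).differentiable
    (x + (0 : ℝ) • basisVec i)).hasFDerivAt).comp_hasDerivAt (0 : ℝ) h2
  have h4 := h3.unique (by simpa [Function.comp_def] using h1)
  simpa [pderiv', dilAvg] using h4

lemma fderiv_apply_eq_sum (f : Euc N → ℝ) (x y : Euc N) :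
    fderiv ℝ f x y = ∑ i, y i * pderiv' i f x := by
  have : y = ∑ i, y i • basisVec i := by
    ext j
    simp [basisVec, Finset.sum_apply, Pi.single_apply]
  conv_lhs => rw [this]
  simp [pderiv']

lemma integrable_dilAvg (hη : IsSmooth η) (hc : HasCompactSupport η) (hg : Continuous g)
    (t : ℝ) (x : Euc N) : Integrable fun y => η y * g (x + t • y) := by
  have hcη := hη.continuous
  exact Continuous.integrable_of_hasCompactSupport (by fun_prop) hc.mul_right

/-- The kernel `y_i η(y)`. -/
def coordMul (i : Fin N) (η : Euc N → ℝ) : Euc N → ℝ := fun y => y i * η y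

lemma IsSmooth.coordMul (hη : IsSmooth η) (i : Fin N) : IsSmooth (coordMul i η) := by
  unfold _root_.coordMul
  exact ContDiff.mul (by fun_prop) hη

lemma hasCompactSupport_coordMul (hc : HasCompactSupport η) (i : Fin N) :
    HasCompactSupport (coordMul i η) := hc.mul_left

lemma tsupport_coordMul_subset (i : Fin N) (η : Euc N → ℝ) :
    tsupport (coordMul i η) ⊆ tsupport η :=
  closure_mono fun y hy h => hy (by simp [coordMul, h])

lemma hasDerivAt_dilAvg (hη : IsSmooth η) (hc : HasCompactSupport η) (hg : IsSmooth g) (t : ℝ)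
    (x : Euc N) : HasDerivAt (fun t => dilAvg η t g x)
      (∑ i, dilAvg (coordMul i η) t (pderiv' i g) x) t := by
  have h1 := hasDerivAt_dilAvg_line hη hc hg 0 1 x 0 t
  simp only [zero_add, mul_one, smul_zero, add_zero, one_smul] at h1
  convert h1 using 1
  simp only [fderiv_apply_eq_sum, Finset.mul_sum]
  rw [integral_finsetSum]
  · refine Finset.sum_congr rfl fun i _ => integral_congr_ae (Eventually.of_forall fun y => ?_)
    simp only [coordMul]
    ring
  · intro i _
    have := integrable_dilAvg (hη.coordMul i) (hasCompactSupport_coordMul hc i)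
      (hg.pderiv' i).continuous t x
    refine this.congr (Eventually.of_forall fun y => ?_)
    simp only [coordMul]
    ring

lemma mul_dilAvg_pderiv' (hη : IsSmooth η) (hc : HasCompactSupport η) (hg : IsSmooth g) (t : ℝ)
    (i : Fin N) (x : Euc N) :
    t * dilAvg η t (pderiv' i g) x = -dilAvg (pderiv' i η) t g x := by
  have hgs : IsSmooth fun y => g (x + t • y) := hg.comp (by fun_prop)
  have hd : ∀ y, fderiv ℝ (fun y => g (x + t • y)) y (basisVec i) =
      t * pderiv' i g (x + t • y) := by
    intro y
    have h2 : HasFDerivAt (fun y : Euc N => x + t • y) (t • ContinuousLinearMap.id ℝ (Euc N)) y :=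
      ((hasFDerivAt_id y).const_smul t).const_add x
    have h3 := ((hg.differentiable (x + t • y)).hasFDerivAt.comp y h2).fderiv
    have h4 : fderiv ℝ (fun y => g (x + t • y)) y = _ := h3
    rw [h4]
    simp [pderiv']
  have h := integral_mul_fderiv_eq_neg_fderiv_mul_of_integrable (μ := volume)
    (v := basisVec i) (f := fun y => g (x + t • y)) (g := η)
    (integrable_mul_of_hasCompactSupport (hgs.pderiv' i).continuous hη.continuous hc)
    (integrable_mul_of_hasCompactSupport hgs.continuous (hη.pderiv' i).continuous
      (hasCompactSupport_pderivList hc [i]))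
    (integrable_mul_of_hasCompactSupport hgs.continuous hη.continuous hc)
    (fun x _ => hgs.differentiable x) (fun x _ => hη.differentiable x)
  have e1 : dilAvg (pderiv' i η) t g x = ∫ y, g (x + t • y) * fderiv ℝ η y (basisVec i) := by
    simp only [dilAvg, pderiv', mul_comm]
  rw [e1, h, neg_neg]
  simp only [hd, dilAvg]
  rw [← integral_const_mul]
  refine integral_congr_ae (Eventually.of_forall fun y => ?_)
  simp only
  ring

lemma pow_mul_dilAvg_pderivList (hη : IsSmooth η) (hc : HasCompactSupport η) (hg : IsSmooth g)
    (t : ℝ) (l : List (Fin N)) (x : Euc N) :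
    t ^ l.length * dilAvg η t (pderivList l g) x =
      (-1) ^ l.length * dilAvg (pderivList l.reverse η) t g x := by
  induction l generalizing η with
  | nil => simp [pderivList]
  | cons i l ih =>
    have h1 := mul_dilAvg_pderiv' hη hc (hg.pderivList l) t i x
    have h2 := ih (hη.pderiv' i) (hasCompactSupport_pderivList hc [i])
    simp only [pderivList, List.length_cons, pow_succ, List.reverse_cons]
    rw [pderivList_append]
    simp only [pderivList]
    calc _ = t ^ l.length * (t * dilAvg η t (pderiv' i (pderivList l g)) x) := by ring
      _ = _ := by rw [h1, mul_neg, h2]; ring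

lemma integral_pderivList_eq_zero (hη : IsSmooth η) (hc : HasCompactSupport η)
    {l : List (Fin N)} (hl : l ≠ []) : ∫ y, pderivList l η y = 0 := by
  obtain ⟨i, l, rfl⟩ := List.exists_cons_of_ne_nil hl
  have hs := hη.pderivList l
  have h := mul_dilAvg_pderiv' (g := fun _ => 1) hs (hasCompactSupport_pderivList hc l)
    contDiff_const 0 i 0
  simpa [dilAvg, pderivList] using h

lemma dilAvg_zero (g : Euc N → ℝ) (x : Euc N) : dilAvg η 0 g x = (∫ y, η y) * g x := by
  simp [dilAvg, integral_mul_const]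

end DilAvg

/-! ### Averaged Taylor expansions -/

/-- `∫ η(y) D^j g(x + t y)[y,…,y] dy`. -/
def taylorAvg {N : ℕ} : ℕ → (Euc N → ℝ) → ℝ → (Euc N → ℝ) → Euc N → ℝ
  | 0, η, t, g => dilAvg η t g
  | j + 1, η, t, g => fun x => ∑ i, taylorAvg j (coordMul i η) t (pderiv' i g) x

/-- The averaged Taylor polynomial of order `m` of `g`, with centre `x + t y`, evaluated
at `x`. -/
def avgTaylor {N : ℕ} (m : ℕ) (η : Euc N → ℝ) (t : ℝ) (g : Euc N → ℝ) (x : Euc N) : ℝ :=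
  ∑ j ∈ Finset.range m, (-t) ^ j / j.factorial * taylorAvg j η t g x

section TaylorAvg

variable {N : ℕ} {η g : Euc N → ℝ}

lemma contDiff_taylorAvg (j : ℕ) (hη : IsSmooth η) (hc : HasCompactSupport η)
    (hg : IsSmooth g) :
    ContDiff ℝ (⊤ : ℕ∞) fun p : ℝ × Euc N => taylorAvg j η p.1 g p.2 := by
  induction j generalizing η g with
  | zero => exact contDiff_dilAvg hη hc hg
  | succ j ih =>
    exact ContDiff.sum fun i _ =>
      ih (hη.coordMul i) (hasCompactSupport_coordMul hc i) (hg.pderiv' i)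

lemma IsSmooth.taylorAvg (j : ℕ) (hη : IsSmooth η) (hc : HasCompactSupport η)
    (hg : IsSmooth g) (t : ℝ) : IsSmooth (taylorAvg j η t g) :=
  (contDiff_taylorAvg j hη hc hg).comp (by fun_prop : ContDiff ℝ _ fun x : Euc N => (t, x))

lemma pderiv'_sum {ι : Type*} (s : Finset ι) {f : ι → Euc N → ℝ} (hf : ∀ i, IsSmooth (f i))
    (i : Fin N) : pderiv' i (fun x => ∑ a ∈ s, f a x) = fun x => ∑ a ∈ s, pderiv' i (f a) x := by
  funext x
  unfold pderiv'
  rw [(HasFDerivAt.fun_sum fun a _ => ((hf a).differentiable x).hasFDerivAt).fderiv]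
  simp

lemma pderiv'_taylorAvg (j : ℕ) (hη : IsSmooth η) (hc : HasCompactSupport η)
    (hg : IsSmooth g) (t : ℝ) (i : Fin N) :
    pderiv' i (taylorAvg j η t g) = taylorAvg j η t (pderiv' i g) := by
  induction j generalizing η g with
  | zero => exact pderiv'_dilAvg hη hc hg t i
  | succ j ih =>
    simp only [taylorAvg]
    rw [pderiv'_sum]
    · funext x
      refine Finset.sum_congr rfl fun l _ => ?_
      rw [ih (hη.coordMul l) (hasCompactSupport_coordMul hc l) (hg.pderiv' l),
        pderiv'_comm hg]
    · exact fun l =>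
        IsSmooth.taylorAvg j (hη.coordMul l) (hasCompactSupport_coordMul hc l) (hg.pderiv' l) t

lemma hasDerivAt_taylorAvg (j : ℕ) (hη : IsSmooth η) (hc : HasCompactSupport η)
    (hg : IsSmooth g) (t : ℝ) (x : Euc N) :
    HasDerivAt (fun t => taylorAvg j η t g x) (taylorAvg (j + 1) η t g x) t := by
  induction j generalizing η g with
  | zero => exact hasDerivAt_dilAvg hη hc hg t x
  | succ j ih =>
    exact HasDerivAt.fun_sum fun i _ =>
      ih (hη.coordMul i) (hasCompactSupport_coordMul hc i) (hg.pderiv' i)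

variable (m : ℕ)

lemma contDiff_avgTaylor (hη : IsSmooth η) (hc : HasCompactSupport η) (hg : IsSmooth g) :
    ContDiff ℝ (⊤ : ℕ∞) fun p : ℝ × Euc N => avgTaylor m η p.1 g p.2 :=
  ContDiff.sum fun j _ => ContDiff.mul (by fun_prop) (contDiff_taylorAvg j hη hc hg)

lemma IsSmooth.avgTaylor (hη : IsSmooth η) (hc : HasCompactSupport η)
    (hg : IsSmooth g) (t : ℝ) : IsSmooth (avgTaylor m η t g) :=
  (contDiff_avgTaylor m hη hc hg).comp (by fun_prop : ContDiff ℝ _ fun x : Euc N => (t, x))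

lemma pderiv'_const_mul {f : Euc N → ℝ} (hf : IsSmooth f) (c : ℝ) (i : Fin N) :
    pderiv' i (fun x => c * f x) = fun x => c * pderiv' i f x := by
  funext x
  unfold pderiv'
  rw [((hf.differentiable x).hasFDerivAt.const_mul c).fderiv]
  simp

lemma pderiv'_avgTaylor (hη : IsSmooth η) (hc : HasCompactSupport η)
    (hg : IsSmooth g) (t : ℝ) (i : Fin N) :
    pderiv' i (avgTaylor m η t g) = avgTaylor m η t (pderiv' i g) := by
  have h := fun j => IsSmooth.taylorAvg j hη hc hg t
  unfold avgTaylor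
  rw [pderiv'_sum _ fun j => contDiff_const.mul (h j)]
  funext x
  refine Finset.sum_congr rfl fun j _ => ?_
  rw [pderiv'_const_mul (h j), pderiv'_taylorAvg j hη hc hg]

lemma pderivList_avgTaylor (hη : IsSmooth η) (hc : HasCompactSupport η)
    (hg : IsSmooth g) (t : ℝ) (l : List (Fin N)) :
    pderivList l (avgTaylor m η t g) = avgTaylor m η t (pderivList l g) := by
  induction l with
  | nil => rfl
  | cons i l ih =>
    simp only [pderivList]
    rw [ih, pderiv'_avgTaylor m hη hc (hg.pderivList l)]

lemma hasDerivAt_avgTaylor (hη : IsSmooth η) (hc : HasCompactSupport η)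
    (hg : IsSmooth g) (t : ℝ) (x : Euc N) :
    HasDerivAt (fun t => avgTaylor (m + 1) η t g x)
      ((-t) ^ m / m.factorial * taylorAvg (m + 1) η t g x) t := by
  induction m with
  | zero => simpa [avgTaylor] using hasDerivAt_taylorAvg 0 hη hc hg t x
  | succ m ih =>
    have h1 : HasDerivAt (fun t : ℝ => (-t) ^ (m + 1) / (m + 1).factorial)
        (-((-t) ^ m / m.factorial)) t := by
      have := ((hasDerivAt_neg t).fun_pow (m + 1)).div_const ((m + 1).factorial : ℝ)
      refine this.congr_deriv ?_
      have : (m.factorial : ℝ) ≠ 0 := by positivity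
      rw [Nat.factorial_succ]
      push_cast
      field_simp
    have h2 := ih.add (h1.mul (hasDerivAt_taylorAvg (m + 1) hη hc hg t x))
    refine HasDerivAt.congr_deriv (HasDerivAt.congr_of_eventuallyEq h2
      (Eventually.of_forall fun s => ?_)) ?_
    · simp [avgTaylor, Finset.sum_range_succ]
    · ring

lemma avgTaylor_zero (hη : ∫ y, η y = 1) (g : Euc N → ℝ) :
    avgTaylor (m + 1) η 0 g = g := by
  funext x
  rw [avgTaylor, Finset.sum_range_succ']
  simp [taylorAvg, dilAvg_zero, hη]

end TaylorAvg

/-! ### Bounds for averaged Taylor expansions -/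

/-- Uniform constants for the finitely many words of bounded length. -/
lemma exists_uniform_words {N : ℕ} (d : ℕ) {P : List (Fin N) → ℝ → Prop}
    (hmono : ∀ W C C', C ≤ C' → P W C → P W C') (h : ∀ W, W.length ≤ d → ∃ C, P W C) :
    ∃ C, 0 ≤ C ∧ ∀ W, W.length ≤ d → P W C := by
  have hfin : {W : List (Fin N) | W.length ≤ d}.Finite := List.finite_length_le (Fin N) d
  choose! c hc using h
  refine ⟨∑ W ∈ hfin.toFinset, |c W|, Finset.sum_nonneg fun _ _ => abs_nonneg _, fun W hW => ?_⟩
  refine hmono W _ _ ((le_abs_self _).trans ?_) (hc W hW)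
  exact Finset.single_le_sum (f := fun W => |c W|) (fun _ _ => abs_nonneg _)
    (hfin.mem_toFinset.2 hW)

/-- The averaged oscillation of the derivatives of order `k` of `u` over `x + t Y`. -/
def oscAvg {N : ℕ} (k : ℕ) (Y : Set (Euc N)) (u : Euc N → ℝ) (t : ℝ) (x : Euc N) : ℝ :=
  ∑ l : Fin k → Fin N,
    ∫ y in Y, |pderivList (List.ofFn l) u (x + t • y) - pderivList (List.ofFn l) u x|

section TaylorBounds

variable {N : ℕ} {η u : Euc N → ℝ} {Y : Set (Euc N)}

lemma oscAvg_nonneg (k : ℕ) (t : ℝ) (x : Euc N) : 0 ≤ oscAvg k Y u t x :=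
  Finset.sum_nonneg fun _ _ => integral_nonneg fun _ => abs_nonneg _

lemma abs_dilAvg_le (hY : IsCompact Y) (hηY : tsupport η ⊆ Y) {B : ℝ}
    (hB : ∀ y, |η y| ≤ B) {g : Euc N → ℝ} (hg : Continuous g) (t : ℝ) (x : Euc N) :
    |dilAvg η t g x| ≤ B * ∫ y in Y, |g (x + t • y)| := by
  have h1 : dilAvg η t g x = ∫ y in Y, η y * g (x + t • y) := by
    rw [dilAvg, setIntegral_eq_integral_of_forall_compl_eq_zero]
    intro y hy
    simp [image_eq_zero_of_notMem_tsupport fun h => hy (hηY h)]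
  rw [h1, ← integral_const_mul]
  refine abs_integral_le_integral_abs.trans (integral_mono_of_nonneg
    (Eventually.of_forall fun _ => abs_nonneg _) ?_ (Eventually.of_forall fun y => ?_))
  · exact (Continuous.continuousOn (by fun_prop)).integrableOn_compact hY
  · simp only [abs_mul]
    exact mul_le_mul_of_nonneg_right (hB y) (abs_nonneg _)

lemma exists_abs_le_of_hasCompactSupport (hη : Continuous η) (hc : HasCompactSupport η) :
    ∃ B, 0 ≤ B ∧ ∀ y, |η y| ≤ B := by
  obtain ⟨B, hB⟩ := hη.bounded_above_of_compact_support hc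
  exact ⟨B, (norm_nonneg _).trans (hB 0), hB⟩

lemma exists_taylorAvg_bound (hY : IsCompact Y) (k j a : ℕ) (ha : 1 ≤ a) (W : List (Fin N))
    (hW : W.length + j = k + a) (hη : IsSmooth η) (hηY : tsupport η ⊆ Y) :
    ∃ C, 0 ≤ C ∧ ∀ u : Euc N → ℝ, IsSmooth u → ∀ t : ℝ, 0 < t → ∀ x,
      t ^ a * |taylorAvg j η t (pderivList W u) x| ≤ C * oscAvg k Y u t x := by
  induction j generalizing η W with
  | zero =>
    have hc : HasCompactSupport η := hY.of_isClosed_subset (isClosed_tsupport _) hηY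
    set W₁ := W.take a with hW₁
    set W₂ := W.drop a with hW₂
    have hl₁ : W₁.length = a := by simp [hW₁]; omega
    have hl₂ : W₂.length = k := by simp [hW₂]; omega
    have hWW : W = W₁ ++ W₂ := (List.take_append_drop a W).symm
    have hrev : W₁.reverse ≠ [] := by
      intro h
      have := congrArg List.length h
      simp [hl₁] at this
      omega
    set η' := pderivList W₁.reverse η with hη'
    have hη's : IsSmooth η' := hη.pderivList _
    have hη'Y : tsupport η' ⊆ Y := (tsupport_pderivList_subset _ _).trans hηY
    have hc' : HasCompactSupport η' := hasCompactSupport_pderivList hc _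
    obtain ⟨B, hB0, hB⟩ := exists_abs_le_of_hasCompactSupport hη's.continuous hc'
    refine ⟨B, hB0, fun u hu t ht x => ?_⟩
    have hg : IsSmooth (pderivList W₂ u) := hu.pderivList _
    have e1 : t ^ a * |dilAvg η t (pderivList W u) x| = |dilAvg η' t (pderivList W₂ u) x| := by
      have h := pow_mul_dilAvg_pderivList hη hc hg t W₁ x
      have h' := congrArg abs h
      rw [← pderivList_append, ← hWW, hl₁, abs_mul, abs_mul, abs_pow, abs_pow, abs_neg, abs_one,
        one_pow, one_mul, abs_of_pos ht] at h'
      exact h'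
    have e2 : dilAvg η' t (pderivList W₂ u) x =
        dilAvg η' t (fun z => pderivList W₂ u z - pderivList W₂ u x) x := by
      have h0 := integral_pderivList_eq_zero hη hc hrev
      simp only [dilAvg, mul_sub]
      rw [integral_sub (integrable_dilAvg hη's hc' hg.continuous t x)
        ((hη's.continuous.integrable_of_hasCompactSupport hc').mul_const _),
        integral_mul_const, h0, zero_mul, sub_zero]
    simp only [taylorAvg]
    rw [e1, e2]
    refine (abs_dilAvg_le hY hη'Y hB
      (hg.continuous.sub continuous_const) t x).trans ?_
    refine mul_le_mul_of_nonneg_left ?_ hB0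
    have hW₂' : W₂ = List.ofFn (fun i : Fin k => W₂.get (i.cast hl₂.symm)) := by
      apply List.ext_get
      · simp [hl₂]
      · intro n h1 h2
        simp
    rw [oscAvg]
    conv_lhs => rw [hW₂']
    exact Finset.single_le_sum (f := fun l : Fin k → Fin N => ∫ y in Y,
      |pderivList (List.ofFn l) u (x + t • y) - pderivList (List.ofFn l) u x|)
      (fun _ _ => integral_nonneg fun _ => abs_nonneg _) (Finset.mem_univ _)
  | succ j ih =>
    have h : ∀ i, ∃ C, 0 ≤ C ∧ ∀ u : Euc N → ℝ, IsSmooth u → ∀ t : ℝ, 0 < t → ∀ x,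
        t ^ a * |taylorAvg j (coordMul i η) t (pderivList (i :: W) u) x| ≤
          C * oscAvg k Y u t x := fun i =>
      ih (i :: W) (by simp; omega) (hη.coordMul i) ((tsupport_coordMul_subset i η).trans hηY)
    choose C hC0 hC using h
    refine ⟨∑ i, C i, Finset.sum_nonneg fun i _ => hC0 i, fun u hu t ht x => ?_⟩
    simp only [taylorAvg]
    rw [Finset.sum_mul]
    refine (mul_le_mul_of_nonneg_left (Finset.abs_sum_le_sum_abs _ _) (by positivity)).trans ?_
    rw [Finset.mul_sum]
    exact Finset.sum_le_sum fun i _ => hC i u hu t ht x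

lemma exists_taylorAvg_one_bound (hY : IsCompact Y) (j : ℕ) (W : List (Fin N))
    (hη : IsSmooth η) (hηY : tsupport η ⊆ Y) :
    ∃ C, 0 ≤ C ∧ ∀ u : Euc N → ℝ, IsSmooth u → ∀ x,
      |taylorAvg j η 1 (pderivList W u) x| ≤ C * ∫ y in Y, |u (x + y)| := by
  induction j generalizing η W with
  | zero =>
    have hc : HasCompactSupport η := hY.of_isClosed_subset (isClosed_tsupport _) hηY
    have hη's : IsSmooth (pderivList W.reverse η) := hη.pderivList _
    obtain ⟨B, hB0, hB⟩ := exists_abs_le_of_hasCompactSupport hη's.continuous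
      (hasCompactSupport_pderivList hc _)
    refine ⟨B, hB0, fun u hu x => ?_⟩
    have h := congrArg abs (pow_mul_dilAvg_pderivList hη hc hu 1 W x)
    rw [one_pow, one_mul, abs_mul, abs_pow, abs_neg, abs_one, one_pow, one_mul] at h
    simp only [taylorAvg]
    rw [h]
    simpa using abs_dilAvg_le hY
      ((tsupport_pderivList_subset _ _).trans hηY) hB hu.continuous 1 x
  | succ j ih =>
    have h := fun i =>
      ih (i :: W) (hη.coordMul i) ((tsupport_coordMul_subset i η).trans hηY)
    choose C hC0 hC using h
    refine ⟨∑ i, C i, Finset.sum_nonneg fun i _ => hC0 i, fun u hu x => ?_⟩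
    simp only [taylorAvg]
    rw [Finset.sum_mul]
    exact (Finset.abs_sum_le_sum_abs _ _).trans (Finset.sum_le_sum fun i _ => hC i u hu x)

lemma exists_avgTaylor_bound (hY : IsCompact Y) (k a : ℕ) (ha : 1 ≤ a)
    (hη : IsSmooth η) (hηY : tsupport η ⊆ Y) :
    ∃ C, 0 ≤ C ∧ ∀ W : List (Fin N), W.length ≤ k + a → W.length = k + a →
      ∀ u : Euc N → ℝ, IsSmooth u → ∀ t : ℝ, 0 < t → ∀ x,
        t ^ a * |pderivList W (avgTaylor (k + a) η t u) x| ≤ C * oscAvg k Y u t x := by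
  refine exists_uniform_words (k + a) (P := fun W C => W.length = k + a →
    ∀ u : Euc N → ℝ, IsSmooth u → ∀ t : ℝ, 0 < t → ∀ x,
      t ^ a * |pderivList W (avgTaylor (k + a) η t u) x| ≤ C * oscAvg k Y u t x) ?_ ?_
  · intro W C C' hCC h hW u hu t ht x
    exact (h hW u hu t ht x).trans (mul_le_mul_of_nonneg_right hCC (oscAvg_nonneg _ _ _))
  intro W _
  by_cases hW : W.length = k + a
  · have hc : HasCompactSupport η := hY.of_isClosed_subset (isClosed_tsupport _) hηY
    choose C hC0 hC using fun j =>
      exists_taylorAvg_bound hY k j (a + j) (by omega) W (by omega) hη hηY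
    refine ⟨∑ j ∈ Finset.range (k + a), C j / j.factorial, fun _ u hu t ht x => ?_⟩
    rw [pderivList_avgTaylor _ hη hc hu, avgTaylor, Finset.sum_mul]
    refine (mul_le_mul_of_nonneg_left (Finset.abs_sum_le_sum_abs _ _) (by positivity)).trans ?_
    rw [Finset.mul_sum]
    refine Finset.sum_le_sum fun j _ => ?_
    rw [abs_mul, abs_div, abs_pow, abs_neg, abs_of_pos ht, Nat.abs_cast]
    calc _ = (t ^ (a + j) * |taylorAvg j η t (pderivList W u) x|) / j.factorial := by
          rw [pow_add]; ring
      _ ≤ (C j * oscAvg k Y u t x) / j.factorial :=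
          div_le_div_of_nonneg_right (hC j u hu t ht x) (by positivity)
      _ = _ := by ring
  · exact ⟨0, fun h => absurd h hW⟩

lemma exists_avgTaylor_one_bound (hY : IsCompact Y) (m d : ℕ)
    (hη : IsSmooth η) (hηY : tsupport η ⊆ Y) :
    ∃ C, 0 ≤ C ∧ ∀ W : List (Fin N), W.length ≤ d →
      ∀ u : Euc N → ℝ, IsSmooth u → ∀ x,
        |pderivList W (avgTaylor m η 1 u) x| ≤ C * ∫ y in Y, |u (x + y)| := by
  refine exists_uniform_words d (P := fun W C => ∀ u : Euc N → ℝ, IsSmooth u → ∀ x,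
        |pderivList W (avgTaylor m η 1 u) x| ≤ C * ∫ y in Y, |u (x + y)|) ?_ ?_
  · intro W C C' hCC h u hu x
    exact (h u hu x).trans (mul_le_mul_of_nonneg_right hCC
      (integral_nonneg fun _ => abs_nonneg _))
  intro W _
  have hc : HasCompactSupport η := hY.of_isClosed_subset (isClosed_tsupport _) hηY
  choose C hC0 hC using fun j => exists_taylorAvg_one_bound hY j W hη hηY
  refine ⟨∑ j ∈ Finset.range m, C j, fun u hu x => ?_⟩
  rw [pderivList_avgTaylor _ hη hc hu, avgTaylor, Finset.sum_mul]
  refine (Finset.abs_sum_le_sum_abs _ _).trans (Finset.sum_le_sum fun j _ => ?_)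
  rw [abs_mul, abs_div, abs_pow, abs_neg, abs_one, one_pow, Nat.abs_cast]
  refine le_trans (mul_le_of_le_one_left (abs_nonneg _) ?_) (hC j u hu x)
  rw [div_le_one (by positivity)]
  exact_mod_cast Nat.factorial_pos j

end TaylorBounds

/-! ### Measure-theoretic estimates -/

/-- Jensen's inequality for powers of lower integrals. -/
lemma lintegral_pow_le {X : Type*} [MeasurableSpace X] (μ : Measure X) {f : X → ENNReal}
    (hf : AEMeasurable f μ) {q : ℕ} (hq : 1 ≤ q) :
    (∫⁻ x, f x ∂μ) ^ q ≤ μ Set.univ ^ (q - 1) * ∫⁻ x, f x ^ q ∂μ := by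
  have hq0 : (0 : ℝ) < q := by exact_mod_cast hq
  have h := eLpNorm'_le_eLpNorm'_mul_rpow_measure_univ (μ := μ) (f := f) (p := 1) (q := q)
    one_pos (by exact_mod_cast hq) hf.aestronglyMeasurable
  simp only [eLpNorm', enorm_eq_self, ENNReal.rpow_one, div_one, ENNReal.rpow_natCast] at h
  calc (∫⁻ x, f x ∂μ) ^ q
      ≤ ((∫⁻ x, f x ^ q ∂μ) ^ (1 / (q : ℝ)) * μ Set.univ ^ (1 - 1 / (q : ℝ))) ^ q := by gcongr
    _ = _ := by
      rw [mul_pow, ← ENNReal.rpow_natCast, ← ENNReal.rpow_mul, ← ENNReal.rpow_natCast,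
        ← ENNReal.rpow_mul, mul_comm]
      congr 1
      · rw [← ENNReal.rpow_natCast]
        congr 1
        rw [Nat.cast_sub hq]
        field_simp
        simp
      · rw [one_div, inv_mul_cancel₀ hq0.ne', ENNReal.rpow_one]

lemma ENNReal.finset_sum_pow_le {ι : Type*} [Fintype ι] (f : ι → ENNReal) {q : ℕ} (hq : 1 ≤ q) :
    (∑ i, f i) ^ q ≤ (Fintype.card ι : ENNReal) ^ (q - 1) * ∑ i, f i ^ q := by
  let _ : MeasurableSpace ι := ⊤
  have h := lintegral_pow_le Measure.count (measurable_from_top (f := f)).aemeasurable hq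
  simpa [lintegral_fintype, Measure.count_apply, MeasurableSet.univ, ENat.card_eq_coe_fintype_card]
    using h

lemma ENNReal.prod_le_one_add_sum_pow {r q : ℕ} (hrq : r ≤ q) (b : Fin r → ENNReal) :
    ∏ k, b k ≤ 1 + ∑ k, b k ^ q := by
  by_cases h : ∀ k, b k ≤ 1
  · exact (Finset.prod_le_one' fun k _ => h k).trans le_self_add
  push Not at h
  obtain ⟨k₁, hk₁⟩ := h
  obtain ⟨k, -, hk⟩ := Finset.exists_max_image Finset.univ b ⟨k₁, Finset.mem_univ _⟩
  have hbk : 1 ≤ b k := hk₁.le.trans (hk k₁ (Finset.mem_univ _))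
  calc ∏ j, b j ≤ ∏ _j : Fin r, b k := Finset.prod_le_prod' fun j hj => hk j hj
    _ = b k ^ r := by simp
    _ ≤ b k ^ q := pow_le_pow_right₀ hbk hrq
    _ ≤ ∑ k, b k ^ q := Finset.single_le_sum (f := fun k => b k ^ q)
        (fun _ _ => bot_le) (Finset.mem_univ k)
    _ ≤ _ := le_add_self

lemma enorm_integral_prod_mul_le {N r q : ℕ} (hrq : r ≤ q) {K : Set (Euc N)}
    (hK : MeasurableSet K) {f : Fin r → Euc N → ℝ} {φ : Euc N → ℝ} {S : ℝ}
    (hφ : ∀ x, |φ x| ≤ S) (hφK : ∀ x ∉ K, φ x = 0) {c : ENNReal} {b : Fin r → Euc N → ENNReal}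
    (hb : ∀ k, Measurable (b k)) (hfb : ∀ x ∈ K, ‖∏ k, f k x‖ₑ ≤ c * ∏ k, b k x) :
    ‖∫ x, (∏ k, f k x) * φ x‖ₑ ≤
      ENNReal.ofReal S * (c * (volume K + ∑ k, ∫⁻ x in K, b k x ^ q)) := by
  calc ‖∫ x, (∏ k, f k x) * φ x‖ₑ = ‖∫ x in K, (∏ k, f k x) * φ x‖ₑ := by
        rw [setIntegral_eq_integral_of_forall_compl_eq_zero]
        intro x hx
        simp [hφK x hx]
    _ ≤ ∫⁻ x in K, ‖(∏ k, f k x) * φ x‖ₑ := enorm_integral_le_lintegral_enorm _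
    _ ≤ ∫⁻ x in K, (ENNReal.ofReal S * c) * (1 + ∑ k, b k x ^ q) := by
        refine setLIntegral_mono' hK fun x hx => ?_
        rw [enorm_mul, mul_comm]
        have h1 : ‖φ x‖ₑ ≤ ENNReal.ofReal S := by
          rw [Real.enorm_eq_ofReal_abs]
          exact ENNReal.ofReal_le_ofReal (hφ x)
        calc ‖φ x‖ₑ * ‖∏ k, f k x‖ₑ ≤ ENNReal.ofReal S * (c * ∏ k, b k x) :=
              mul_le_mul' h1 (hfb x hx)
          _ ≤ ENNReal.ofReal S * (c * (1 + ∑ k, b k x ^ q)) := by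
              gcongr
              exact ENNReal.prod_le_one_add_sum_pow hrq _
          _ = _ := by rw [mul_assoc]
    _ = _ := by
        rw [lintegral_const_mul _ (by fun_prop), lintegral_add_left measurable_const,
          lintegral_finsetSum _ (fun k _ => by fun_prop), mul_assoc]
        simp

/-- Dilation of a lower integral over a subset of a ball. -/
lemma lintegral_dilation_le {N : ℕ} {Y E : Set (Euc N)} {R : ℝ} (hE : MeasurableSet E)
    (hR : Y ⊆ Metric.closedBall 0 R) (hY : MeasurableSet Y) {t : ℝ} (ht : 0 < t) (x : Euc N)
    (hx : ∀ y ∈ Y, x + t • y ∈ E) {φ : Euc N → ENNReal} (hφ : Measurable φ) :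
    ∫⁻ y in Y, φ (x + t • y) ≤
      ENNReal.ofReal (t ^ N)⁻¹ * ∫⁻ z in E, (if ‖x - z‖ ≤ R * t then φ z else 0) := by
  have hms : Measurable fun z : Euc N => if ‖x - z‖ ≤ R * t then φ z else 0 :=
    Measurable.ite (measurableSet_le (by fun_prop) measurable_const) hφ measurable_const
  set G : Euc N → ENNReal := E.indicator fun z => if ‖x - z‖ ≤ R * t then φ z else 0 with hG
  have hGm : Measurable G := hms.indicator hE
  calc ∫⁻ y in Y, φ (x + t • y) ≤ ∫⁻ y in Y, G (x + t • y) := by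
        refine setLIntegral_mono' hY fun y hy => ?_
        have h1 : ‖x - (x + t • y)‖ ≤ R * t := by
          have : ‖y‖ ≤ R := by simpa using hR hy
          rw [show x - (x + t • y) = -(t • y) by abel, norm_neg, norm_smul, Real.norm_eq_abs,
            abs_of_pos ht, mul_comm]
          gcongr
        rw [hG, Set.indicator_of_mem (hx y hy), if_pos h1]
    _ ≤ ∫⁻ y, G (x + t • y) := setLIntegral_le_lintegral _ _
    _ = ∫⁻ y, (fun y => G (x + y)) (t • y) := rfl
    _ = ∫⁻ y, G (x + y) ∂(Measure.map (t • ·) volume) := by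
        rw [lintegral_map (by fun_prop) (by fun_prop)]
    _ = ENNReal.ofReal (t ^ N)⁻¹ * ∫⁻ z, G z := by
        rw [Measure.map_addHaar_smul _ ht.ne', lintegral_smul_measure, finrank_euclideanSpace_fin,
          abs_of_pos (by positivity), lintegral_add_left_eq_self]
        rfl
    _ = _ := by rw [hG, lintegral_indicator hE]

lemma lintegral_Ioc_inv_pow_le {P : ℕ} (hP : 1 ≤ P) {R d : ℝ} (hR : 0 < R) (hd : 0 < d) :
    ∫⁻ t in Set.Ioc (0 : ℝ) 1, (if d ≤ R * t then ENNReal.ofReal (t ^ (P + 1))⁻¹ else 0) ≤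
      ENNReal.ofReal (R ^ P / P) * ENNReal.ofReal (d ^ P)⁻¹ := by
  have hP0 : (0 : ℝ) < P := by exact_mod_cast hP
  have hc : 0 < d / R := by positivity
  have ha : -((P : ℝ) + 1) < -1 := by linarith
  calc ∫⁻ t in Set.Ioc (0 : ℝ) 1, (if d ≤ R * t then ENNReal.ofReal (t ^ (P + 1))⁻¹ else 0)
      ≤ ∫⁻ t, (Set.Ici (d / R)).indicator (fun t => ENNReal.ofReal (t ^ (P + 1))⁻¹) t := by
        refine (setLIntegral_le_lintegral _ _).trans (lintegral_mono fun t => ?_)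
        simp only [Set.indicator, Set.mem_Ici, div_le_iff₀' hR]
        rfl
    _ = ∫⁻ t in Set.Ioi (d / R), ENNReal.ofReal (t ^ (P + 1))⁻¹ := by
        rw [lintegral_indicator measurableSet_Ici, setLIntegral_congr Ioi_ae_eq_Ici.symm]
    _ = ∫⁻ t in Set.Ioi (d / R), ENNReal.ofReal (t ^ (-((P : ℝ) + 1))) := by
        refine setLIntegral_congr_fun measurableSet_Ioi fun t ht => ?_
        have : 0 < t := hc.trans ht
        rw [Real.rpow_neg this.le]
        norm_cast
    _ = ENNReal.ofReal (∫ t in Set.Ioi (d / R), t ^ (-((P : ℝ) + 1))) := by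
        rw [ofReal_integral_eq_lintegral_ofReal (integrableOn_Ioi_rpow_of_lt ha hc)]
        refine (ae_restrict_iff' measurableSet_Ioi).2 (Eventually.of_forall fun t ht => ?_)
        exact Real.rpow_nonneg (hc.trans ht).le _
    _ ≤ _ := by
        rw [integral_Ioi_rpow_of_lt ha hc, ← ENNReal.ofReal_mul (by positivity)]
        refine ENNReal.ofReal_le_ofReal (le_of_eq ?_)
        rw [show -((P : ℝ) + 1) + 1 = -P by ring, Real.rpow_neg hc.le, Real.rpow_natCast, div_pow]
        field_simp

/-- The scale integral of the oscillations of `h` is controlled by its Gagliardo seminorm. -/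
lemma lintegral_oscillation_le {N e P q : ℕ} (hP : 1 ≤ P) (hq : 1 ≤ q) {Y E K : Set (Euc N)}
    {R : ℝ} (hR0 : 0 < R) (hE : MeasurableSet E) (hR : Y ⊆ Metric.closedBall 0 R)
    (hY : MeasurableSet Y) (hK : MeasurableSet K)
    (hx : ∀ t ∈ Set.Icc (0 : ℝ) 1, ∀ x ∈ K, ∀ y ∈ Y, x + t • y ∈ E) (hKE : K ⊆ E)
    {h : Euc N → ℝ} (hh : Continuous h) {m : ℕ} (he : P + m = N + e) (hm : 1 ≤ m) :
    ∫⁻ t in Set.Ioc (0 : ℝ) 1, ENNReal.ofReal (t ^ (m - 1) * (t ^ e)⁻¹) *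
        ∫⁻ x in K, ∫⁻ y in Y, ‖h (x + t • y) - h x‖ₑ ^ q ≤
      ENNReal.ofReal (R ^ P / P) *
        ∫⁻ x in E, ∫⁻ z in E, ‖h x - h z‖ₑ ^ q / ‖x - z‖ₑ ^ P := by
  obtain ⟨D, hD⟩ : ∃ D : Euc N → Euc N → ℝ → ENNReal, ∀ x z t, D x z t =
      (if ‖x - z‖ ≤ R * t then ENNReal.ofReal (t ^ (P + 1))⁻¹ else 0) * ‖h x - h z‖ₑ ^ q :=
    ⟨_, fun _ _ _ => rfl⟩
  have hm1 : Measurable fun p : Euc N × Euc N × ℝ => D p.1 p.2.1 p.2.2 := by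
    simp only [hD]
    refine Measurable.mul (Measurable.ite (measurableSet_le (by fun_prop) (by fun_prop))
      (by fun_prop) measurable_const) ?_
    have : Continuous fun p : Euc N × Euc N × ℝ => h p.1 - h p.2.1 := by fun_prop
    exact this.measurable.enorm.pow_const q
  calc _ ≤ ∫⁻ t in Set.Ioc (0 : ℝ) 1, ∫⁻ x in K, ∫⁻ z in E, D x z t := by
        refine setLIntegral_mono' measurableSet_Ioc fun t ht => ?_
        have ht0 : 0 < t := ht.1
        rw [← lintegral_const_mul' _ _ ENNReal.ofReal_ne_top]
        refine setLIntegral_mono' hK fun x hxK => ?_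
        have hφ : Measurable fun z => ‖h z - h x‖ₑ ^ q :=
          (hh.sub continuous_const).measurable.enorm.pow_const q
        refine (mul_le_mul_right (lintegral_dilation_le hE hR hY ht0 x
          (hx t ⟨ht0.le, ht.2⟩ x hxK) hφ) _).trans ?_
        rw [← mul_assoc, ← ENNReal.ofReal_mul (by positivity),
          ← lintegral_const_mul' _ _ ENNReal.ofReal_ne_top]
        refine lintegral_mono fun z => le_of_eq ?_
        have e1 : t ^ (m - 1) * (t ^ e)⁻¹ * (t ^ N)⁻¹ = (t ^ (P + 1))⁻¹ := by
          have h1 : t ^ e * t ^ N = t ^ (m - 1) * t ^ (P + 1) := by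
            rw [← pow_add, ← pow_add]
            congr 1
            omega
          rw [mul_assoc, ← mul_inv, h1, mul_inv, mul_inv_cancel_left₀ (by positivity)]
        simp only [hD]
        rw [e1]
        split_ifs
        · rw [enorm_sub_rev (h z)]
        · simp
    _ = ∫⁻ x in K, ∫⁻ t in Set.Ioc (0 : ℝ) 1, ∫⁻ z in E, D x z t := by
        rw [lintegral_lintegral_swap]
        refine (Measurable.lintegral_prod_right' (f := fun p : (ℝ × Euc N) × Euc N =>
          D p.1.2 p.2 p.1.1) ?_).aemeasurable
        exact hm1.comp (by fun_prop : Measurable fun p : (ℝ × Euc N) × Euc N =>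
          (p.1.2, p.2, p.1.1))
    _ = ∫⁻ x in K, ∫⁻ z in E, ∫⁻ t in Set.Ioc (0 : ℝ) 1, D x z t := by
        refine lintegral_congr fun x => ?_
        rw [lintegral_lintegral_swap]
        exact (hm1.comp (by fun_prop : Measurable fun p : ℝ × Euc N => (x, p.2, p.1))).aemeasurable
    _ ≤ ∫⁻ x in K, ∫⁻ z in E, ENNReal.ofReal (R ^ P / P) *
          (‖h x - h z‖ₑ ^ q / ‖x - z‖ₑ ^ P) := by
        refine lintegral_mono fun x => lintegral_mono fun z => ?_
        simp only [hD]
        rw [lintegral_mul_const' _ _ (by finiteness)]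
        rcases eq_or_ne x z with rfl | hxz
        · simp [zero_pow (by omega : q ≠ 0)]
        have hd : 0 < ‖x - z‖ := norm_pos_iff.2 (sub_ne_zero.2 hxz)
        refine (mul_le_mul_left (lintegral_Ioc_inv_pow_le hP hR0 hd) _).trans (le_of_eq ?_)
        rw [ENNReal.ofReal_inv_of_pos (by positivity), ENNReal.ofReal_pow hd.le, ofReal_norm,
          mul_assoc, mul_comm (_ ^ P)⁻¹, ENNReal.div_eq_inv_mul, mul_comm (_ ^ P)⁻¹]
    _ ≤ ∫⁻ x in E, ∫⁻ z in E, ENNReal.ofReal (R ^ P / P) *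
          (‖h x - h z‖ₑ ^ q / ‖x - z‖ₑ ^ P) := lintegral_mono_set hKE
    _ = _ := by
        simp_rw [lintegral_const_mul' _ _ ENNReal.ofReal_ne_top]

/-! ### The estimate for smooth functions: fractional exponents -/

/-- The derivative in `t` of `avgTaylor (m + 1) η t g`. -/
def avgTaylorDeriv {N : ℕ} (m : ℕ) (η : Euc N → ℝ) (t : ℝ) (g : Euc N → ℝ) (x : Euc N) : ℝ :=
  (-t) ^ m / m.factorial * taylorAvg (m + 1) η t g x

section Path

variable {N m r : ℕ} {η g : Euc N → ℝ}

lemma contDiff_avgTaylorDeriv (hη : IsSmooth η) (hc : HasCompactSupport η) (hg : IsSmooth g) :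
    ContDiff ℝ (⊤ : ℕ∞) fun p : ℝ × Euc N => avgTaylorDeriv m η p.1 g p.2 :=
  ContDiff.mul (by fun_prop) (contDiff_taylorAvg (m + 1) hη hc hg)

lemma IsSmooth.avgTaylorDeriv (hη : IsSmooth η) (hc : HasCompactSupport η)
    (hg : IsSmooth g) (t : ℝ) : IsSmooth (avgTaylorDeriv m η t g) :=
  (contDiff_avgTaylorDeriv hη hc hg).comp (by fun_prop : ContDiff ℝ _ fun x : Euc N => (t, x))

lemma pderivList_avgTaylorDeriv (hη : IsSmooth η) (hc : HasCompactSupport η)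
    (hg : IsSmooth g) (t : ℝ) (l : List (Fin N)) :
    pderivList l (avgTaylorDeriv m η t g) = avgTaylorDeriv m η t (pderivList l g) := by
  induction l with
  | nil => rfl
  | cons i l ih =>
    simp only [pderivList]
    rw [ih]
    funext x
    unfold avgTaylorDeriv
    rw [pderiv'_const_mul (IsSmooth.taylorAvg (m + 1) hη hc (hg.pderivList l) t),
      pderiv'_taylorAvg _ hη hc (hg.pderivList l)]

variable {w : Fin r → Euc N → ℝ}

lemma slotForm_update_avgTaylor (α : Fin (m + 1) → Fin r → Fin N) (hη : IsSmooth η)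
    (hc : HasCompactSupport η) (hw : ∀ k, IsSmooth (w k)) (t : ℝ) (k₀ : Fin r) (x : Euc N) :
    slotForm (m + 1) α (Function.update (fun k => avgTaylor (m + 1) η t (w k)) k₀
        (avgTaylorDeriv m η t (w k₀))) x =
      ∑ τ : Fin (m + 1) → Equiv.Perm (Fin r), (∏ s, ((Equiv.Perm.sign (τ s) : ℤ) : ℝ)) *
        ((∏ k ∈ Finset.univ.erase k₀,
            avgTaylor (m + 1) η t (pderivList (List.ofFn fun s => α s (τ s k)) (w k)) x) *
          avgTaylorDeriv m η t (pderivList (List.ofFn fun s => α s (τ s k₀)) (w k₀)) x) := by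
  refine Finset.sum_congr rfl fun τ _ => ?_
  congr 1
  rw [← Finset.mul_prod_erase _ _ (Finset.mem_univ k₀), mul_comm]
  simp only [Function.update_self]
  rw [pderivList_avgTaylorDeriv hη hc (hw k₀)]
  congr 1
  refine Finset.prod_congr rfl fun k hk => ?_
  rw [Function.update_of_ne (Finset.ne_of_mem_erase hk), pderivList_avgTaylor _ hη hc (hw k)]

lemma slotForm_avgTaylor (α : Fin (m + 1) → Fin r → Fin N) (hη : IsSmooth η)
    (hc : HasCompactSupport η) (hw : ∀ k, IsSmooth (w k)) (t : ℝ) (x : Euc N) :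
    slotForm (m + 1) α (fun k => avgTaylor (m + 1) η t (w k)) x =
      ∑ τ : Fin (m + 1) → Equiv.Perm (Fin r), (∏ s, ((Equiv.Perm.sign (τ s) : ℤ) : ℝ)) *
        ∏ k, avgTaylor (m + 1) η t (pderivList (List.ofFn fun s => α s (τ s k)) (w k)) x := by
  refine Finset.sum_congr rfl fun τ _ => ?_
  congr 1
  refine Finset.prod_congr rfl fun k hk => ?_
  rw [pderivList_avgTaylor _ hη hc (hw k)]

lemma hasDerivAt_slotForm_avgTaylor (α : Fin (m + 1) → Fin r → Fin N) (hη : IsSmooth η)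
    (hc : HasCompactSupport η) (hw : ∀ k, IsSmooth (w k)) (t : ℝ) (x : Euc N) :
    HasDerivAt (fun t => slotForm (m + 1) α (fun k => avgTaylor (m + 1) η t (w k)) x)
      (∑ k₀, slotForm (m + 1) α (Function.update (fun k => avgTaylor (m + 1) η t (w k)) k₀
        (avgTaylorDeriv m η t (w k₀))) x) t := by
  simp only [slotForm_avgTaylor α hη hc hw, slotForm_update_avgTaylor α hη hc hw]
  rw [Finset.sum_comm]
  refine HasDerivAt.fun_sum fun τ _ => ?_
  rw [← Finset.mul_sum]
  refine HasDerivAt.const_mul _ ?_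
  have h := HasDerivAt.fun_finsetProd (u := (Finset.univ : Finset (Fin r))) (x := t)
    (f := fun k t =>
      avgTaylor (m + 1) η t (pderivList (List.ofFn fun s => α s (τ s k)) (w k)) x)
    (f' := fun k =>
      avgTaylorDeriv m η t (pderivList (List.ofFn fun s => α s (τ s k)) (w k)) x)
    (fun k _ => hasDerivAt_avgTaylor m hη hc ((hw k).pderivList _) t x)
  simpa [smul_eq_mul] using h

lemma integral_mul_eq_sub_of_hasDerivAt {ι : Type*} [Fintype ι] {Φ : ℝ → Euc N → ℝ}
    {G : ι → ℝ → Euc N → ℝ} (hΦ : Continuous Φ.uncurry) (hG : ∀ k, Continuous (G k).uncurry)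
    (hd : ∀ t x, HasDerivAt (fun t => Φ t x) (∑ k, G k t x) t)
    {ψ : Euc N → ℝ} (hψc : Continuous ψ) (hcψ : HasCompactSupport ψ) :
    ∫ x, Φ 0 x * ψ x =
      (∫ x, Φ 1 x * ψ x) - ∫ t in (0 : ℝ)..1, ∑ k, ∫ x, G k t x * ψ x := by
  have hψ0 : ∀ x ∉ tsupport ψ, ψ x = 0 := fun x hx => image_eq_zero_of_notMem_tsupport hx
  have hderiv : ∀ t, HasDerivAt (fun t => ∫ x, Φ t x * ψ x)
      (∫ x, (∑ k, G k t x) * ψ x) t := by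
    intro t
    refine hasDerivAt_integral_of_continuous (K := tsupport ψ) hcψ
      (Φ' := fun t x => (∑ k, G k t x) * ψ x) ?_ ?_ ?_ ?_ ?_ t
    · exact hΦ.mul (hψc.comp continuous_snd)
    · exact (continuous_finsetSum _ fun k _ => hG k).mul (hψc.comp continuous_snd)
    · intro s x hx
      simp [hψ0 x hx]
    · intro s x hx
      simp [hψ0 x hx]
    · intro s x
      exact (hd s x).mul_const (ψ x)
  have hsum : ∀ t, ∫ x, (∑ k, G k t x) * ψ x = ∑ k, ∫ x, G k t x * ψ x := by
    intro t
    simp only [Finset.sum_mul]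
    refine integral_finsetSum _ fun k _ => integrable_mul_of_hasCompactSupport ?_ hψc hcψ
    exact (hG k).comp (by fun_prop : Continuous fun x : Euc N => (t, x))
  have hInt : ∀ k, Continuous fun t => ∫ x, G k t x * ψ x := by
    intro k
    have h := continuous_parametric_integral_of_continuous (μ := (volume : Measure (Euc N)))
      (s := tsupport ψ) (f := fun t x => G k t x * ψ x)
      ((hG k).mul (hψc.comp continuous_snd)) hcψ
    refine h.congr fun t => ?_
    rw [setIntegral_eq_integral_of_forall_compl_eq_zero]
    intro x hx
    simp [hψ0 x hx]
  have hftc := intervalIntegral.integral_eq_sub_of_hasDerivAt (a := 0) (b := 1)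
    (fun t _ => hderiv t) (by
      simp only [hsum]
      exact (continuous_finsetSum _ fun k _ => hInt k).intervalIntegrable _ _)
  simp only [hsum] at hftc
  rw [hftc]
  ring

lemma integral_slotForm_eq_sub (α : Fin (m + 1) → Fin r → Fin N) (hη : IsSmooth η)
    (hc : HasCompactSupport η) (hη1 : ∫ y, η y = 1) (hw : ∀ k, IsSmooth (w k))
    {ψ : Euc N → ℝ} (hψ : IsSmooth ψ) (hcψ : HasCompactSupport ψ) :
    ∫ x, slotForm (m + 1) α w x * ψ x =
      (∫ x, slotForm (m + 1) α (fun k => avgTaylor (m + 1) η 1 (w k)) x * ψ x) -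
      ∫ t in (0 : ℝ)..1, ∑ k₀, ∫ x, slotForm (m + 1) α
        (Function.update (fun k => avgTaylor (m + 1) η t (w k)) k₀
          (avgTaylorDeriv m η t (w k₀))) x * ψ x := by
  have hcont : Continuous (Function.uncurry fun t x =>
      slotForm (m + 1) α (fun k => avgTaylor (m + 1) η t (w k)) x) := by
    unfold Function.uncurry
    simp only [slotForm_avgTaylor α hη hc hw]
    exact continuous_finsetSum _ fun τ _ => continuous_const.mul (continuous_finsetProd _
      fun k _ => (contDiff_avgTaylor (m + 1) hη hc ((hw k).pderivList _)).continuous)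
  have hcont' : ∀ k₀, Continuous (Function.uncurry fun t x => slotForm (m + 1) α
      (Function.update (fun k => avgTaylor (m + 1) η t (w k)) k₀
        (avgTaylorDeriv m η t (w k₀))) x) := by
    intro k₀
    unfold Function.uncurry
    simp only [slotForm_update_avgTaylor α hη hc hw]
    exact continuous_finsetSum _ fun τ _ => continuous_const.mul ((continuous_finsetProd _
      fun k _ => (contDiff_avgTaylor (m + 1) hη hc ((hw k).pderivList _)).continuous).mul
        (contDiff_avgTaylorDeriv hη hc ((hw k₀).pderivList _)).continuous)
  have h := integral_mul_eq_sub_of_hasDerivAt hcont hcont'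
    (hasDerivAt_slotForm_avgTaylor α hη hc hw) hψ.continuous hcψ
  simpa only [avgTaylor_zero m hη1] using h

lemma enorm_integral_slotForm_le_add (α : Fin (m + 1) → Fin r → Fin N) (hη : IsSmooth η)
    (hc : HasCompactSupport η) (hη1 : ∫ y, η y = 1) (hw : ∀ k, IsSmooth (w k))
    {ψ : Euc N → ℝ} (hψ : IsSmooth ψ) (hcψ : HasCompactSupport ψ) :
    ‖∫ x, slotForm (m + 1) α w x * ψ x‖ₑ ≤
      ‖∫ x, slotForm (m + 1) α (fun k => avgTaylor (m + 1) η 1 (w k)) x * ψ x‖ₑ +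
      ∫⁻ t in Set.Ioc (0 : ℝ) 1, ∑ k₀, ‖∫ x, slotForm (m + 1) α
        (Function.update (fun k => avgTaylor (m + 1) η t (w k)) k₀
          (avgTaylorDeriv m η t (w k₀))) x * ψ x‖ₑ := by
  rw [integral_slotForm_eq_sub α hη hc hη1 hw hψ hcψ]
  refine enorm_sub_le.trans (add_le_add le_rfl ?_)
  rw [intervalIntegral.integral_of_le zero_le_one]
  refine (enorm_integral_le_lintegral_enorm _).trans (lintegral_mono fun t => ?_)
  exact enorm_sum_le _ _

end Path

section FractionalEstimate

variable {N r k a q : ℕ} {ρ : Euc N → ℝ} {Y : Set (Euc N)}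

lemma exists_prod_update_bound (hY : IsCompact Y) (hρ : IsSmooth ρ) (hρY : tsupport ρ ⊆ Y) :
    ∃ C : ℝ, 0 ≤ C ∧ ∀ w : Fin r → Euc N → ℝ, (∀ i, IsSmooth (w i)) → ∀ k₀ : Fin r,
      ∀ L : Fin r → List (Fin N), (∀ i, (L i).length + (if k₀ = i then k + a + 1 else 0) =
        k + a + 1) → ∀ t : ℝ, 0 < t → ∀ x,
      |∏ i, pderivList (L i) (Function.update (fun i => avgTaylor (k + a + 1) ρ t (w i)) k₀
          (avgTaylorDeriv (k + a) ρ t (w k₀)) i) x| ≤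
        C * t ^ (k + a) * ∏ i, ((t ^ (a + 1))⁻¹ * oscAvg k Y (w i) t x) := by
  have hc : HasCompactSupport ρ := hY.of_isClosed_subset (isClosed_tsupport _) hρY
  obtain ⟨C₁, hC₁0, hC₁⟩ := exists_avgTaylor_bound hY k (a + 1) (by omega) hρ hρY
  obtain ⟨C₂, hC₂0, hC₂⟩ := exists_taylorAvg_bound hY k (k + a + 1) (a + 1) (by omega) []
    (by simp; omega) hρ hρY
  set C := max C₁ C₂ with hC
  have hC0 : 0 ≤ C := hC₁0.trans (le_max_left _ _)
  refine ⟨C ^ r, by positivity, fun w hw k₀ L hL t ht x => ?_⟩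
  have hbound : ∀ i, |pderivList (L i) (Function.update
      (fun i => avgTaylor (k + a + 1) ρ t (w i)) k₀ (avgTaylorDeriv (k + a) ρ t (w k₀)) i) x| ≤
      (if i = k₀ then t ^ (k + a) else 1) *
        (C * ((t ^ (a + 1))⁻¹ * oscAvg k Y (w i) t x)) := by
    intro i
    have hosc : 0 ≤ oscAvg k Y (w i) t x := oscAvg_nonneg _ _ _
    have key : ∀ b c : ℝ, c ≤ C → t ^ (a + 1) * b ≤ c * oscAvg k Y (w i) t x →
        b ≤ C * ((t ^ (a + 1))⁻¹ * oscAvg k Y (w i) t x) := by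
      intro b c hcC hb
      have h1 : t ^ (a + 1) * b ≤ C * oscAvg k Y (w i) t x :=
        hb.trans (mul_le_mul_of_nonneg_right hcC hosc)
      calc b = (t ^ (a + 1))⁻¹ * (t ^ (a + 1) * b) := by field_simp
        _ ≤ (t ^ (a + 1))⁻¹ * (C * oscAvg k Y (w i) t x) := by gcongr
        _ = _ := by ring
    by_cases hi : i = k₀
    · subst hi
      have hLi : L i = [] := by
        have := hL i
        rw [if_pos rfl] at this
        exact List.length_eq_zero_iff.1 (by omega)
      rw [hLi, Function.update_self, if_pos rfl]
      simp only [pderivList, avgTaylorDeriv]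
      rw [abs_mul, abs_div, abs_pow, abs_neg, abs_of_pos ht, Nat.abs_cast]
      refine mul_le_mul (div_le_self (by positivity) ?_)
        (key _ _ (le_max_right _ _) (hC₂ (w i) (hw i) t ht x)) (abs_nonneg _) (by positivity)
      exact_mod_cast Nat.factorial_pos _
    · have hLi : (L i).length = k + (a + 1) := by
        have := hL i
        rw [if_neg (Ne.symm hi)] at this
        omega
      rw [Function.update_of_ne hi, if_neg hi, one_mul]
      exact key _ _ (le_max_left _ _) (hC₁ _ hLi.le hLi (w i) (hw i) t ht x)
  rw [Finset.abs_prod]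
  refine (Finset.prod_le_prod (fun i _ => abs_nonneg _) fun i _ => hbound i).trans (le_of_eq ?_)
  rw [Finset.prod_mul_distrib, Finset.prod_mul_distrib, Finset.prod_ite_eq' Finset.univ k₀]
  simp
  ring

lemma continuous_oscAvg (hY : IsCompact Y) {u : Euc N → ℝ} (hu : IsSmooth u) (t : ℝ) :
    Continuous (oscAvg k Y u t) := by
  refine continuous_finsetSum _ fun l _ => ?_
  have h := (hu.pderivList (List.ofFn l)).continuous
  exact continuous_parametric_integral_of_continuous (by unfold Function.uncurry; fun_prop) hY

lemma ofReal_oscAvg_pow_le (hY : IsCompact Y) (hq : 1 ≤ q) {u : Euc N → ℝ} (hu : IsSmooth u)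
    (t : ℝ) (x : Euc N) :
    ENNReal.ofReal (oscAvg k Y u t x) ^ q ≤
      ((Fintype.card (Fin k → Fin N) : ENNReal) ^ (q - 1) * volume Y ^ (q - 1)) *
        ∑ l : Fin k → Fin N, ∫⁻ y in Y, ‖pderivList (List.ofFn l) u (x + t • y) -
          pderivList (List.ofFn l) u x‖ₑ ^ q := by
  have hc : ∀ l : Fin k → Fin N, Continuous fun y => pderivList (List.ofFn l) u (x + t • y) -
      pderivList (List.ofFn l) u x := fun l => by
    have h := (hu.pderivList (List.ofFn l)).continuous
    fun_prop
  have e1 : ENNReal.ofReal (oscAvg k Y u t x) = ∑ l : Fin k → Fin N, ∫⁻ y in Y,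
      ‖pderivList (List.ofFn l) u (x + t • y) - pderivList (List.ofFn l) u x‖ₑ := by
    rw [oscAvg, ENNReal.ofReal_sum_of_nonneg fun l _ => integral_nonneg fun _ => abs_nonneg _]
    refine Finset.sum_congr rfl fun l _ => ?_
    exact ofReal_integral_norm_eq_lintegral_enorm ((hc l).continuousOn.integrableOn_compact hY)
  rw [e1]
  refine (ENNReal.finset_sum_pow_le _ hq).trans ?_
  rw [mul_assoc, Finset.mul_sum (a := volume Y ^ (q - 1))]
  gcongr with l
  have h := lintegral_pow_le (volume.restrict Y) (hc l).measurable.enorm.aemeasurable hq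
  simpa using h

/-- The part of the estimate coming from scales in `(0, 1]`. -/
lemma exists_lintegral_path_bound {P : ℕ} (hP1 : 1 ≤ P) (hP : P + (k + a + 1) = N + (a + 1) * q)
    (hq : 1 ≤ q) (hrq : r ≤ q) (hY : IsCompact Y) (hρ : IsSmooth ρ) (hρY : tsupport ρ ⊆ Y)
    {V : ENNReal} (hV : V ≠ ⊤) :
    ∃ C : ENNReal, C ≠ ⊤ ∧ ∀ (α : Fin (k + a + 1) → Fin r → Fin N) (w : Fin r → Euc N → ℝ)
      (ψ : Euc N → ℝ) (S : ℝ) (E : Set (Euc N)), (∀ i, IsSmooth (w i)) → IsSmooth ψ →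
      HasCompactSupport ψ → (∀ W : List (Fin N), W.length = k + a + 1 → ∀ x,
        |pderivList W ψ x| ≤ S) → MeasurableSet E → volume E ≤ V → tsupport ψ ⊆ E →
      (∀ t ∈ Set.Icc (0 : ℝ) 1, ∀ x ∈ tsupport ψ, ∀ y ∈ Y, x + t • y ∈ E) →
      (∀ i, ∀ l : Fin k → Fin N, ∫⁻ x in E, ∫⁻ z in E,
        ‖pderivList (List.ofFn l) (w i) x - pderivList (List.ofFn l) (w i) z‖ₑ ^ q /
          ‖x - z‖ₑ ^ P ≤ 1) →
      ∫⁻ t in Set.Ioc (0 : ℝ) 1, ∑ k₀, ‖∫ x, slotForm (k + a + 1) α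
        (Function.update (fun i => avgTaylor (k + a + 1) ρ t (w i)) k₀
          (avgTaylorDeriv (k + a) ρ t (w k₀))) x * ψ x‖ₑ ≤ C * ENNReal.ofReal S := by
  have hc : HasCompactSupport ρ := hY.of_isClosed_subset (isClosed_tsupport _) hρY
  obtain ⟨C₁, hC₁0, hC₁⟩ := exists_prod_update_bound (r := r) (k := k) (a := a) hY hρ hρY
  obtain ⟨R₀, hR₀⟩ := hY.isBounded.subset_closedBall (0 : Euc N)
  set R := max R₀ 1 with hR
  have hR0 : 0 < R := lt_of_lt_of_le one_pos (le_max_right _ _)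
  have hRY : Y ⊆ Metric.closedBall 0 R :=
    hR₀.trans (Metric.closedBall_subset_closedBall (le_max_left _ _))
  set c₁ : ENNReal := (Fintype.card (Fin k → Fin N) : ENNReal) ^ (q - 1) *
    volume Y ^ (q - 1) with hc₁
  have hc₁t : c₁ ≠ ⊤ := by
    have : volume Y ≠ ⊤ := hY.measure_lt_top.ne
    finiteness
  set M : ENNReal := V + ∑ _i : Fin r, c₁ * ∑ _l : Fin k → Fin N, ENNReal.ofReal (R ^ P / P)
    with hM
  have hMt : M ≠ ⊤ := by
    rw [hM]
    refine ENNReal.add_ne_top.2 ⟨hV, ENNReal.sum_ne_top.2 fun _ _ => ENNReal.mul_ne_top hc₁t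
      (ENNReal.sum_ne_top.2 fun _ _ => ENNReal.ofReal_ne_top)⟩
  refine ⟨r * ((r.factorial : ENNReal) ^ (k + a + 1) * (ENNReal.ofReal C₁ * M)), by finiteness,
    fun α w ψ S E hw hψ hcψ hS hE hEV hψE hEx hG => ?_⟩
  have hK : MeasurableSet (tsupport ψ) := (isClosed_tsupport ψ).measurableSet
  obtain ⟨J, hJ⟩ : ∃ J : Fin r → (Fin k → Fin N) → ℝ → ENNReal, ∀ i l t, J i l t =
      ENNReal.ofReal (t ^ (k + a) * (t ^ ((a + 1) * q))⁻¹) * ∫⁻ x in tsupport ψ, ∫⁻ y in Y,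
        ‖pderivList (List.ofFn l) (w i) (x + t • y) - pderivList (List.ofFn l) (w i) x‖ₑ ^ q :=
    ⟨_, fun _ _ _ => rfl⟩
  have hJm : ∀ i l, Measurable (J i l) := by
    intro i l
    have h := (hw i).pderivList (List.ofFn l) |>.continuous
    have h1 : Measurable fun p : (ℝ × Euc N) × Euc N => ‖pderivList (List.ofFn l) (w i)
        (p.1.2 + p.1.1 • p.2) - pderivList (List.ofFn l) (w i) p.1.2‖ₑ ^ q := by
      have : Continuous fun p : (ℝ × Euc N) × Euc N => pderivList (List.ofFn l) (w i)
        (p.1.2 + p.1.1 • p.2) - pderivList (List.ofFn l) (w i) p.1.2 := by fun_prop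
      exact this.measurable.enorm.pow_const q
    have h2 := (h1.lintegral_prod_right' (ν := volume.restrict Y)).lintegral_prod_right'
      (ν := volume.restrict (tsupport ψ))
    have e : J i l = fun t => ENNReal.ofReal (t ^ (k + a) * (t ^ ((a + 1) * q))⁻¹) *
      ∫⁻ x in tsupport ψ, ∫⁻ y in Y, ‖pderivList (List.ofFn l) (w i) (x + t • y) -
        pderivList (List.ofFn l) (w i) x‖ₑ ^ q := funext (hJ i l)
    rw [e]
    exact Measurable.mul (by fun_prop) h2
  have hJint : ∀ i l, ∫⁻ t in Set.Ioc (0 : ℝ) 1, J i l t ≤ ENNReal.ofReal (R ^ P / P) := by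
    intro i l
    simp only [hJ]
    have h := lintegral_oscillation_le (m := k + a + 1) (e := (a + 1) * q) hP1 hq hR0 hE hRY
      hY.measurableSet hK hEx hψE ((hw i).pderivList (List.ofFn l)).continuous hP (by omega)
    exact h.trans (mul_le_of_le_one_right bot_le (hG i l))
  have hpt : ∀ t ∈ Set.Ioc (0 : ℝ) 1, ∀ k₀, ‖∫ x, slotForm (k + a + 1) α
        (Function.update (fun i => avgTaylor (k + a + 1) ρ t (w i)) k₀
          (avgTaylorDeriv (k + a) ρ t (w k₀))) x * ψ x‖ₑ ≤
      (r.factorial : ENNReal) ^ (k + a + 1) * (ENNReal.ofReal S * (ENNReal.ofReal C₁ *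
        (V + ∑ i, c₁ * ∑ l, J i l t))) := by
    intro t ht k₀
    have ht0 : 0 < t := ht.1
    refine enorm_integral_slotForm_le α (fun _ => k₀) (fun i => IsSmooth.update
      (fun i => IsSmooth.avgTaylor _ hρ hc (hw i) t) k₀
      (IsSmooth.avgTaylorDeriv hρ hc (hw k₀) t) i) hψ hcψ _ ?_
    intro L L' hL' hL
    have hL2 : ∀ i, (L i).length + (if k₀ = i then k + a + 1 else 0) = k + a + 1 := by
      intro i
      have := hL i
      split_ifs with h <;> simp [h] at this ⊢ <;> omega
    have hb : ∀ i, Measurable fun x =>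
        ENNReal.ofReal ((t ^ (a + 1))⁻¹ * oscAvg k Y (w i) t x) := fun i =>
      ((continuous_oscAvg hY (hw i) t).measurable.const_mul _).ennreal_ofReal
    refine (enorm_integral_prod_mul_le hrq hK (hS L' hL') (fun x hx => ?_)
      (c := ENNReal.ofReal (C₁ * t ^ (k + a))) hb fun x _ => ?_).trans ?_
    · exact image_eq_zero_of_notMem_tsupport fun h => hx (tsupport_pderivList_subset _ _ h)
    · have hnn : ∀ i, 0 ≤ (t ^ (a + 1))⁻¹ * oscAvg k Y (w i) t x := fun i =>
        mul_nonneg (by positivity) (oscAvg_nonneg _ _ _)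
      rw [Real.enorm_eq_ofReal_abs, ← ENNReal.ofReal_prod_of_nonneg fun i _ => hnn i,
        ← ENNReal.ofReal_mul (by positivity)]
      exact ENNReal.ofReal_le_ofReal (hC₁ w hw k₀ L hL2 t ht0 x)
    · refine mul_le_mul_right ?_ _
      rw [ENNReal.ofReal_mul hC₁0, mul_assoc]
      refine mul_le_mul_right ?_ _
      rw [mul_add, Finset.mul_sum]
      refine add_le_add ?_ (Finset.sum_le_sum fun i _ => ?_)
      · refine le_trans (mul_le_of_le_one_left bot_le ?_) ((measure_mono hψE).trans hEV)
        rw [← ENNReal.ofReal_one]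
        exact ENNReal.ofReal_le_ofReal (pow_le_one₀ ht0.le ht.2)
      · have hm1 : ∀ l : Fin k → Fin N, Measurable fun x => ∫⁻ y in Y,
            ‖pderivList (List.ofFn l) (w i) (x + t • y) -
              pderivList (List.ofFn l) (w i) x‖ₑ ^ q := by
          intro l
          have h := (hw i).pderivList (List.ofFn l) |>.continuous
          have : Continuous fun p : Euc N × Euc N => pderivList (List.ofFn l) (w i)
            (p.1 + t • p.2) - pderivList (List.ofFn l) (w i) p.1 := by fun_prop
          exact (this.measurable.enorm.pow_const q).lintegral_prod_right'
        calc ENNReal.ofReal (t ^ (k + a)) * ∫⁻ x in tsupport ψ,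
              ENNReal.ofReal ((t ^ (a + 1))⁻¹ * oscAvg k Y (w i) t x) ^ q
            ≤ ENNReal.ofReal (t ^ (k + a)) * ∫⁻ x in tsupport ψ,
              ENNReal.ofReal (t ^ ((a + 1) * q))⁻¹ * (c₁ * ∑ l : Fin k → Fin N, ∫⁻ y in Y,
                ‖pderivList (List.ofFn l) (w i) (x + t • y) -
                  pderivList (List.ofFn l) (w i) x‖ₑ ^ q) := by
              gcongr with x
              rw [ENNReal.ofReal_mul (by positivity), mul_pow,
                ← ENNReal.ofReal_pow (by positivity), inv_pow, ← pow_mul]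
              gcongr
              exact ofReal_oscAvg_pow_le hY hq (hw i) t x
          _ = c₁ * ∑ l, J i l t := by
              simp only [hJ]
              rw [lintegral_const_mul' _ _ ENNReal.ofReal_ne_top, lintegral_const_mul' _ _ hc₁t,
                lintegral_finsetSum _ fun l _ => hm1 l, ← Finset.mul_sum,
                ENNReal.ofReal_mul (by positivity)]
              ring
          _ ≤ _ := le_rfl
  calc _ ≤ ∫⁻ t in Set.Ioc (0 : ℝ) 1, ∑ _k₀ : Fin r, (r.factorial : ENNReal) ^ (k + a + 1) *
        (ENNReal.ofReal S * (ENNReal.ofReal C₁ * (V + ∑ i, c₁ * ∑ l, J i l t))) :=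
        setLIntegral_mono' measurableSet_Ioc fun t ht =>
          Finset.sum_le_sum fun k₀ _ => hpt t ht k₀
    _ = r * ((r.factorial : ENNReal) ^ (k + a + 1) * (ENNReal.ofReal S * (ENNReal.ofReal C₁ *
        ∫⁻ t in Set.Ioc (0 : ℝ) 1, (V + ∑ i, c₁ * ∑ l, J i l t)))) := by
        simp only [Finset.sum_const, Finset.card_univ, Fintype.card_fin, nsmul_eq_mul]
        rw [lintegral_const_mul' _ _ (by finiteness), lintegral_const_mul' _ _ (by finiteness),
          lintegral_const_mul' _ _ (by finiteness), lintegral_const_mul' _ _ (by finiteness)]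
    _ ≤ r * ((r.factorial : ENNReal) ^ (k + a + 1) * (ENNReal.ofReal S * (ENNReal.ofReal C₁ *
        M))) := by
        gcongr
        rw [lintegral_add_left measurable_const, lintegral_finsetSum _ fun i _ =>
          (Finset.measurable_fun_sum _ fun l _ => hJm i l).const_mul _]
        refine add_le_add (by simp) (Finset.sum_le_sum fun i _ => ?_)
        rw [lintegral_const_mul' _ _ hc₁t, lintegral_finsetSum _ fun l _ => hJm i l]
        gcongr with l
        exact hJint i l
    _ = _ := by ring

end FractionalEstimate

section Core

variable {N r m k q : ℕ}

/-- The `q`-th power of the Sobolev norm of order `k` on `E`; for `P = some p` the Gagliardo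
seminorm of the `k`-th derivatives with kernel `|x - z|^{-p}` is included. -/
def energy (E : Set (Euc N)) (k q : ℕ) (P : Option ℕ) (w : Euc N → ℝ) : ENNReal :=
  (∑ j ∈ Finset.range (k + 1), ∑ l : Fin j → Fin N,
    ∫⁻ x in E, ‖pderivList (List.ofFn l) w x‖ₑ ^ q) +
  P.elim 0 fun p => ∑ l : Fin k → Fin N, ∫⁻ x in E, ∫⁻ z in E,
    ‖pderivList (List.ofFn l) w x - pderivList (List.ofFn l) w z‖ₑ ^ q / ‖x - z‖ₑ ^ p

/-- The orders of differentiability `k` and kernel exponents corresponding to the space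
`W^{m - m/q, q}` in dimension `N`. -/
def IsCritical (N m q k : ℕ) : Option ℕ → Prop
  | none => ∃ j, m = j * q ∧ k + j = m
  | some p => 1 ≤ p ∧ k < m ∧ p + m = N + (m - k) * q

lemma lintegral_pderivList_le_energy {E : Set (Euc N)} {P : Option ℕ} {w : Euc N → ℝ}
    {W : List (Fin N)} (hW : W.length ≤ k) :
    ∫⁻ x in E, ‖pderivList W w x‖ₑ ^ q ≤ energy E k q P w := by
  refine le_trans ?_ le_self_add
  refine le_trans ?_ (Finset.single_le_sum (f := fun j => ∑ l : Fin j → Fin N,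
    ∫⁻ x in E, ‖pderivList (List.ofFn l) w x‖ₑ ^ q) (fun _ _ => bot_le)
    (Finset.mem_range.2 (Nat.lt_succ_of_le hW)))
  refine le_trans (le_of_eq ?_) (Finset.single_le_sum (f := fun l : Fin W.length → Fin N =>
    ∫⁻ x in E, ‖pderivList (List.ofFn l) w x‖ₑ ^ q) (fun _ _ => bot_le)
    (Finset.mem_univ W.get))
  simp

lemma lintegral_gagliardo_le_energy {E : Set (Euc N)} {p : ℕ} {w : Euc N → ℝ}
    (l : Fin k → Fin N) :
    ∫⁻ x in E, ∫⁻ z in E,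
      ‖pderivList (List.ofFn l) w x - pderivList (List.ofFn l) w z‖ₑ ^ q / ‖x - z‖ₑ ^ p ≤
      energy E k q (some p) w :=
  (Finset.single_le_sum (f := fun l : Fin k → Fin N => ∫⁻ x in E, ∫⁻ z in E,
      ‖pderivList (List.ofFn l) w x - pderivList (List.ofFn l) w z‖ₑ ^ q / ‖x - z‖ₑ ^ p)
    (fun _ _ => bot_le) (Finset.mem_univ l)).trans le_add_self

/-- The averaged part of the estimate, at scale `1`. -/
lemma exists_enorm_integral_avgTaylor_le (hr : 1 ≤ r) (hrq : r ≤ q) {ρ : Euc N → ℝ}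
    (hρ : IsSmooth ρ) (hc : HasCompactSupport ρ) {V : ENNReal} (hV : V ≠ ⊤) (m : ℕ) :
    ∃ C : ENNReal, C ≠ ⊤ ∧ ∀ (α : Fin m → Fin r → Fin N) (w : Fin r → Euc N → ℝ)
      (ψ : Euc N → ℝ) (S : ℝ) (E : Set (Euc N)), (∀ i, IsSmooth (w i)) → IsSmooth ψ →
      HasCompactSupport ψ → (∀ W : List (Fin N), W.length = m → ∀ x, |pderivList W ψ x| ≤ S) →
      MeasurableSet E → volume E ≤ V → tsupport ψ ⊆ E →
      (∀ x ∈ tsupport ψ, ∀ y ∈ tsupport ρ, x + y ∈ E) →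
      (∀ i, ∫⁻ x in E, ‖w i x‖ₑ ^ q ≤ 1) →
      ‖∫ x, slotForm m α (fun i => avgTaylor m ρ 1 (w i)) x * ψ x‖ₑ ≤
        C * ENNReal.ofReal S := by
  have hY : IsCompact (tsupport ρ) := hc
  set Y := tsupport ρ with hYdef
  obtain ⟨C₁, hC₁0, hC₁⟩ := exists_avgTaylor_one_bound hY m m hρ hYdef.ge
  have hYt : volume Y ≠ ⊤ := hY.measure_lt_top.ne
  refine ⟨(r.factorial : ENNReal) ^ m * (ENNReal.ofReal (C₁ ^ r) *
    (V + ∑ _i : Fin r, volume Y ^ (q - 1) * V)), ?_, ?_⟩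
  · have : (∑ _i : Fin r, volume Y ^ (q - 1) * V) ≠ ⊤ :=
      ENNReal.sum_ne_top.2 fun _ _ => by finiteness
    finiteness
  intro α w ψ S E hw hψ hcψ hS hE hEV hψE hEx hG
  have hK : MeasurableSet (tsupport ψ) := (isClosed_tsupport ψ).measurableSet
  have hcont : ∀ i, Continuous fun x => ∫ y in Y, |w i (x + y)| := fun i => by
    have h := (hw i).continuous
    exact continuous_parametric_integral_of_continuous (by unfold Function.uncurry; fun_prop) hY
  refine (enorm_integral_slotForm_le α (fun _ => ⟨0, hr⟩)
    (fun i => IsSmooth.avgTaylor m hρ hc (hw i) 1) hψ hcψ (ENNReal.ofReal (C₁ ^ r) *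
    (V + ∑ _i : Fin r, volume Y ^ (q - 1) * V) * ENNReal.ofReal S) ?_).trans_eq (by ring)
  intro L L' hL' hL
  have hnn : ∀ i x, 0 ≤ ∫ y in Y, |w i (x + y)| := fun i x =>
    integral_nonneg fun _ => abs_nonneg _
  refine (enorm_integral_prod_mul_le hrq hK (hS L' hL') (fun x hx => ?_)
    (c := ENNReal.ofReal (C₁ ^ r)) (b := fun i x => ENNReal.ofReal (∫ y in Y, |w i (x + y)|))
    (fun i => (hcont i).measurable.ennreal_ofReal) fun x _ => ?_).trans ?_
  · exact image_eq_zero_of_notMem_tsupport fun h => hx (tsupport_pderivList_subset _ _ h)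
  · rw [Real.enorm_eq_ofReal_abs, ← ENNReal.ofReal_prod_of_nonneg fun i _ => hnn i x,
      ← ENNReal.ofReal_mul (by positivity), Finset.abs_prod]
    refine ENNReal.ofReal_le_ofReal ?_
    calc ∏ i, |pderivList (L i) (avgTaylor m ρ 1 (w i)) x|
        ≤ ∏ i, (C₁ * ∫ y in Y, |w i (x + y)|) :=
          Finset.prod_le_prod (fun _ _ => abs_nonneg _) fun i _ =>
            hC₁ _ (by have := hL i; omega) _ (hw i) x
      _ = _ := by rw [Finset.prod_mul_distrib]; simp
  · rw [mul_comm]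
    gcongr with i
    · exact (measure_mono hψE).trans hEV
    have hY2 : ∀ x, ENNReal.ofReal (∫ y in Y, |w i (x + y)|) ^ q ≤
        volume Y ^ (q - 1) * ∫⁻ y in Y, ‖w i (x + y)‖ₑ ^ q := by
      intro x
      have h := (hw i).continuous
      have hco : Continuous fun y => w i (x + y) := by fun_prop
      rw [show (∫ y in Y, |w i (x + y)|) = ∫ y in Y, ‖w i (x + y)‖ from rfl,
        ofReal_integral_norm_eq_lintegral_enorm (hco.continuousOn.integrableOn_compact hY)]
      simpa using lintegral_pow_le (volume.restrict Y) hco.measurable.enorm.aemeasurable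
        (by omega : 1 ≤ q)
    calc ∫⁻ x in tsupport ψ, ENNReal.ofReal (∫ y in Y, |w i (x + y)|) ^ q
        ≤ ∫⁻ x in tsupport ψ, volume Y ^ (q - 1) * 1 := by
          refine setLIntegral_mono' hK fun x hx => (hY2 x).trans ?_
          gcongr
          calc ∫⁻ y in Y, ‖w i (x + y)‖ₑ ^ q
              ≤ ∫⁻ y in (fun y => x + y) ⁻¹' E, ‖w i (x + y)‖ₑ ^ q :=
                lintegral_mono_set fun y hy => hEx x hx y hy
            _ = ∫⁻ z in E, ‖w i z‖ₑ ^ q :=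
                (measurePreserving_add_left volume x).setLIntegral_comp_preimage hE
                  ((hw i).continuous.measurable.enorm.pow_const q)
            _ ≤ 1 := hG i
      _ = volume Y ^ (q - 1) * volume (tsupport ψ) := by simp
      _ ≤ _ := by gcongr; exact (measure_mono hψE).trans hEV

lemma card_filter_mod_ge {j : ℕ} (hr : 1 ≤ r) (hrq : r ≤ q) (hm : m = j * q) (i : Fin r) :
    j ≤ (Finset.univ.filter fun s : Fin m =>
      (⟨s % r, Nat.mod_lt _ hr⟩ : Fin r) = i).card := by
  have hmem : ∀ t : Fin j, t * r + i < m := by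
    intro t
    have h1 : (t : ℕ) * r + i < (t + 1) * r := by rw [add_mul, one_mul]; omega
    calc (t : ℕ) * r + i < (t + 1) * r := h1
      _ ≤ j * q := Nat.mul_le_mul t.2 hrq
      _ = m := hm.symm
  have h := Finset.card_le_card_of_injOn (s := (Finset.univ : Finset (Fin j)))
    (t := Finset.univ.filter fun s : Fin m => (⟨s % r, Nat.mod_lt _ hr⟩ : Fin r) = i)
    (fun t => ⟨t * r + i, hmem t⟩) ?_ ?_
  · simpa using h
  · intro t _
    simp [Fin.ext_iff, Nat.mod_eq_of_lt i.2]
  · intro t _ t' _ h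
    simp only [Fin.mk.injEq, add_left_inj] at h
    exact Fin.ext (Nat.eq_of_mul_eq_mul_right hr h)

/-- The multilinear estimate for smooth functions whose energies are normalised. -/
theorem exists_enorm_integral_slotForm_le (hr : 1 ≤ r) (hrq : r ≤ q) {P : Option ℕ}
    (hP : IsCritical N m q k P) {ρ : Euc N → ℝ} (hρ : IsSmooth ρ) (hc : HasCompactSupport ρ)
    (hρ1 : ∫ y, ρ y = 1) {V : ENNReal} (hV : V ≠ ⊤) :
    ∃ C : ENNReal, C ≠ ⊤ ∧ ∀ (α : Fin m → Fin r → Fin N) (w : Fin r → Euc N → ℝ)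
      (ψ : Euc N → ℝ) (S : ℝ) (E : Set (Euc N)), (∀ i, IsSmooth (w i)) → IsSmooth ψ →
      HasCompactSupport ψ → (∀ W : List (Fin N), W.length = m → ∀ x, |pderivList W ψ x| ≤ S) →
      MeasurableSet E → volume E ≤ V → tsupport ψ ⊆ E →
      (∀ t ∈ Set.Icc (0 : ℝ) 1, ∀ x ∈ tsupport ψ, ∀ y ∈ tsupport ρ, x + t • y ∈ E) →
      (∀ i, energy E k q P (w i) ≤ 1) →
      ‖∫ x, slotForm m α w x * ψ x‖ₑ ≤ C * ENNReal.ofReal S := by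
  rcases P with _ | p
  · obtain ⟨j, hm, hkj⟩ := hP
    refine ⟨(r.factorial : ENNReal) ^ m * (V + ∑ _i : Fin r, 1), ?_, ?_⟩
    · have : (∑ _i : Fin r, (1 : ENNReal)) ≠ ⊤ := ENNReal.sum_ne_top.2 fun _ _ => by finiteness
      finiteness
    intro α w ψ S E hw hψ hcψ hS hE hEV hψE hEx hG
    have hK : MeasurableSet (tsupport ψ) := (isClosed_tsupport ψ).measurableSet
    refine (enorm_integral_slotForm_le α (fun s => ⟨s % r, Nat.mod_lt _ hr⟩) hw hψ hcψ
      ((V + ∑ _i : Fin r, 1) * ENNReal.ofReal S) ?_).trans_eq (by ring)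
    intro L L' hL' hL
    refine (enorm_integral_prod_mul_le hrq hK (hS L' hL') (fun x hx => ?_)
      (c := 1) (b := fun i x => ‖pderivList (L i) (w i) x‖ₑ)
      (fun i => ((hw i).pderivList _).continuous.measurable.enorm) fun x _ => ?_).trans ?_
    · exact image_eq_zero_of_notMem_tsupport fun h => hx (tsupport_pderivList_subset _ _ h)
    · simp [Real.enorm_eq_ofReal_abs, Finset.abs_prod,
        ENNReal.ofReal_prod_of_nonneg fun i _ => abs_nonneg _]
    · rw [mul_comm, one_mul]
      gcongr with i
      · exact (measure_mono hψE).trans hEV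
      · refine (lintegral_mono_set hψE).trans
          ((lintegral_pderivList_le_energy ?_).trans (hG i))
        have h1 := hL i
        have h2 := card_filter_mod_ge hr hrq hm i
        omega
  · obtain ⟨hp1, hkm, hp⟩ := hP
    obtain ⟨a, rfl⟩ : ∃ a, m = k + a + 1 := ⟨m - k - 1, by omega⟩
    obtain ⟨C₁, hC₁, h₁⟩ := exists_enorm_integral_avgTaylor_le hr hrq hρ hc hV (k + a + 1)
    obtain ⟨C₂, hC₂, h₂⟩ := exists_lintegral_path_bound (r := r) (q := q) (k := k) (a := a) hp1
      (by rw [hp]; congr 2; omega) (by omega) hrq hc hρ subset_rfl hV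
    refine ⟨C₁ + C₂, ENNReal.add_ne_top.2 ⟨hC₁, hC₂⟩, ?_⟩
    intro α w ψ S E hw hψ hcψ hS hE hEV hψE hEx hG
    refine (enorm_integral_slotForm_le_add α hρ hc hρ1 hw hψ hcψ).trans ?_
    rw [add_mul]
    refine add_le_add (h₁ α w ψ S E hw hψ hcψ hS hE hEV hψE (fun x hx y hy => ?_) fun i => ?_)
      (h₂ α w ψ S E hw hψ hcψ hS hE hEV hψE hEx fun i l =>
        (lintegral_gagliardo_le_energy l).trans (hG i))
    · simpa using hEx 1 (by simp) x hx y hy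
    · exact (lintegral_pderivList_le_energy (W := []) (by simp)).trans (hG i)

end Core

section Smoothing

variable {N m : ℕ}

lemma contDiffOn_pderivList {U : Set (Euc N)} (hU : IsOpen U) (W : List (Fin N)) {n : ℕ}
    {f : Euc N → ℝ} (hf : ContDiffOn ℝ ((n + W.length : ℕ) : WithTop ℕ∞) f U) :
    ContDiffOn ℝ n (pderivList W f) U := by
  induction W generalizing n with
  | nil => simpa [pderivList] using hf
  | cons i W ih =>
    have h := ih (n := n + 1) (by simpa [add_assoc, add_comm 1] using hf)
    have h2 : ContDiffOn ℝ n (fderiv ℝ (pderivList W f)) U :=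
      h.fderiv_of_isOpen hU (by norm_cast)
    exact h2.clm_apply contDiffOn_const

lemma ContDiffOn.continuousOn_pderivList {U : Set (Euc N)} (hU : IsOpen U) {W : List (Fin N)}
    {f : Euc N → ℝ} (hf : ContDiffOn ℝ m f U) (hW : W.length ≤ m) :
    ContinuousOn (pderivList W f) U :=
  (contDiffOn_pderivList hU W (n := 0)
    (hf.of_le (by simpa using hW))).continuousOn

lemma pderivList_eventuallyEq {f g : Euc N → ℝ} {x : Euc N} (h : f =ᶠ[𝓝 x] g)
    (W : List (Fin N)) : pderivList W f =ᶠ[𝓝 x] pderivList W g := by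
  induction W with
  | nil => exact h
  | cons i W ih =>
    filter_upwards [ih.fderiv (𝕜 := ℝ)] with y hy
    simp only [pderivList, pderiv', hy]

lemma pderivList_const_mul (c : ℝ) (f : Euc N → ℝ) (W : List (Fin N)) :
    pderivList W (fun x => c * f x) = fun x => c * pderivList W f x := by
  induction W with
  | nil => rfl
  | cons i W ih =>
    funext x
    have h := fderiv_const_smul_field (𝕜 := ℝ) (f := pderivList W f) c
    have h2 : (fun x => c * pderivList W f x) = c • pderivList W f := rfl
    simp only [pderivList, pderiv', ih, h2, h]
    rfl

/-- A `C^m` function on an open set agrees near a compact subset with a compactly supported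
`C^m` function. -/
lemma exists_contDiff_cutoff {U A : Set (Euc N)} (hU : IsOpen U) (hA : IsCompact A)
    (hAU : A ⊆ U) {f : Euc N → ℝ} (hf : ContDiffOn ℝ m f U) :
    ∃ δ > 0, ∃ g : Euc N → ℝ, ContDiff ℝ m g ∧ HasCompactSupport g ∧
      ∀ x ∈ A, ∀ y, ‖y‖ < δ → x - y ∈ U ∧
        ∀ W, pderivList W g (x - y) = pderivList W f (x - y) := by
  obtain ⟨δ, hδ, hδU⟩ := hA.exists_cthickening_subset_open hU hAU
  have hδ2 : δ / 2 < δ := by linarith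
  obtain ⟨χ, hχ, -, hsupp, hone⟩ := exists_contMDiff_support_eq_eq_one_iff
    (modelWithCornersSelf ℝ (Euc N)) (n := (⊤ : ℕ∞)) (Metric.isOpen_thickening (δ := δ) (E := A))
    (Metric.isClosed_cthickening (δ := δ / 2) (E := A))
    (Metric.cthickening_subset_thickening' hδ hδ2 A)
  have hχ : ContDiff ℝ (⊤ : ℕ∞) χ := hχ.contDiff
  have htχ : tsupport χ ⊆ Metric.cthickening δ A := by
    rw [tsupport, hsupp]; exact Metric.closure_thickening_subset_cthickening _ _
  have hcχ : HasCompactSupport χ := (hA.cthickening).of_isClosed_subset (isClosed_tsupport _) htχ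
  refine ⟨δ / 2, by positivity, fun x => χ x * f x, ?_, hcχ.mul_right, fun x hx y hy => ?_⟩
  · refine contDiff_iff_contDiffAt.2 fun x => ?_
    by_cases hx : x ∈ tsupport χ
    · exact (hχ.of_le (by exact_mod_cast le_top)).contDiffAt.mul
        (hf.contDiffAt (hU.mem_nhds (hδU (htχ hx))))
    · have h0 : (fun x => χ x * f x) =ᶠ[𝓝 x] fun _ => 0 := by
        filter_upwards [notMem_tsupport_iff_eventuallyEq.1 hx] with y hy
        simp [hy]
      exact contDiffAt_const.congr_of_eventuallyEq h0
  · have hmem : x - y ∈ Metric.thickening (δ / 2) A :=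
      Metric.mem_thickening_iff.2 ⟨x, hx, by simpa [dist_eq_norm] using hy⟩
    refine ⟨hδU (Metric.thickening_subset_cthickening _ _
      (Metric.thickening_mono hδ2.le _ hmem)), fun W => ?_⟩
    refine (pderivList_eventuallyEq ?_ W).self_of_nhds
    filter_upwards [Metric.isOpen_thickening.mem_nhds hmem] with z hz
    rw [(hone z).1 (Metric.thickening_subset_cthickening _ _ hz), one_mul]

open scoped Convolution

/-- Mollification of `g` by `φ`. -/
def mollify (φ g : Euc N → ℝ) : Euc N → ℝ :=
  φ ⋆[ContinuousLinearMap.lsmul ℝ ℝ, volume] g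

lemma mollify_apply (φ g : Euc N → ℝ) (x : Euc N) :
    mollify φ g x = ∫ y, φ y * g (x - y) := by
  simp [mollify, convolution_def]

lemma IsSmooth.mollify {φ g : Euc N → ℝ} (hφ : IsSmooth φ) (hc : HasCompactSupport φ)
    (hg : Continuous g) : IsSmooth (mollify φ g) :=
  hc.contDiff_convolution_left _ hφ hg.locallyIntegrable

lemma pderiv'_mollify {φ g : Euc N → ℝ} (hφ : Continuous φ) (hg : ContDiff ℝ 1 g)
    (hcg : HasCompactSupport g) (i : Fin N) :
    pderiv' i (mollify φ g) = mollify φ (pderiv' i g) := by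
  funext x
  have h := hcg.hasFDerivAt_convolution_right (ContinuousLinearMap.lsmul ℝ ℝ)
    (hφ.locallyIntegrable (μ := volume)) hg x
  rw [pderiv', mollify, h.fderiv, convolution_precompR_apply _ hφ.locallyIntegrable
    (hcg.fderiv (𝕜 := ℝ)) (hg.continuous_fderiv (by simp))]
  rfl

lemma pderivList_mollify {φ g : Euc N → ℝ} (hφ : Continuous φ) {W : List (Fin N)}
    (hg : ContDiff ℝ m g) (hW : W.length ≤ m) (hcg : HasCompactSupport g) :
    pderivList W (mollify φ g) = mollify φ (pderivList W g) := by
  induction W with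
  | nil => rfl
  | cons i W ih =>
    have hW' : W.length + 1 ≤ m := by simpa using hW
    simp only [pderivList]
    rw [ih (by omega), pderiv'_mollify hφ]
    · exact contDiffOn_univ.1 (contDiffOn_pderivList isOpen_univ W (n := 1)
        (hg.contDiffOn.of_le (by norm_cast; omega)))
    · exact hcg.of_isClosed_subset (isClosed_tsupport _) (tsupport_pderivList_subset _ _)

end Smoothing

section SmoothingEnergy

variable {N m k q : ℕ}

lemma enorm_integral_mul_pow_le {φ h : Euc N → ℝ} (hφ : Continuous φ) (hφ0 : ∀ y, 0 ≤ φ y)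
    (hφ1 : ∫⁻ y, ENNReal.ofReal (φ y) = 1) (hh : Continuous h) (hq : 1 ≤ q) :
    ‖∫ y, φ y * h y‖ₑ ^ q ≤ ∫⁻ y, ENNReal.ofReal (φ y) * ‖h y‖ₑ ^ q := by
  have hm : Measurable fun y => ENNReal.ofReal (φ y) := hφ.measurable.ennreal_ofReal
  have h1 : ‖∫ y, φ y * h y‖ₑ ≤ ∫⁻ y, ‖h y‖ₑ ∂(volume.withDensity fun y =>
      ENNReal.ofReal (φ y)) := by
    rw [lintegral_withDensity_eq_lintegral_mul _ hm hh.measurable.enorm]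
    refine (enorm_integral_le_lintegral_enorm _).trans_eq (lintegral_congr fun y => ?_)
    simp [enorm_mul, Real.enorm_of_nonneg (hφ0 y)]
  have h2 := lintegral_pow_le (volume.withDensity fun y => ENNReal.ofReal (φ y))
    hh.measurable.enorm.aemeasurable hq
  rw [lintegral_withDensity_eq_lintegral_mul _ hm (hh.measurable.enorm.pow_const q)] at h2
  simp only [withDensity_apply _ MeasurableSet.univ, Measure.restrict_univ, hφ1, one_pow,
    one_mul] at h2
  calc _ ≤ _ := pow_le_pow_left' h1 q
    _ ≤ _ := h2

lemma setLIntegral_comp_sub_le {A U : Set (Euc N)} (H : Euc N → ENNReal) {y : Euc N}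
    (h : ∀ x ∈ A, x - y ∈ U) : ∫⁻ x in A, H (x - y) ≤ ∫⁻ x in U, H x := by
  rw [← (measurePreserving_sub_right volume y).setLIntegral_comp_preimage_emb
    (MeasurableEquiv.subRight y).measurableEmbedding H U]
  exact lintegral_mono_set h

lemma lintegral_weight_mul_le {φ : Euc N → ℝ} (hφ : Continuous φ)
    (hφ1 : ∫⁻ y, ENNReal.ofReal (φ y) = 1) {F : Euc N → ENNReal} {I : ENNReal}
    (hF : ∀ y, φ y ≠ 0 → F y ≤ I) : ∫⁻ y, ENNReal.ofReal (φ y) * F y ≤ I := by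
  calc ∫⁻ y, ENNReal.ofReal (φ y) * F y ≤ ∫⁻ y, ENNReal.ofReal (φ y) * I := by
        refine lintegral_mono fun y => ?_
        by_cases hy : φ y = 0
        · simp [hy]
        · gcongr; exact hF y hy
    _ = I := by
        rw [lintegral_mul_const _ hφ.measurable.ennreal_ofReal, hφ1, one_mul]

lemma lintegral_mollify_le {A U : Set (Euc N)} (hA : MeasurableSet A) (hq : 1 ≤ q)
    {φ F G : Euc N → ℝ} (hφ : Continuous φ) (hφ0 : ∀ y, 0 ≤ φ y)
    (hφ1 : ∫⁻ y, ENNReal.ofReal (φ y) = 1) (hG : Continuous G)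
    (h : ∀ x ∈ A, ∀ y, φ y ≠ 0 → x - y ∈ U ∧ G (x - y) = F (x - y)) :
    ∫⁻ x in A, ‖mollify φ G x‖ₑ ^ q ≤ ∫⁻ x in U, ‖F x‖ₑ ^ q := by
  calc ∫⁻ x in A, ‖mollify φ (G) x‖ₑ ^ q
      ≤ ∫⁻ x in A, ∫⁻ y, ENNReal.ofReal (φ y) * ‖G (x - y)‖ₑ ^ q := by
        refine lintegral_mono fun x => ?_
        rw [mollify_apply]
        exact enorm_integral_mul_pow_le hφ hφ0 hφ1 (by fun_prop) hq
    _ = ∫⁻ y, ENNReal.ofReal (φ y) * ∫⁻ x in A,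
          ‖G (x - y)‖ₑ ^ q := by
        rw [lintegral_lintegral_swap (by
          have : Measurable fun p : Euc N × Euc N => G (p.1 - p.2) :=
            Continuous.measurable (by fun_prop)
          have h2 : Measurable fun p : Euc N × Euc N => ENNReal.ofReal (φ p.2) :=
            (hφ.measurable.comp measurable_snd).ennreal_ofReal
          exact (h2.mul (this.enorm.pow_const q)).aemeasurable)]
        refine lintegral_congr fun y => lintegral_const_mul' _ _ ENNReal.ofReal_ne_top
    _ ≤ _ := lintegral_weight_mul_le hφ hφ1 fun y hy => by
        calc ∫⁻ x in A, ‖G (x - y)‖ₑ ^ q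
            = ∫⁻ x in A, ‖F (x - y)‖ₑ ^ q :=
              setLIntegral_congr_fun hA fun x hx => by simp only [(h x hx y hy).2]
          _ ≤ _ := setLIntegral_comp_sub_le (fun x => ‖F x‖ₑ ^ q)
              fun x hx => (h x hx y hy).1

lemma lintegral_gagliardo_mollify_le {A U : Set (Euc N)} (hA : MeasurableSet A) (hq : 1 ≤ q)
    {φ F G : Euc N → ℝ} (hφ : Continuous φ) (hφ0 : ∀ y, 0 ≤ φ y)
    (hφ1 : ∫⁻ y, ENNReal.ofReal (φ y) = 1) (hG : Continuous G) (hcG : HasCompactSupport G)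
    (h : ∀ x ∈ A, ∀ y, φ y ≠ 0 → x - y ∈ U ∧ G (x - y) = F (x - y)) (p : ℕ) :
    ∫⁻ x in A, ∫⁻ z in A, ‖mollify φ G x - mollify φ G z‖ₑ ^ q / ‖x - z‖ₑ ^ p ≤
      ∫⁻ x in U, ∫⁻ z in U, ‖F x - F z‖ₑ ^ q / ‖x - z‖ₑ ^ p := by
  have hφm : Measurable fun p : Euc N × Euc N => ENNReal.ofReal (φ p.2) :=
    (hφ.measurable.comp measurable_snd).ennreal_ofReal
  obtain ⟨D, hD⟩ : ∃ D : (Euc N → ℝ) → Euc N → Euc N → Euc N → ENNReal, ∀ F x z y,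
      D F x z y = ‖F (x - y) - F (z - y)‖ₑ ^ q / ‖x - z‖ₑ ^ p := ⟨_, fun _ _ _ _ => rfl⟩
  have hDm : Measurable fun v : (Euc N × Euc N) × Euc N => D G v.1.1 v.1.2 v.2 := by
    simp only [hD]
    have h1 : Measurable fun v : (Euc N × Euc N) × Euc N => G (v.1.1 - v.2) - G (v.1.2 - v.2) :=
      Continuous.measurable (by fun_prop)
    have h2 : Measurable fun v : (Euc N × Euc N) × Euc N => v.1.1 - v.1.2 :=
      Continuous.measurable (by fun_prop)
    exact (h1.enorm.pow_const q).div (h2.enorm.pow_const p)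
  calc ∫⁻ x in A, ∫⁻ z in A, ‖mollify φ G x - mollify φ G z‖ₑ ^ q / ‖x - z‖ₑ ^ p
      ≤ ∫⁻ x in A, ∫⁻ z in A, ∫⁻ y, ENNReal.ofReal (φ y) * D G x z y := by
        refine lintegral_mono fun x => lintegral_mono fun z => ?_
        have hi : ∀ x, Integrable fun y => φ y * G (x - y) := fun x =>
          Continuous.integrable_of_hasCompactSupport (by fun_prop)
            (HasCompactSupport.mul_left (hcG.comp_homeomorph (Homeomorph.subLeft x)))
        simp only [mollify_apply]
        rw [← integral_sub (hi x) (hi z), div_eq_mul_inv]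
        simp only [← mul_sub]
        calc _ ≤ (∫⁻ y, ENNReal.ofReal (φ y) * ‖G (x - y) - G (z - y)‖ₑ ^ q) *
              (‖x - z‖ₑ ^ p)⁻¹ := by
              gcongr
              exact enorm_integral_mul_pow_le hφ hφ0 hφ1 (by fun_prop) hq
          _ ≤ ∫⁻ y, ENNReal.ofReal (φ y) * ‖G (x - y) - G (z - y)‖ₑ ^ q *
              (‖x - z‖ₑ ^ p)⁻¹ := lintegral_mul_const_le _ _
          _ = _ := lintegral_congr fun y => by rw [hD, mul_assoc, div_eq_mul_inv]
    _ = ∫⁻ x in A, ∫⁻ y, ENNReal.ofReal (φ y) * ∫⁻ z in A, D G x z y := by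
        refine lintegral_congr fun x => ?_
        rw [lintegral_lintegral_swap]
        · exact lintegral_congr fun y => lintegral_const_mul' _ _ ENNReal.ofReal_ne_top
        · refine (hφm.mul ?_).aemeasurable
          exact hDm.comp (f := fun v : Euc N × Euc N => ((x, v.1), v.2)) (by fun_prop)
    _ = ∫⁻ y, ENNReal.ofReal (φ y) * ∫⁻ x in A, ∫⁻ z in A, D G x z y := by
        rw [lintegral_lintegral_swap]
        · exact lintegral_congr fun y => lintegral_const_mul' _ _ ENNReal.ofReal_ne_top
        · refine (hφm.mul ?_).aemeasurable
          have : Measurable fun v : (Euc N × Euc N) × Euc N => D G v.1.1 v.2 v.1.2 :=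
            hDm.comp (f := fun v : (Euc N × Euc N) × Euc N => ((v.1.1, v.2), v.1.2))
              (by fun_prop)
          exact this.lintegral_prod_right'
    _ ≤ _ := lintegral_weight_mul_le hφ hφ1 fun y hy => by
        calc ∫⁻ x in A, ∫⁻ z in A, D G x z y
            = ∫⁻ x in A, ∫⁻ z in A, D F x z y :=
              setLIntegral_congr_fun hA fun x hx => setLIntegral_congr_fun hA fun z hz => by
                simp only [hD, (h x hx y hy).2, (h z hz y hy).2]
          _ ≤ ∫⁻ x in A, ∫⁻ z in U, ‖F (x - y) - F z‖ₑ ^ q / ‖x - y - z‖ₑ ^ p := by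
              refine lintegral_mono fun x => le_trans (le_of_eq ?_) (setLIntegral_comp_sub_le
                (fun z => ‖F (x - y) - F z‖ₑ ^ q / ‖x - y - z‖ₑ ^ p)
                fun z hz => (h z hz y hy).1)
              simp [hD]
          _ ≤ _ := setLIntegral_comp_sub_le (fun x => ∫⁻ z in U, ‖F x - F z‖ₑ ^ q /
              ‖x - z‖ₑ ^ p) fun x hx => (h x hx y hy).1

lemma energy_mollify_le {A U : Set (Euc N)} (hA : MeasurableSet A) (hq : 1 ≤ q) (hkm : k ≤ m)
    {φ f g : Euc N → ℝ} (hφ : Continuous φ) (hφ0 : ∀ y, 0 ≤ φ y)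
    (hφ1 : ∫⁻ y, ENNReal.ofReal (φ y) = 1)
    (hg : ContDiff ℝ m g) (hcg : HasCompactSupport g)
    (h : ∀ x ∈ A, ∀ y, φ y ≠ 0 → x - y ∈ U ∧
      ∀ W, pderivList W g (x - y) = pderivList W f (x - y)) (P : Option ℕ) :
    energy A k q P (mollify φ g) ≤ energy U k q P f := by
  have hcont : ∀ W : List (Fin N), W.length ≤ m → Continuous (pderivList W g) := fun W hW =>
    continuousOn_univ.1 (hg.contDiffOn.continuousOn_pderivList isOpen_univ hW)
  rw [energy, energy]
  refine add_le_add (Finset.sum_le_sum fun j hj => Finset.sum_le_sum fun l _ => ?_) ?_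
  · have hlen : (List.ofFn l).length ≤ m := by
      have := Finset.mem_range.1 hj
      simp; omega
    have hG := hcont _ hlen
    rw [pderivList_mollify hφ hg hlen hcg]
    exact lintegral_mollify_le hA hq hφ hφ0 hφ1 hG fun x hx y hy =>
      ⟨(h x hx y hy).1, (h x hx y hy).2 _⟩
  · rcases P with _ | p
    · simp
    simp only [Option.elim_some]
    refine Finset.sum_le_sum fun l _ => ?_
    have hlen : (List.ofFn l).length ≤ m := by simpa using hkm
    have hG := hcont _ hlen
    rw [pderivList_mollify hφ hg hlen hcg]
    exact lintegral_gagliardo_mollify_le hA hq hφ hφ0 hφ1 hG (hcg.of_isClosed_subset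
      (isClosed_tsupport _) (tsupport_pderivList_subset _ _)) (fun x hx y hy =>
      ⟨(h x hx y hy).1, (h x hx y hy).2 _⟩) p

end SmoothingEnergy

section NonsmoothEstimate

variable {N m r k q : ℕ}

lemma abs_mollify_le {φ G : Euc N → ℝ} (hφ : Continuous φ) (hφ0 : ∀ y, 0 ≤ φ y)
    (hφ1 : ∫⁻ y, ENNReal.ofReal (φ y) = 1) (hG : Continuous G) {B : ℝ} (hB : 0 ≤ B)
    (hGB : ∀ x, |G x| ≤ B) (x : Euc N) : |mollify φ G x| ≤ B := by
  have h := enorm_integral_mul_pow_le (h := fun y => G (x - y)) hφ hφ0 hφ1 (by fun_prop)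
    (le_refl 1)
  rw [pow_one, ← mollify_apply, Real.enorm_eq_ofReal_abs] at h
  refine (ENNReal.ofReal_le_ofReal_iff hB).1 (h.trans (lintegral_weight_mul_le hφ hφ1
    fun y _ => ?_))
  rw [pow_one, Real.enorm_eq_ofReal_abs]
  exact ENNReal.ofReal_le_ofReal (hGB _)

/-- Interior approximation by smooth functions without increase of energy. -/
lemma exists_smooth_approx {U A : Set (Euc N)} (hU : IsOpen U) (hA : IsCompact A) (hAU : A ⊆ U)
    (hq : 1 ≤ q) (hkm : k ≤ m) (P : Option ℕ) {f : Euc N → ℝ} (hf : ContDiffOn ℝ m f U) :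
    ∃ u : ℕ → Euc N → ℝ, (∀ n, IsSmooth (u n)) ∧
      (∀ n, energy A k q P (u n) ≤ energy U k q P f) ∧
      (∃ B, 0 ≤ B ∧ ∀ W : List (Fin N), W.length ≤ m → ∀ n x, |pderivList W (u n) x| ≤ B) ∧
      ∀ W : List (Fin N), W.length ≤ m → ∀ x ∈ A,
        Tendsto (fun n => pderivList W (u n) x) atTop (𝓝 (pderivList W f x)) := by
  obtain ⟨δ, hδ, g, hg, hcg, hgf⟩ := exists_contDiff_cutoff hU hA hAU hf
  have hpos : ∀ n : ℕ, (0 : ℝ) < δ / (n + 2) := fun n => by positivity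
  obtain ⟨φ, hφ⟩ : ∃ φ : ℕ → ContDiffBump (0 : Euc N), ∀ n, (φ n).rOut = δ / (n + 2) :=
    ⟨fun n => ⟨δ / (n + 2) / 2, δ / (n + 2), half_pos (hpos n), half_lt_self (hpos n)⟩,
      fun _ => rfl⟩
  have hcont : ∀ n, Continuous ((φ n).normed volume) := fun n => (φ n).continuous_normed
  have h0 : ∀ n y, 0 ≤ (φ n).normed volume y := fun n => (φ n).nonneg_normed
  have h1 : ∀ n, ∫⁻ y, ENNReal.ofReal ((φ n).normed volume y) = 1 := fun n => by
    rw [← ofReal_integral_eq_lintegral_ofReal (φ n).integrable_normed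
      (Eventually.of_forall (h0 n)), (φ n).integral_normed, ENNReal.ofReal_one]
  have hne : ∀ n y, (φ n).normed volume y ≠ 0 → ‖y‖ < δ := fun n y hy => by
    have : y ∈ Function.support ((φ n).normed volume) := hy
    rw [(φ n).support_normed_eq, mem_ball_zero_iff, hφ] at this
    refine this.trans_le (div_le_self hδ.le ?_)
    have : (0 : ℝ) ≤ n := n.cast_nonneg
    linarith
  have hcW : ∀ W : List (Fin N), W.length ≤ m → Continuous (pderivList W g) := fun W hW =>
    continuousOn_univ.1 (hg.contDiffOn.continuousOn_pderivList isOpen_univ hW)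
  refine ⟨fun n => mollify ((φ n).normed volume) g, fun n => ?_, fun n => ?_, ?_, ?_⟩
  · exact IsSmooth.mollify (φ n).contDiff_normed (φ n).hasCompactSupport_normed hg.continuous
  · exact energy_mollify_le hA.measurableSet hq hkm (hcont n) (h0 n) (h1 n) hg hcg
      (fun x hx y hy => hgf x hx y (hne n y hy)) P
  · refine exists_uniform_words m (P := fun W B => ∀ n x,
      |pderivList W (mollify ((φ n).normed volume) g) x| ≤ B)
      (fun W B B' hBB h n x => (h n x).trans hBB) fun W hW => ?_
    obtain ⟨B, hB0, hB⟩ := exists_abs_le_of_hasCompactSupport (hcW W hW)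
      (hcg.of_isClosed_subset (isClosed_tsupport _) (tsupport_pderivList_subset W g))
    refine ⟨B, fun n x => ?_⟩
    rw [pderivList_mollify (hcont n) hg hW hcg]
    exact abs_mollify_le (hcont n) (h0 n) (h1 n) (hcW W hW) hB0 hB x
  · intro W hW x hx
    have e : pderivList W f x = pderivList W g x := by
      simpa using ((hgf x hx 0 (by simpa using hδ)).2 W).symm
    simp only [e, pderivList_mollify (hcont _) hg hW hcg]
    refine ContDiffBump.convolution_tendsto_right_of_continuous ?_ (hcW W hW) x
    simp only [hφ]
    exact tendsto_const_nhds.div_atTop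
      (tendsto_atTop_add_const_right _ _ tendsto_natCast_atTop_atTop)

lemma abs_slotForm_le (α : Fin m → Fin r → Fin N) {w : Fin r → Euc N → ℝ} {B : ℝ} {x : Euc N}
    (hB : ∀ i, ∀ W : List (Fin N), W.length = m → |pderivList W (w i) x| ≤ B) :
    |slotForm m α w x| ≤ ∑ _τ : Fin m → Equiv.Perm (Fin r), B ^ r := by
  refine (Finset.abs_sum_le_sum_abs _ _).trans (Finset.sum_le_sum fun τ _ => ?_)
  rw [abs_mul, Finset.abs_prod, Finset.abs_prod]
  have hs : ∏ s, |((Equiv.Perm.sign (τ s) : ℤ) : ℝ)| = 1 := Finset.prod_eq_one fun s _ => by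
    rcases Int.units_eq_one_or (Equiv.Perm.sign (τ s)) with h | h <;> simp [h]
  rw [hs, one_mul]
  refine (Finset.prod_le_prod (fun _ _ => abs_nonneg _) fun i _ => hB i _ (by simp)).trans ?_
  simp

lemma tendsto_slotForm (α : Fin m → Fin r → Fin N) {u : ℕ → Fin r → Euc N → ℝ}
    {w : Fin r → Euc N → ℝ} {x : Euc N} (h : ∀ i, ∀ W : List (Fin N), W.length = m →
      Tendsto (fun n => pderivList W (u n i) x) atTop (𝓝 (pderivList W (w i) x))) :
    Tendsto (fun n => slotForm m α (u n) x) atTop (𝓝 (slotForm m α w x)) :=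
  tendsto_finsetSum _ fun τ _ => (tendsto_finsetProd _ fun i _ =>
    h i _ (by simp)).const_mul _

lemma IsCritical.le {P : Option ℕ} (hP : IsCritical N m q k P) : k ≤ m := by
  rcases P with _ | p
  · obtain ⟨j, -, h⟩ := hP; omega
  · exact hP.2.1.le

lemma exists_enorm_setIntegral_slotForm_le (hr : 1 ≤ r) (hrq : r ≤ q) {P : Option ℕ}
    (hP : IsCritical N m q k P) {ρ : Euc N → ℝ} (hρ : IsSmooth ρ) (hc : HasCompactSupport ρ)
    (hρ1 : ∫ y, ρ y = 1) {U : Set (Euc N)} (hU : IsOpen U) (hUv : volume U ≠ ⊤) :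
    ∃ C : ENNReal, C ≠ ⊤ ∧ ∀ (α : Fin m → Fin r → Fin N) (w : Fin r → Euc N → ℝ)
      (ψ : Euc N → ℝ) (S : ℝ), (∀ i, ContDiffOn ℝ m (w i) U) → IsSmooth ψ →
      HasCompactSupport ψ → (∀ W : List (Fin N), W.length = m → ∀ x, |pderivList W ψ x| ≤ S) →
      (∀ t ∈ Set.Icc (0 : ℝ) 1, ∀ x ∈ tsupport ψ, ∀ y ∈ tsupport ρ, x + t • y ∈ U) →
      (∀ i, energy U k q P (w i) ≤ 1) →
      ‖∫ x in U, slotForm m α w x * ψ x‖ₑ ≤ C * ENNReal.ofReal S := by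
  obtain ⟨C, hC, h⟩ := exists_enorm_integral_slotForm_le (k := k) (m := m) hr hrq hP hρ hc hρ1 hUv
  refine ⟨C, hC, fun α w ψ S hw hψ hcψ hS hx hG => ?_⟩
  obtain ⟨y₀, hy₀⟩ : (tsupport ρ).Nonempty := by
    by_contra h0
    rw [Set.not_nonempty_iff_eq_empty, tsupport_eq_empty_iff] at h0
    simp [h0] at hρ1
  set A := (fun v : (ℝ × Euc N) × Euc N => v.1.2 + v.1.1 • v.2) ''
    ((Set.Icc 0 1 ×ˢ tsupport ψ) ×ˢ tsupport ρ) with hAdef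
  have hA : IsCompact A := ((isCompact_Icc.prod hcψ).prod hc).image (by fun_prop)
  have hmem : ∀ t ∈ Set.Icc (0 : ℝ) 1, ∀ x ∈ tsupport ψ, ∀ y ∈ tsupport ρ, x + t • y ∈ A :=
    fun t ht x hx y hy => ⟨((t, x), y), ⟨⟨ht, hx⟩, hy⟩, rfl⟩
  have hψA : tsupport ψ ⊆ A := fun x hx => by simpa using hmem 0 (by simp) x hx y₀ hy₀
  have hAU : A ⊆ U := by
    rintro _ ⟨v, ⟨⟨ht, hv⟩, hy⟩, rfl⟩
    exact hx _ ht _ hv _ hy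
  choose u hus huE huB hut using fun i =>
    exists_smooth_approx hU hA hAU (by omega : 1 ≤ q) hP.le P (hw i)
  choose B hB0 hB using huB
  have hkey : ∀ n, ‖∫ x, slotForm m α (fun i => u i n) x * ψ x‖ₑ ≤ C * ENNReal.ofReal S :=
    fun n => h α _ ψ S A (fun i => hus i n) hψ hcψ hS hA.measurableSet (measure_mono hAU) hψA
      hmem fun i => (huE i n).trans (hG i)
  have hK : MeasurableSet (tsupport ψ) := (isClosed_tsupport ψ).measurableSet
  have hzero : ∀ (F : Euc N → ℝ) (T : Set (Euc N)), tsupport ψ ⊆ T → MeasurableSet T →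
      ∫ x in T, F x * ψ x = ∫ x in tsupport ψ, F x * ψ x := fun F T hT hTm =>
    (setIntegral_eq_of_subset_of_forall_sdiff_eq_zero hTm hT fun x hx => by
      simp [image_eq_zero_of_notMem_tsupport hx.2])
  have hlim : Tendsto (fun n => ∫ x, slotForm m α (fun i => u i n) x * ψ x) atTop
      (𝓝 (∫ x in U, slotForm m α w x * ψ x)) := by
    rw [hzero _ U (hψA.trans hAU) hU.measurableSet]
    have e : ∀ n, ∫ x, slotForm m α (fun i => u i n) x * ψ x =
        ∫ x in tsupport ψ, slotForm m α (fun i => u i n) x * ψ x := fun n => by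
      rw [← hzero _ Set.univ (Set.subset_univ _) MeasurableSet.univ, Measure.restrict_univ]
    simp only [e]
    refine tendsto_integral_of_dominated_convergence
      (fun x => (∑ _τ : Fin m → Equiv.Perm (Fin r), (∑ i, B i) ^ r) * |ψ x|) (fun n => ?_) ?_
      (fun n => Eventually.of_forall fun x => ?_) ?_
    · exact ((IsSmooth.slotForm α fun i => hus i n).continuous.mul
        hψ.continuous).aestronglyMeasurable
    · exact ((hψ.continuous.integrable_of_hasCompactSupport hcψ).abs.const_mul _).integrableOn
    · rw [norm_mul, Real.norm_eq_abs, Real.norm_eq_abs]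
      refine mul_le_mul_of_nonneg_right (abs_slotForm_le α fun i W hW => ?_) (abs_nonneg _)
      exact (hB i W hW.le n x).trans (Finset.single_le_sum (fun i _ => hB0 i) (Finset.mem_univ i))
    · refine (ae_restrict_iff' hK).2 (Eventually.of_forall fun x hx => ?_)
      exact (tendsto_slotForm α fun i W hW => hut i W hW.le x (hψA hx)).mul_const _
  exact le_of_tendsto' ((continuous_enorm.tendsto _).comp hlim) hkey

lemma energy_const_mul (E : Set (Euc N)) (k q : ℕ) (P : Option ℕ) (c : ℝ) (w : Euc N → ℝ) :
    energy E k q P (fun x => c * w x) = ‖c‖ₑ ^ q * energy E k q P w := by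
  have hc : ‖c‖ₑ ^ q ≠ ⊤ := by finiteness
  rw [energy, energy, mul_add, Finset.mul_sum]
  simp only [pderivList_const_mul, ← mul_sub, enorm_mul, mul_pow, mul_div_assoc,
    lintegral_const_mul' _ _ hc, Finset.mul_sum]
  rcases P with _ | p
  · simp
  · simp [Finset.mul_sum]

lemma slotForm_const_mul (α : Fin m → Fin r → Fin N) (c : Fin r → ℝ) (w : Fin r → Euc N → ℝ)
    (x : Euc N) : slotForm m α (fun i y => c i * w i y) x = (∏ i, c i) * slotForm m α w x := by
  simp only [slotForm, pderivList_const_mul, Finset.prod_mul_distrib, Finset.mul_sum]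
  exact Finset.sum_congr rfl fun τ _ => by ring

/-- The multilinear estimate in terms of energies, for `C^m` functions and test functions
supported in a piece of the domain that is star-shaped with respect to a shifted ball. -/
lemma exists_abs_setIntegral_slotForm_le (hr : 1 ≤ r) (hrq : r ≤ q) {P : Option ℕ}
    (hP : IsCritical N m q k P) {ρ : Euc N → ℝ} (hρ : IsSmooth ρ) (hc : HasCompactSupport ρ)
    (hρ1 : ∫ y, ρ y = 1) {U : Set (Euc N)} (hU : IsOpen U) (hUv : volume U ≠ ⊤) :
    ∃ C : ℝ, 0 ≤ C ∧ ∀ (α : Fin m → Fin r → Fin N) (w : Fin r → Euc N → ℝ)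
      (ψ : Euc N → ℝ) (S : ℝ) (a : Fin r → ℝ), (∀ i, ContDiffOn ℝ m (w i) U) → IsSmooth ψ →
      HasCompactSupport ψ → 0 ≤ S →
      (∀ W : List (Fin N), W.length = m → ∀ x, |pderivList W ψ x| ≤ S) →
      (∀ t ∈ Set.Icc (0 : ℝ) 1, ∀ x ∈ tsupport ψ, ∀ y ∈ tsupport ρ, x + t • y ∈ U) →
      (∀ i, 0 ≤ a i) → (∀ i, energy U k q P (w i) ≤ ENNReal.ofReal (a i) ^ q) →
      |∫ x in U, slotForm m α w x * ψ x| ≤ C * S * ∏ i, a i := by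
  obtain ⟨C, hC, h⟩ :=
    exists_enorm_setIntegral_slotForm_le (k := k) (m := m) hr hrq hP hρ hc hρ1 hU hUv
  refine ⟨C.toReal, ENNReal.toReal_nonneg, fun α w ψ S a hw hψ hcψ hS0 hS hx ha hG => ?_⟩
  have hpos : ∀ δ > 0, |∫ x in U, slotForm m α w x * ψ x| ≤ C.toReal * S * ∏ i, (a i + δ) := by
    intro δ hδ
    have hp : ∀ i, 0 < a i + δ := fun i => by linarith [ha i]
    have h1 := h α (fun i y => (a i + δ)⁻¹ * w i y) ψ S
      (fun i => contDiffOn_const.mul (hw i)) hψ hcψ hS hx fun i => by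
        rw [energy_const_mul]
        calc ‖(a i + δ)⁻¹‖ₑ ^ q * energy U k q P (w i)
            ≤ ENNReal.ofReal (a i + δ)⁻¹ ^ q * ENNReal.ofReal (a i + δ) ^ q := by
              rw [Real.enorm_of_nonneg (inv_nonneg.2 (hp i).le)]
              gcongr
              exact (hG i).trans (by gcongr; linarith)
          _ = 1 := by
              rw [← mul_pow, ← ENNReal.ofReal_mul (inv_nonneg.2 (hp i).le),
                inv_mul_cancel₀ (hp i).ne', ENNReal.ofReal_one, one_pow]
    simp only [slotForm_const_mul, mul_assoc, integral_const_mul] at h1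
    rw [Real.enorm_eq_ofReal_abs, ← ENNReal.ofReal_toReal hC,
      ← ENNReal.ofReal_mul ENNReal.toReal_nonneg,
      ENNReal.ofReal_le_ofReal_iff (by positivity), abs_mul,
      abs_of_nonneg (Finset.prod_nonneg fun i _ => inv_nonneg.2 (hp i).le),
      Finset.prod_inv_distrib, inv_mul_le_iff₀ (Finset.prod_pos fun i _ => hp i)] at h1
    linarith
  have hlim : Tendsto (fun δ : ℝ => C.toReal * S * ∏ i, (a i + δ)) (𝓝[>] 0)
      (𝓝 (C.toReal * S * ∏ i, a i)) := by
    have : Continuous fun δ : ℝ => C.toReal * S * ∏ i, (a i + δ) := by fun_prop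
    simpa using (this.tendsto 0).mono_left nhdsWithin_le_nhds
  exact ge_of_tendsto hlim (eventually_nhdsWithin_of_forall fun δ hδ => hpos δ hδ)

end NonsmoothEstimate

section Cone

variable {N : ℕ} {Ω : Set (Euc N)}

/-- Smooth domains satisfy a uniform interior cone condition near each point of the closure. -/
lemma IsSmoothDomain.exists_cone (hΩ : IsSmoothDomain Ω) {p : Euc N} (hp : p ∈ closure Ω) :
    ∃ w : Euc N, ∃ c > 0, ∃ δ > 0, ∀ x ∈ Ω, ‖x - p‖ < δ → ∀ v, ‖v‖ < δ → ∀ s : ℝ, 0 ≤ s →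
      ‖v - s • w‖ ≤ c * s → x + v ∈ Ω := by
  obtain ⟨hO, -, f, hf, rfl, hdf⟩ := hΩ
  by_cases hpi : p ∈ {x | f x < 0}
  · obtain ⟨ε, hε, hb⟩ := Metric.isOpen_iff.1 hO p hpi
    refine ⟨0, 1, one_pos, ε / 2, by positivity, fun x _ hx v hv s _ _ => hb ?_⟩
    rw [Metric.mem_ball, dist_eq_norm, show x + v - p = (x - p) + v by abel]
    linarith [norm_add_le (x - p) v]
  have hfr : p ∈ frontier {x | f x < 0} := by
    rw [frontier, hO.interior_eq]; exact ⟨hp, hpi⟩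
  set ℓ := fderiv ℝ f p with hℓ
  obtain ⟨z, hz⟩ : ∃ z, ℓ z ≠ 0 := by
    by_contra! h
    exact hdf p hfr (ContinuousLinearMap.ext h)
  obtain ⟨w, hw⟩ : ∃ w, ℓ w = -1 := ⟨(-(ℓ z)⁻¹) • z, by simp [hz]⟩
  have hst : HasStrictFDerivAt f ℓ p := hf.contDiffAt.hasStrictFDerivAt (by simp)
  have hlo := hst.isLittleO
  set c' : ℝ := 1 / (4 * (‖w‖ + 1)) with hc'
  have hc'0 : 0 < c' := by positivity
  set c : ℝ := 1 / (4 * (‖ℓ‖ + 1)) with hc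
  have hc0 : 0 < c := by positivity
  have hev := hlo.bound hc'0
  rw [nhds_prod_eq, ← nhds_prod_eq, Metric.eventually_nhds_iff] at hev
  obtain ⟨ε, hε, hb⟩ := hev
  refine ⟨w, c, hc0, ε / 2, by positivity, fun x hx hxp v hv s hs hvs => ?_⟩
  have h1 := @hb (x + v, x) (by
    rw [Prod.dist_eq, max_lt_iff, dist_eq_norm, dist_eq_norm]
    refine ⟨?_, by simpa using by linarith⟩
    simp only
    rw [show x + v - p = (x - p) + v by abel]
    linarith [norm_add_le (x - p) v])
  simp only [add_sub_cancel_left] at h1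
  have h2 := (le_abs_self _).trans h1
  have hv' : ‖v‖ ≤ s * ‖w‖ + c * s := by
    calc ‖v‖ = ‖(v - s • w) + s • w‖ := by simp
      _ ≤ ‖v - s • w‖ + ‖s • w‖ := norm_add_le _ _
      _ ≤ c * s + s * ‖w‖ := by rw [norm_smul, Real.norm_of_nonneg hs]; gcongr
      _ = _ := by ring
  have hℓv : ℓ v ≤ -s + ‖ℓ‖ * (c * s) := by
    have : ℓ v = s * ℓ w + ℓ (v - s • w) := by simp
    rw [this, hw]
    have := (le_abs_self _).trans ((ℓ.le_opNorm (v - s • w)).trans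
      (mul_le_mul_of_nonneg_left hvs (norm_nonneg _)))
    linarith
  have h3 : ‖ℓ‖ * c ≤ 1 / 4 := by
    rw [hc, mul_one_div, div_le_div_iff₀ (by positivity) (by norm_num)]
    nlinarith [norm_nonneg ℓ]
  have h4 : c ≤ 1 := by
    rw [hc, div_le_one (by positivity)]
    nlinarith [norm_nonneg ℓ]
  have h5 : c' * (‖w‖ + 1) = 1 / 4 := by
    rw [hc']; field_simp
  have h6 : c' * ‖v‖ ≤ s / 4 := by
    calc c' * ‖v‖ ≤ c' * (s * ‖w‖ + 1 * s) := by gcongr; exact hv'.trans (by gcongr)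
      _ = s * (c' * (‖w‖ + 1)) := by ring
      _ = s / 4 := by rw [h5]; ring
  have h7 : ‖ℓ‖ * (c * s) ≤ s / 4 := by
    calc ‖ℓ‖ * (c * s) = (‖ℓ‖ * c) * s := by ring
      _ ≤ 1 / 4 * s := by gcongr
      _ = s / 4 := by ring
  have hfx : f x < 0 := hx
  change f (x + v) < 0
  linarith

/-- Near each point of its closure a smooth domain is star-shaped with respect to a ball, in the
form of a compactly supported kernel. -/
lemma IsSmoothDomain.exists_star_kernel (hΩ : IsSmoothDomain Ω) {p : Euc N}
    (hp : p ∈ closure Ω) :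
    ∃ V, IsOpen V ∧ p ∈ V ∧ ∃ ρ : Euc N → ℝ, IsSmooth ρ ∧ HasCompactSupport ρ ∧
      ∫ y, ρ y = 1 ∧ ∀ t ∈ Set.Icc (0 : ℝ) 1, ∀ x ∈ V ∩ Ω, ∀ y ∈ tsupport ρ, x + t • y ∈ Ω := by
  obtain ⟨w, c, hc, δ, hδ, h⟩ := hΩ.exists_cone hp
  obtain ⟨s, hs, hsδ⟩ : ∃ s : ℝ, 0 < s ∧ s * (‖w‖ + c) < δ :=
    ⟨δ / (2 * (‖w‖ + c)), by positivity, by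
      rw [div_mul_eq_mul_div, div_lt_iff₀ (by positivity)]
      nlinarith [norm_nonneg w, mul_pos hδ (by positivity : 0 < ‖w‖ + c)]⟩
  let b : ContDiffBump (s • w) := ⟨c * s / 2, c * s, by positivity, by
    linarith [mul_pos hc hs]⟩
  refine ⟨Metric.ball p δ, Metric.isOpen_ball, Metric.mem_ball_self hδ, b.normed volume,
    b.contDiff_normed, b.hasCompactSupport_normed, b.integral_normed,
    fun t ht x hx y hy => ?_⟩
  rw [b.tsupport_normed_eq, mem_closedBall_iff_norm] at hy
  change ‖y - s • w‖ ≤ c * s at hy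
  have hyn : ‖y‖ ≤ s * (‖w‖ + c) := by
    calc ‖y‖ = ‖(y - s • w) + s • w‖ := by simp
      _ ≤ ‖y - s • w‖ + ‖s • w‖ := norm_add_le _ _
      _ ≤ c * s + s * ‖w‖ := by rw [norm_smul, Real.norm_of_nonneg hs.le]; gcongr
      _ = _ := by ring
  refine h x hx.2 (by simpa [dist_eq_norm] using hx.1) (t • y) ?_ (t * s)
    (mul_nonneg ht.1 hs.le) ?_
  · rw [norm_smul, Real.norm_of_nonneg ht.1]
    calc t * ‖y‖ ≤ 1 * ‖y‖ := by gcongr; exact ht.2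
      _ < δ := by linarith
  · rw [mul_smul, ← smul_sub, norm_smul, Real.norm_of_nonneg ht.1]
    calc t * ‖y - s • w‖ ≤ t * (c * s) := by gcongr; exact ht.1
      _ = _ := by ring

/-- Nearby points of a smooth domain are joined inside the domain by three segments of
comparable length. -/
lemma IsSmoothDomain.exists_short_path (hΩ : IsSmoothDomain Ω) {p : Euc N}
    (hp : p ∈ closure Ω) :
    ∃ V, IsOpen V ∧ p ∈ V ∧ ∃ w : Euc N, ∀ x ∈ V ∩ Ω, ∀ y ∈ V ∩ Ω, ∀ t ∈ Set.Icc (0 : ℝ) 1,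
      x + t • (‖x - y‖ • w) ∈ Ω ∧ x + ‖x - y‖ • w + t • (y - x) ∈ Ω := by
  obtain ⟨w, c, hc, δ, hδ, h⟩ := hΩ.exists_cone hp
  set ε : ℝ := δ / (2 * (1 + ‖w‖ / c) + 1) with hε
  have hε0 : 0 < ε := by positivity
  have hεδ : 2 * ε * (1 + ‖w‖ / c) < δ := by
    rw [hε]
    have : 0 ≤ ‖w‖ / c := by positivity
    rw [mul_div_assoc', div_mul_eq_mul_div, div_lt_iff₀ (by positivity)]
    nlinarith
  have hεδ' : ε ≤ δ := by
    have : 0 ≤ ‖w‖ / c := by positivity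
    nlinarith
  refine ⟨Metric.ball p ε, Metric.isOpen_ball, Metric.mem_ball_self hε0, c⁻¹ • w,
    fun x hx y hy t ht => ?_⟩
  have hxp : ‖x - p‖ < ε := by simpa [dist_eq_norm] using hx.1
  have hyp : ‖y - p‖ < ε := by simpa [dist_eq_norm] using hy.1
  set d := ‖x - y‖ with hd
  have hd0 : 0 ≤ d := norm_nonneg _
  have hd2 : d ≤ 2 * ε := by
    rw [hd, show x - y = (x - p) - (y - p) by abel]
    linarith [norm_sub_le (x - p) (y - p)]
  have hlen : ‖d • c⁻¹ • w‖ = d * (‖w‖ / c) := by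
    rw [norm_smul, norm_smul, norm_inv, Real.norm_of_nonneg hd0, Real.norm_of_nonneg hc.le]
    ring
  have hsm : d + ‖d • c⁻¹ • w‖ < δ := by
    rw [hlen]
    calc d + d * (‖w‖ / c) = d * (1 + ‖w‖ / c) := by ring
      _ ≤ 2 * ε * (1 + ‖w‖ / c) := by gcongr
      _ < δ := hεδ
  constructor
  · refine h x hx.2 (hxp.trans_le hεδ') _ ?_ (t * d * c⁻¹)
      (mul_nonneg (mul_nonneg ht.1 hd0) (inv_nonneg.2 hc.le)) ?_
    · rw [norm_smul, Real.norm_of_nonneg ht.1]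
      calc t * ‖d • c⁻¹ • w‖ ≤ 1 * ‖d • c⁻¹ • w‖ := by gcongr; exact ht.2
        _ < δ := by linarith
    · rw [smul_smul, smul_smul, ← sub_smul, sub_self]
      simp only [zero_smul, norm_zero]
      exact mul_nonneg hc.le (mul_nonneg (mul_nonneg ht.1 hd0) (inv_nonneg.2 hc.le))
  · have ht' : ‖t • (y - x)‖ ≤ d := by
      rw [norm_smul, Real.norm_of_nonneg ht.1, norm_sub_rev, ← hd]
      nlinarith [ht.2]
    rw [add_assoc]
    refine h x hx.2 (hxp.trans_le hεδ') _ ?_ (d * c⁻¹) (mul_nonneg hd0 (inv_nonneg.2 hc.le)) ?_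
    · linarith [norm_add_le (d • c⁻¹ • w) (t • (y - x))]
    · rw [mul_smul, add_sub_cancel_left]
      calc _ ≤ d := ht'
        _ = _ := by field_simp

/-- A map with bounded derivative on a smooth domain is Lipschitz there. -/
lemma IsSmoothDomain.exists_lipschitz (hΩ : IsSmoothDomain Ω) {F : Type*} [NormedAddCommGroup F]
    [NormedSpace ℝ F] {g : Euc N → F} {B B' : ℝ} (hg : ∀ x ∈ Ω, DifferentiableAt ℝ g x)
    (hB : ∀ x ∈ Ω, ‖g x‖ ≤ B) (hB' : ∀ x ∈ Ω, ‖fderiv ℝ g x‖ ≤ B') :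
    ∃ C : ℝ, 0 ≤ C ∧ ∀ x ∈ Ω, ∀ y ∈ Ω, ‖g x - g y‖ ≤ C * ‖x - y‖ := by
  choose! V hVo hpV w hw using fun p (hp : p ∈ closure Ω) => hΩ.exists_short_path hp
  have hcpt : IsCompact (closure Ω) := hΩ.2.1.isCompact_closure
  obtain ⟨T, hT, hcov⟩ := hcpt.elim_nhds_subcover V
    (fun p hp => (hVo p hp).mem_nhds (hpV p hp))
  obtain ⟨δ, hδ, hleb⟩ := lebesgue_number_lemma_of_metric (c := fun p : T => V p) hcpt
    (fun p => hVo p (hT p p.2)) (by simpa [Set.iUnion_subtype] using hcov)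
  obtain ⟨R, hR0, hR⟩ : ∃ R : ℝ, 0 ≤ R ∧ ∀ p ∈ T, ‖w p‖ ≤ R :=
    ⟨∑ p ∈ T, ‖w p‖, Finset.sum_nonneg fun _ _ => norm_nonneg _,
      fun p hp => Finset.single_le_sum (f := fun p => ‖w p‖) (fun _ _ => norm_nonneg _) hp⟩
  have hmax : ∀ x ∈ Ω, ‖fderiv ℝ g x‖ ≤ max B' 0 := fun x hx => (hB' x hx).trans (le_max_left _ _)
  have hmaxB : ∀ x ∈ Ω, ‖g x‖ ≤ max B 0 := fun x hx => (hB x hx).trans (le_max_left _ _)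
  have hseg : ∀ x v : Euc N, (∀ t ∈ Set.Icc (0 : ℝ) 1, x + t • v ∈ Ω) →
      ‖g (x + v) - g x‖ ≤ max B' 0 * ‖v‖ := by
    intro x v h
    have hsub : ∀ z ∈ segment ℝ x (x + v), z ∈ Ω := by
      intro z hz
      rw [segment_eq_image'] at hz
      obtain ⟨t, ht, rfl⟩ := hz
      simpa using h t ht
    have := (convex_segment x (x + v)).norm_image_sub_le_of_norm_fderiv_le (f := g) (𝕜 := ℝ)
      (fun z hz => hg z (hsub z hz)) (fun z hz => hmax z (hsub z hz))
      (left_mem_segment ℝ x (x + v)) (right_mem_segment ℝ x (x + v))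
    simpa using this
  refine ⟨max B' 0 * (2 * R + 1) + 2 * max B 0 / δ, by positivity, fun x hx y hy => ?_⟩
  by_cases hxy : ‖x - y‖ < δ
  · obtain ⟨p, hpδ⟩ := hleb x (subset_closure hx)
    have hxV : x ∈ V p ∩ Ω := ⟨hpδ (Metric.mem_ball_self hδ), hx⟩
    have hyV : y ∈ V p ∩ Ω := ⟨hpδ (by simpa [dist_eq_norm, norm_sub_rev] using hxy), hy⟩
    have hpc := hT p p.2
    have h1 := hseg x (‖x - y‖ • w p) fun t ht => (hw p hpc x hxV y hyV t ht).1
    have h2 := hseg (x + ‖x - y‖ • w p) (y - x) fun t ht => (hw p hpc x hxV y hyV t ht).2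
    have h3 := hseg y (‖x - y‖ • w p) fun t ht => by
      have := (hw p hpc y hyV x hxV t ht).1
      rwa [norm_sub_rev] at this
    rw [show x + ‖x - y‖ • w p + (y - x) = y + ‖x - y‖ • w p by abel] at h2
    have hn : ‖‖x - y‖ • w p‖ ≤ R * ‖x - y‖ := by
      rw [norm_smul, norm_norm, mul_comm]; gcongr; exact hR p p.2
    rw [norm_sub_rev y x] at h2
    set a := g (x + ‖x - y‖ • w p)
    set b := g (y + ‖x - y‖ • w p)
    have htri : ‖g x - g y‖ ≤ ‖a - g x‖ + ‖b - a‖ + ‖b - g y‖ := by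
      rw [show g x - g y = -(a - g x) - (b - a) + (b - g y) by abel]
      refine (norm_add_le _ _).trans (add_le_add_left ((norm_sub_le _ _).trans ?_) _)
      rw [norm_neg]
    have h4 : max B' 0 * ‖‖x - y‖ • w p‖ ≤ max B' 0 * (R * ‖x - y‖) := by gcongr
    have h5 : 0 ≤ 2 * max B 0 / δ * ‖x - y‖ := by positivity
    nlinarith
  · have h1 : ‖g x - g y‖ ≤ 2 * max B 0 := by
      linarith [norm_sub_le (g x) (g y), hmaxB x hx, hmaxB y hy]
    have h2 : 2 * max B 0 ≤ 2 * max B 0 / δ * ‖x - y‖ := by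
      rw [div_mul_eq_mul_div, le_div_iff₀ hδ]
      gcongr
      exact not_lt.1 hxy
    have h3 : 0 ≤ max B' 0 * (2 * R + 1) * ‖x - y‖ := by positivity
    nlinarith

end Cone

section LocalBounds

variable {N : ℕ} {Ω : Set (Euc N)} {F : Type*} [NormedAddCommGroup F] [NormedSpace ℝ F]

/-- The derivatives of a map which is `C^m` up to the boundary are bounded. -/
lemma ContDiffOn.exists_norm_iteratedFDeriv_le (hO : IsOpen Ω) (hb : Bornology.IsBounded Ω)
    {m : ℕ} {u : Euc N → F} (hu : ContDiffOn ℝ m u (closure Ω)) {j : ℕ} (hj : j ≤ m) :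
    ∃ B, ∀ x ∈ Ω, ‖iteratedFDeriv ℝ j u x‖ ≤ B := by
  have hcpt : IsCompact (closure Ω) := hb.isCompact_closure
  suffices h : ∃ B, ∀ x ∈ closure Ω ∩ Ω, ‖iteratedFDeriv ℝ j u x‖ ≤ B from
    h.imp fun B hB x hx => hB x ⟨subset_closure hx, hx⟩
  refine hcpt.induction_on (p := fun s => ∃ B, ∀ x ∈ s ∩ Ω, ‖iteratedFDeriv ℝ j u x‖ ≤ B)
    ⟨0, by simp⟩ (fun s t hst ⟨B, hB⟩ => ⟨B, fun x hx => hB x ⟨hst hx.1, hx.2⟩⟩)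
    (fun s t ⟨B, hB⟩ ⟨B', hB'⟩ => ⟨max B B', fun x hx => ?_⟩) (fun p hp => ?_)
  · rcases hx.1 with h | h
    · exact (hB x ⟨h, hx.2⟩).trans (le_max_left _ _)
    · exact (hB' x ⟨h, hx.2⟩).trans (le_max_right _ _)
  · obtain ⟨U, hU, P, hP⟩ := hu p hp m le_rfl
    rw [Set.insert_eq_of_mem hp] at hU
    have hpU : p ∈ U := mem_of_mem_nhdsWithin hp hU
    have hc := hP.cont j (by exact_mod_cast hj) p hpU
    have hev : ∀ᶠ x in 𝓝[U] p, ‖P x j‖ < ‖P p j‖ + 1 :=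
      hc.norm.eventually_lt continuousWithinAt_const (by linarith)
    obtain ⟨V, hVo, hpV, hV⟩ := mem_nhdsWithin.1 hU
    rw [eventually_nhdsWithin_iff] at hev
    obtain ⟨V', hV', hVo', hpV'⟩ := eventually_nhds_iff.1 hev
    refine ⟨V' ∩ V, mem_nhdsWithin_of_mem_nhds ((hVo'.inter hVo).mem_nhds ⟨hpV', hpV⟩),
      ‖P p j‖ + 1, fun x hx => ?_⟩
    have hsub : V ∩ Ω ⊆ U := fun y hy => hV ⟨hy.1, subset_closure hy.2⟩
    have hop : IsOpen (V ∩ Ω) := hVo.inter hO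
    have hxm : x ∈ V ∩ Ω := ⟨hx.1.2, hx.2⟩
    rw [← iteratedFDerivWithin_of_isOpen j hop hxm,
      ← (hP.mono hsub).eq_iteratedFDerivWithin_of_uniqueDiffOn (by exact_mod_cast hj)
        hop.uniqueDiffOn hxm]
    exact (hV' x hx.1.1 (hsub hxm)).le

lemma ContDiffOn.differentiableAt_iteratedFDeriv (hO : IsOpen Ω)
    {m : ℕ} {u : Euc N → F} (hu : ContDiffOn ℝ m u Ω) {j : ℕ} (hj : j < m) {x : Euc N}
    (hx : x ∈ Ω) : DifferentiableAt ℝ (iteratedFDeriv ℝ j u) x :=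
  (hu.contDiffAt (hO.mem_nhds hx)).differentiableAt_iteratedFDeriv (by exact_mod_cast hj)

lemma ContDiffOn.continuousOn_iteratedFDeriv (hO : IsOpen Ω)
    {m : ℕ} {u : Euc N → F} (hu : ContDiffOn ℝ m u Ω) {j : ℕ} (hj : j ≤ m) :
    ContinuousOn (iteratedFDeriv ℝ j u) Ω :=
  (hu.continuousOn_iteratedFDerivWithin (by exact_mod_cast hj) hO.uniqueDiffOn).congr
    fun _ hx => (iteratedFDerivWithin_of_isOpen j hO hx).symm

/-- Partial derivatives of a component read off from the iterated derivative. -/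
lemma pderivList_clm_comp (hO : IsOpen Ω) {m : ℕ} {u : Euc N → F} (hu : ContDiffOn ℝ m u Ω)
    (T : F →L[ℝ] ℝ) : ∀ (W : List (Fin N)), W.length ≤ m → ∀ x ∈ Ω,
      pderivList W (fun y => T (u y)) x =
        T (iteratedFDeriv ℝ W.length u x fun i => basisVec (W.get i))
  | [], _, x, _ => by simp [pderivList]
  | a :: W, hW, x, hx => by
    have hW' : W.length < m := by simpa using hW
    have hev : pderivList W (fun y => T (u y)) =ᶠ[𝓝 x] fun y =>
        T (iteratedFDeriv ℝ W.length u y fun i => basisVec (W.get i)) := by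
      filter_upwards [hO.mem_nhds hx] with y hy using pderivList_clm_comp hO hu T W hW'.le y hy
    have hd := hu.differentiableAt_iteratedFDeriv hO hW' hx
    have hd' : HasFDerivAt (fun y => T (iteratedFDeriv ℝ W.length u y fun i => basisVec (W.get i)))
        (T ∘L (ContinuousMultilinearMap.apply ℝ (fun _ : Fin W.length => Euc N) F
          (fun i => basisVec (W.get i))) ∘L fderiv ℝ (iteratedFDeriv ℝ W.length u) x) x :=
      T.hasFDerivAt.comp x ((ContinuousMultilinearMap.apply ℝ (fun _ : Fin W.length => Euc N) F
        (fun i => basisVec (W.get i))).hasFDerivAt.comp x hd.hasFDerivAt)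
    rw [pderivList, pderiv', hev.fderiv_eq, hd'.fderiv]
    simp only [List.length_cons, iteratedFDeriv_succ_apply_left]
    rfl

lemma norm_multilinear_basisVec_le {G : Type*} [NormedAddCommGroup G] [NormedSpace ℝ G] {j : ℕ}
    (A : ContinuousMultilinearMap ℝ (fun _ : Fin j => Euc N) G) (l : Fin j → Fin N) :
    ‖A fun i => basisVec (l i)‖ ≤ ‖A‖ := by
  refine (A.le_opNorm _).trans ?_
  simp

end LocalBounds

section Localization

variable {N m r k q : ℕ} {Ω : Set (Euc N)}

lemma abs_pderivList_le_norm_iteratedFDeriv {ψ : Euc N → ℝ} (hψ : IsSmooth ψ) (W : List (Fin N))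
    (x : Euc N) : |pderivList W ψ x| ≤ ‖iteratedFDeriv ℝ W.length ψ x‖ := by
  have h := pderivList_clm_comp (m := W.length) isOpen_univ
    (hψ.of_le (by exact_mod_cast le_top)).contDiffOn
    (ContinuousLinearMap.id ℝ ℝ) W le_rfl x (Set.mem_univ x)
  simp only [ContinuousLinearMap.id_apply] at h
  rw [h, ← Real.norm_eq_abs]
  exact norm_multilinear_basisVec_le _ _

lemma bddAbove_norm_iteratedFDeriv {ψ : Euc N → ℝ} (hψ : IsSmooth ψ) (hc : HasCompactSupport ψ)
    (j : ℕ) : BddAbove (Set.range fun x => ‖iteratedFDeriv ℝ j ψ x‖) :=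
  ((hψ.continuous_iteratedFDeriv (by exact_mod_cast le_top)).norm).bddAbove_range_of_hasCompactSupport
    (hc.iteratedFDeriv j).norm

lemma supDm_nonneg (m : ℕ) (ψ : Euc N → ℝ) : 0 ≤ supDm m ψ :=
  Real.iSup_nonneg fun _ => norm_nonneg _

lemma IsCinfc.norm_iteratedFDeriv_le_supDm {ψ : Euc N → ℝ} (hψ : IsCinfc Ω ψ) (m : ℕ)
    (x : Euc N) : ‖iteratedFDeriv ℝ m ψ x‖ ≤ supDm m ψ :=
  le_ciSup (bddAbove_norm_iteratedFDeriv hψ.1 hψ.2.1 m) x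

lemma IsCinfc.iteratedFDeriv_eq_zero {ψ : Euc N → ℝ} (hψ : IsCinfc Ω ψ) (j : ℕ)
    {x : Euc N} (hx : x ∉ Ω) : iteratedFDeriv ℝ j ψ x = 0 := by
  by_contra h
  exact hx (hψ.2.2 (tsupport_iteratedFDeriv_subset j (subset_tsupport _ h)))

/-- Poincaré inequality for the sup norms of derivatives of test functions. -/
lemma exists_norm_iteratedFDeriv_le_supDm (hN : 1 ≤ N) (hb : Bornology.IsBounded Ω) (m : ℕ) :
    ∃ K : ℝ, 0 ≤ K ∧ ∀ ψ : Euc N → ℝ, IsCinfc Ω ψ → ∀ j ≤ m, ∀ x,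
      ‖iteratedFDeriv ℝ j ψ x‖ ≤ K * supDm m ψ := by
  obtain ⟨R, hR0, hR⟩ := hb.subset_closedBall_lt 0 0
  obtain ⟨x₀, hx₀⟩ : ∃ x₀ : Euc N, ‖x₀‖ = R + 1 :=
    ⟨(R + 1) • basisVec ⟨0, hN⟩, by
      rw [norm_smul, norm_basisVec, Real.norm_of_nonneg (by linarith), mul_one]⟩
  have hx₀Ω : x₀ ∉ Ω := fun h => by
    have := hR h
    rw [mem_closedBall_zero_iff] at this
    linarith
  have key : ∀ i ≤ m, ∀ ψ : Euc N → ℝ, IsCinfc Ω ψ → ∀ x,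
      ‖iteratedFDeriv ℝ (m - i) ψ x‖ ≤ (2 * R + 1) ^ i * supDm m ψ := by
    intro i
    induction i with
    | zero => intro _ ψ hψ x; simpa using hψ.norm_iteratedFDeriv_le_supDm m x
    | succ i ih =>
      intro hi ψ hψ x
      by_cases hx : x ∈ Ω
      · have hd : ∀ z, DifferentiableAt ℝ (iteratedFDeriv ℝ (m - (i + 1)) ψ) z := fun z =>
          hψ.1.contDiffAt.differentiableAt_iteratedFDeriv
            (WithTop.coe_lt_coe.2 (ENat.natCast_lt_top _))
        have h := convex_univ.norm_image_sub_le_of_norm_fderiv_le (𝕜 := ℝ)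
          (f := iteratedFDeriv ℝ (m - (i + 1)) ψ) (C := (2 * R + 1) ^ i * supDm m ψ)
          (fun z _ => hd z) (fun z _ => by
            rw [norm_fderiv_iteratedFDeriv, show m - (i + 1) + 1 = m - i by omega]
            exact ih (by omega) ψ hψ z) (Set.mem_univ x₀) (Set.mem_univ x)
        rw [hψ.iteratedFDeriv_eq_zero _ hx₀Ω, sub_zero] at h
        have hxn : ‖x - x₀‖ ≤ 2 * R + 1 := by
          have := hR hx
          rw [mem_closedBall_zero_iff] at this
          linarith [norm_sub_le x x₀]
        calc _ ≤ _ := h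
          _ ≤ (2 * R + 1) ^ i * supDm m ψ * (2 * R + 1) := by
            have := supDm_nonneg m ψ
            gcongr
          _ = _ := by ring
      · rw [hψ.iteratedFDeriv_eq_zero _ hx, norm_zero]
        have := supDm_nonneg m ψ
        positivity
  refine ⟨(2 * R + 1) ^ m, by positivity, fun ψ hψ j hj x => ?_⟩
  have h := key (m - j) (by omega) ψ hψ x
  rw [show m - (m - j) = j by omega] at h
  have := supDm_nonneg m ψ
  refine h.trans ?_
  gcongr
  · linarith
  · omega

lemma integrableOn_mul_of_isCinfc (hO : IsOpen Ω) {F ψ : Euc N → ℝ} (hF : ContinuousOn F Ω)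
    (hψ : IsCinfc Ω ψ) : IntegrableOn (fun x => F x * ψ x) Ω := by
  refine IntegrableOn.of_forall_sdiff_eq_zero (s := tsupport ψ) ?_ hO.measurableSet
    fun x hx => by rw [image_eq_zero_of_notMem_tsupport hx.2, mul_zero]
  exact ((hF.mono hψ.2.2).mul hψ.1.continuous.continuousOn).integrableOn_compact hψ.2.1

lemma continuousOn_slotForm (hO : IsOpen Ω) (α : Fin m → Fin r → Fin N) {w : Fin r → Euc N → ℝ}
    (hw : ∀ i, ContDiffOn ℝ m (w i) Ω) : ContinuousOn (slotForm m α w) Ω := by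
  unfold slotForm
  refine continuousOn_finsetSum _ fun τ _ => continuousOn_const.mul
    (continuousOn_finsetProd _ fun k _ => ?_)
  exact (hw k).continuousOn_pderivList hO (by simp)

/-- Estimate of the integral of a multilinear Jacobian on a smooth domain by the critical
energies of its slots. -/
lemma exists_abs_setIntegral_slotForm_le_supDm (hN : 1 ≤ N) (hr : 1 ≤ r) (hrq : r ≤ q)
    {P : Option ℕ} (hP : IsCritical N m q k P) (hΩ : IsSmoothDomain Ω) :
    ∃ C : ℝ, 0 ≤ C ∧ ∀ (α : Fin m → Fin r → Fin N) (w : Fin r → Euc N → ℝ) (ψ : Euc N → ℝ)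
      (a : Fin r → ℝ), (∀ i, ContDiffOn ℝ m (w i) Ω) → IsCinfc Ω ψ → (∀ i, 0 ≤ a i) →
      (∀ i, energy Ω k q P (w i) ≤ ENNReal.ofReal (a i) ^ q) →
      |∫ x in Ω, slotForm m α w x * ψ x| ≤ C * supDm m ψ * ∏ i, a i := by
  have hO := hΩ.1
  have hcpt : IsCompact (closure Ω) := hΩ.2.1.isCompact_closure
  have hvol : volume Ω ≠ ⊤ := hΩ.2.1.measure_lt_top.ne
  choose! V hVo hpV ρ hρ hρc hρ1 hstar using
    fun p (hp : p ∈ closure Ω) => hΩ.exists_star_kernel hp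
  obtain ⟨T, hT, hcov⟩ := hcpt.elim_nhds_subcover V
    (fun p hp => (hVo p hp).mem_nhds (hpV p hp))
  obtain ⟨η, hη⟩ := SmoothPartitionOfUnity.exists_isSubordinate
    (modelWithCornersSelf ℝ (Euc N)) (isClosed_closure (s := Ω)) (fun p : T => V p)
    (fun p => hVo p (hT p p.2)) (by simpa [Set.iUnion_subtype] using hcov)
  have hηs : ∀ i, IsSmooth (η i) := fun i => (η i).contMDiff.contDiff
  have hη1 : ∀ x ∈ closure Ω, ∑ i, η i x = 1 := fun x hx => by
    rw [← finsum_eq_sum_of_fintype]; exact η.sum_eq_one hx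
  obtain ⟨K, hK0, hK⟩ := exists_norm_iteratedFDeriv_le_supDm hN hΩ.2.1 m
  have hB : ∀ i j, ∃ B : ℝ, 0 ≤ B ∧ ∀ x ∈ closure Ω, ‖iteratedFDeriv ℝ j (η i) x‖ ≤ B := by
    intro i j
    obtain ⟨B, hB⟩ := hcpt.exists_bound_of_continuousOn
      ((hηs i).continuous_iteratedFDeriv (m := j) (by exact_mod_cast le_top)).continuousOn
    exact ⟨max B 0, le_max_right _ _, fun x hx => (hB x hx).trans (le_max_left _ _)⟩
  choose B hB0 hB using hB
  choose C hC0 hC using fun i : T => exists_abs_setIntegral_slotForm_le hr hrq hP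
    (hρ i (hT i i.2)) (hρc i (hT i i.2)) (hρ1 i (hT i i.2)) hO hvol
  obtain ⟨A, hA⟩ : ∃ A : T → ℝ, ∀ i, A i =
      ∑ j ∈ Finset.range (m + 1), (m.choose j : ℝ) * B i j * K := ⟨_, fun _ => rfl⟩
  have hA0 : ∀ i, 0 ≤ A i := fun i => by
    rw [hA]
    exact Finset.sum_nonneg fun j _ => mul_nonneg (mul_nonneg (by positivity) (hB0 i j)) hK0
  refine ⟨∑ i, C i * A i, Finset.sum_nonneg fun i _ => mul_nonneg (hC0 i) (hA0 i),
    fun α w ψ a hw hψ ha hen => ?_⟩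
  have hprod : ∀ i : T, IsCinfc (V i ∩ Ω) fun x => η i x * ψ x := fun i =>
    ⟨(hηs i).mul hψ.1, hψ.2.1.mul_left, Set.subset_inter
      ((tsupport_mul_subset_left).trans (hη i)) ((tsupport_mul_subset_right).trans hψ.2.2)⟩
  have hprod' : ∀ i : T, IsCinfc Ω fun x => η i x * ψ x := fun i =>
    ⟨(hprod i).1, (hprod i).2.1, (hprod i).2.2.trans Set.inter_subset_right⟩
  have hder : ∀ i, ∀ W : List (Fin N), W.length = m → ∀ x,
      |pderivList W (fun x => η i x * ψ x) x| ≤ A i * supDm m ψ := by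
    intro i W hW x
    refine (abs_pderivList_le_norm_iteratedFDeriv (hprod i).1 W x).trans ?_
    rw [hW]
    by_cases hx : x ∈ Ω
    · refine (norm_iteratedFDeriv_mul_le (N := (⊤ : ℕ∞)) (hηs i) hψ.1 x
        (by exact_mod_cast le_top)).trans ?_
      rw [hA, Finset.sum_mul]
      refine Finset.sum_le_sum fun j hj => ?_
      rw [mul_assoc _ K]
      gcongr
      · exact mul_nonneg (by positivity) (hB0 i j)
      · exact hB i j x (subset_closure hx)
      · exact hK ψ hψ _ (by omega) x
    · rw [(hprod' i).iteratedFDeriv_eq_zero m hx, norm_zero]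
      exact mul_nonneg (hA0 i) (supDm_nonneg m ψ)
  have hsplit : ∫ x in Ω, slotForm m α w x * ψ x =
      ∑ i, ∫ x in Ω, slotForm m α w x * (η i x * ψ x) := by
    rw [← integral_finsetSum _ fun i _ =>
      integrableOn_mul_of_isCinfc hO (continuousOn_slotForm hO α hw) (hprod' i)]
    refine setIntegral_congr_fun hO.measurableSet fun x hx => ?_
    rw [← Finset.mul_sum, ← Finset.sum_mul, hη1 x (subset_closure hx), one_mul]
  rw [hsplit, Finset.sum_mul, Finset.sum_mul]
  refine (Finset.abs_sum_le_sum_abs _ _).trans (Finset.sum_le_sum fun i _ => ?_)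
  refine (hC i α w _ (A i * supDm m ψ) a hw (hprod i).1 (hprod i).2.1
    (mul_nonneg (hA0 i) (supDm_nonneg m ψ)) (hder i) (fun t ht x hx y hy =>
      hstar i (hT i i.2) t ht x ((hprod i).2.2 hx) y hy) ha hen).trans_eq ?_
  ring

end Localization

section Telescoping

variable {N m r k q : ℕ} {Ω : Set (Euc N)}

lemma pderivList_sub (hO : IsOpen Ω) {f g : Euc N → ℝ} (hf : ContDiffOn ℝ m f Ω)
    (hg : ContDiffOn ℝ m g Ω) {W : List (Fin N)} (hW : W.length ≤ m) {x : Euc N} (hx : x ∈ Ω) :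
    pderivList W (fun y => f y - g y) x = pderivList W f x - pderivList W g x := by
  have hfg := hf.prodMk hg
  have h := pderivList_clm_comp hO hfg
    (ContinuousLinearMap.fst ℝ ℝ ℝ - ContinuousLinearMap.snd ℝ ℝ ℝ) W hW x hx
  have h1 := pderivList_clm_comp hO hfg (ContinuousLinearMap.fst ℝ ℝ ℝ) W hW x hx
  have h2 := pderivList_clm_comp hO hfg (ContinuousLinearMap.snd ℝ ℝ ℝ) W hW x hx
  simp only [sub_apply, ContinuousLinearMap.coe_fst',
    ContinuousLinearMap.coe_snd'] at h h1 h2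
  rw [h, h1, h2]

/-- The slots of the `i`-th telescoping term: `v` before `i`, `u - v` at `i`, `u` after `i`. -/
def hybridSlots (u v : Fin r → Euc N → ℝ) (i j : Fin r) : Euc N → ℝ :=
  if j < i then v j else if i < j then u j else fun x => u j x - v j x

lemma prod_trichotomy (i : Fin r) (A B D : Fin r → ℝ) :
    ∏ j, (if j < i then A j else if i < j then B j else D j) =
      D i * (∏ j with j < i, A j) * ∏ j with i < j, B j := by
  rw [Finset.prod_filter, Finset.prod_filter]
  have hD : D i = ∏ j, if j = i then D j else 1 := by simp
  rw [hD, ← Finset.prod_mul_distrib, ← Finset.prod_mul_distrib]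
  refine Finset.prod_congr rfl fun j _ => ?_
  rcases lt_trichotomy j i with h | rfl | h
  · simp [h, h.ne, h.not_gt]
  · simp
  · simp [h, h.ne', h.not_gt]

lemma slotForm_sub (hO : IsOpen Ω) (α : Fin m → Fin r → Fin N) {u v : Fin r → Euc N → ℝ}
    (hu : ∀ i, ContDiffOn ℝ m (u i) Ω) (hv : ∀ i, ContDiffOn ℝ m (v i) Ω) {x : Euc N}
    (hx : x ∈ Ω) :
    slotForm m α u x - slotForm m α v x = ∑ i, slotForm m α (hybridSlots u v i) x := by
  unfold slotForm
  rw [Finset.sum_comm, ← Finset.sum_sub_distrib]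
  refine Finset.sum_congr rfl fun τ _ => ?_
  rw [← mul_sub, ← Finset.mul_sum]
  congr 1
  have h := Finset.prod_sub_ordered Finset.univ
    (fun j => pderivList (List.ofFn fun s => α s (τ s j)) (u j) x)
    (fun j => pderivList (List.ofFn fun s => α s (τ s j)) (fun y => u j y - v j y) x)
  have hsub : ∀ j, pderivList (List.ofFn fun s => α s (τ s j)) (u j) x -
      pderivList (List.ofFn fun s => α s (τ s j)) (fun y => u j y - v j y) x =
      pderivList (List.ofFn fun s => α s (τ s j)) (v j) x := fun j => by
    rw [pderivList_sub hO (hu j) (hv j) (by simp) hx]; ring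
  simp only [hsub] at h
  rw [h, sub_sub_cancel]
  refine Finset.sum_congr rfl fun i _ => ?_
  refine (prod_trichotomy i (fun j => pderivList (List.ofFn fun s => α s (τ s j)) (v j) x)
    (fun j => pderivList (List.ofFn fun s => α s (τ s j)) (u j) x)
    (fun j => pderivList (List.ofFn fun s => α s (τ s j))
      (fun y => u j y - v j y) x)).symm.trans ?_
  refine Finset.prod_congr rfl fun j _ => ?_
  unfold hybridSlots
  split_ifs <;> rfl

/-- Stability of the localized multilinear Jacobian with respect to the critical energy. -/
lemma exists_abs_sub_setIntegral_slotForm_le (hN : 1 ≤ N) (hr : 1 ≤ r) (hrq : r ≤ q)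
    {P : Option ℕ} (hP : IsCritical N m q k P) (hΩ : IsSmoothDomain Ω) :
    ∃ C : ℝ, 0 ≤ C ∧ ∀ (α : Fin m → Fin r → Fin N) (u v : Fin r → Euc N → ℝ) (ψ : Euc N → ℝ)
      (a b d : ℝ), (∀ i, ContDiffOn ℝ m (u i) Ω) → (∀ i, ContDiffOn ℝ m (v i) Ω) →
      IsCinfc Ω ψ → 0 ≤ a → 0 ≤ b → 0 ≤ d →
      (∀ i, energy Ω k q P (u i) ≤ ENNReal.ofReal a ^ q) →
      (∀ i, energy Ω k q P (v i) ≤ ENNReal.ofReal b ^ q) →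
      (∀ i, energy Ω k q P (fun x => u i x - v i x) ≤ ENNReal.ofReal d ^ q) →
      |(∫ x in Ω, slotForm m α u x * ψ x) - ∫ x in Ω, slotForm m α v x * ψ x| ≤
        C * d * (a ^ (r - 1) + b ^ (r - 1)) * supDm m ψ := by
  obtain ⟨C, hC0, hC⟩ := exists_abs_setIntegral_slotForm_le_supDm hN hr hrq hP hΩ
  refine ⟨r * C, by positivity, fun α u v ψ a b d hu hv hψ ha hb hd hau hbv hduv => ?_⟩
  have hO := hΩ.1
  have hw : ∀ i j, ContDiffOn ℝ m (hybridSlots u v i j) Ω := fun i j => by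
    unfold hybridSlots
    split_ifs
    exacts [hv j, hu j, (hu j).sub (hv j)]
  have hInt : ∀ w : Fin r → Euc N → ℝ, (∀ i, ContDiffOn ℝ m (w i) Ω) →
      IntegrableOn (fun x => slotForm m α w x * ψ x) Ω := fun w hw =>
    integrableOn_mul_of_isCinfc hO (continuousOn_slotForm hO α hw) hψ
  have hsplit : (∫ x in Ω, slotForm m α u x * ψ x) - ∫ x in Ω, slotForm m α v x * ψ x =
      ∑ i, ∫ x in Ω, slotForm m α (hybridSlots u v i) x * ψ x := by
    rw [← integral_sub (hInt u hu) (hInt v hv), ← integral_finsetSum _ fun i _ => hInt _ (hw i)]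
    refine setIntegral_congr_fun hO.measurableSet fun x hx => ?_
    rw [← sub_mul, slotForm_sub hO α hu hv hx, Finset.sum_mul]
  rw [hsplit]
  have hterm : ∀ i, |∫ x in Ω, slotForm m α (hybridSlots u v i) x * ψ x| ≤
      C * d * (a ^ (r - 1) + b ^ (r - 1)) * supDm m ψ := by
    intro i
    have h := hC α (hybridSlots u v i) ψ (fun j => if j = i then d else max a b) (hw i) hψ
      (fun j => by split_ifs <;> positivity) (fun j => by
        unfold hybridSlots
        rcases lt_trichotomy j i with hj | rfl | hj
        · rw [if_pos hj, if_neg hj.ne]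
          refine (hbv j).trans ?_
          gcongr
          exact le_max_right _ _
        · simpa using hduv j
        · rw [if_neg hj.not_gt, if_pos hj, if_neg hj.ne']
          refine (hau j).trans ?_
          gcongr
          exact le_max_left _ _)
    have hp : ∏ j, (if j = i then d else max a b) = d * max a b ^ (r - 1) := by
      rw [← Finset.mul_prod_erase _ _ (Finset.mem_univ i), if_pos rfl,
        Finset.prod_congr rfl fun j hj => if_neg (Finset.ne_of_mem_erase hj),
        Finset.prod_const, Finset.card_erase_of_mem (Finset.mem_univ i), Finset.card_univ,
        Fintype.card_fin]
    rw [hp] at h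
    have hmax : max a b ^ (r - 1) ≤ a ^ (r - 1) + b ^ (r - 1) := by
      rcases max_cases a b with ⟨h, -⟩ | ⟨h, -⟩ <;> rw [h]
      · linarith [pow_nonneg hb (r - 1)]
      · linarith [pow_nonneg ha (r - 1)]
    have hs := supDm_nonneg m ψ
    calc _ ≤ _ := h
      _ ≤ C * supDm m ψ * (d * (a ^ (r - 1) + b ^ (r - 1))) := by gcongr
      _ = _ := by ring
  refine (Finset.abs_sum_le_sum_abs _ _).trans
    ((Finset.sum_le_sum fun i _ => hterm i).trans_eq ?_)
  rw [Finset.sum_const, Finset.card_univ, Fintype.card_fin, nsmul_eq_mul]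
  ring

end Telescoping

section Norms

variable {N m k q : ℕ} {Ω : Set (Euc N)} {F : Type*} [NormedAddCommGroup F] [NormedSpace ℝ F]

/-- The `q`-th powers of the `L^q` norms of the derivatives of order at most `k` and of the
Gagliardo seminorm of the derivative of order `k`, summed up in `[0, ∞]`. -/
def vecEnergy (E : Set (Euc N)) (k q : ℕ) (P : Option ℕ) (u : Euc N → F) : ENNReal :=
  (∑ j ∈ Finset.range (k + 1), ∫⁻ x in E, ‖iteratedFDeriv ℝ j u x‖ₑ ^ q) +
  P.elim 0 fun p => ∫⁻ x in E, ∫⁻ z in E,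
    ‖iteratedFDeriv ℝ k u x - iteratedFDeriv ℝ k u z‖ₑ ^ q / ‖x - z‖ₑ ^ p

/-- The Sobolev norm with a natural kernel exponent. -/
def sobForm (E : Set (Euc N)) (k q : ℕ) (P : Option ℕ) (u : Euc N → F) : ℝ :=
  intSobNorm E k q u + P.elim 0 fun p => (∫ x in E, ∫ y in E,
    ‖iteratedFDeriv ℝ k u x - iteratedFDeriv ℝ k u y‖ ^ q / ‖x - y‖ ^ p) ^ (1 / (q : ℝ))

lemma exists_sobNorm_eq_sobForm (hm : 1 ≤ m) (hq : 2 ≤ q) (hN : 1 ≤ N) :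
    ∃ k P, IsCritical N m q k P ∧ (∀ p ∈ P, p < N + q) ∧
      ∀ {F : Type} [NormedAddCommGroup F] [NormedSpace ℝ F] (Ω : Set (Euc N)) (u : Euc N → F),
        sobNorm Ω ((m : ℝ) - (m : ℝ) / q) q u = sobForm Ω k q P u := by
  have hq0 : (0 : ℝ) < q := by exact_mod_cast (by omega : 0 < q)
  by_cases hInt : ∃ k : ℕ, (m : ℝ) - (m : ℝ) / q = k
  · obtain ⟨k, hk⟩ := hInt
    have hmul : m * q = k * q + m := by
      have : (m : ℝ) * q = k * q + m := by rw [← hk]; field_simp; ring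
      exact_mod_cast this
    have hkm : k ≤ m := by nlinarith
    refine ⟨k, none, ⟨m - k, ?_, by omega⟩, by simp, fun Ω u => ?_⟩
    · obtain ⟨d, rfl⟩ := Nat.exists_eq_add_of_le hkm
      rw [Nat.add_sub_cancel_left]
      nlinarith
    · rw [sobNorm, if_pos ⟨k, hk⟩, hk, Nat.floor_natCast]
      simp [sobForm]
  · set s : ℝ := (m : ℝ) - (m : ℝ) / q with hs
    have hs0 : 0 ≤ s := by
      rw [hs, sub_nonneg, div_le_iff₀ hq0]
      have : (1 : ℝ) ≤ q := by exact_mod_cast (by omega : 1 ≤ q)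
      have hm0 : (0 : ℝ) ≤ m := by positivity
      nlinarith
    have hsq : s * q = m * q - m := by rw [hs]; field_simp
    set k := ⌊s⌋₊ with hk
    have hk1 : (k : ℝ) ≤ s := Nat.floor_le hs0
    have hk2 : s < k + 1 := Nat.lt_floor_add_one s
    have hkq : k * q + m ≤ m * q := by
      have : (k : ℝ) * q + m ≤ m * q := by nlinarith
      exact_mod_cast this
    have hkq2 : m * q < (k + 1) * q + m := by
      have : (m : ℝ) * q < (k + 1) * q + m := by nlinarith
      exact_mod_cast this
    have hkm : k < m := by
      by_contra! h
      nlinarith [Nat.mul_le_mul_right q h]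
    obtain ⟨d, hd⟩ := Nat.exists_eq_add_of_lt hkm
    have hsub : m - k = d + 1 := by omega
    have hle : k + d + 1 ≤ (d + 1) * q := by rw [hd] at hkq; nlinarith
    have hle2 : (d + 1) * q < q + (k + d + 1) := by rw [hd] at hkq2; nlinarith
    obtain ⟨p, hp⟩ : ∃ p, p = N + (d + 1) * q - (k + d + 1) := ⟨_, rfl⟩
    have hp' : p + (k + d + 1) = N + (d + 1) * q := by omega
    refine ⟨k, some p, ⟨by omega, hkm, by rw [hsub, hd]; exact hp'⟩, ?_, fun Ω u => ?_⟩
    · intro p' hp'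
      rw [Option.mem_def, Option.some.injEq] at hp'
      omega
    · have hexp : (N : ℝ) + (s - k) * q = (p : ℕ) := by
        have : (p : ℝ) + (k + d + 1) = N + (d + 1) * q := by exact_mod_cast hp'
        have hd' : (m : ℝ) = k + d + 1 := by exact_mod_cast hd
        rw [sub_mul, hsq, hd']
        linarith
      rw [sobNorm, if_neg hInt, ← hk, hexp]
      simp only [sobForm, Option.elim_some, Real.rpow_natCast]

lemma ENNReal.add_pow_le_two_pow_mul (a b : ENNReal) (q : ℕ) :
    (a + b) ^ q ≤ 2 ^ q * (a ^ q + b ^ q) := by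
  rcases le_total a b with h | h
  · calc (a + b) ^ q ≤ (2 * b) ^ q := by gcongr; rw [two_mul]; gcongr
      _ = 2 ^ q * b ^ q := mul_pow _ _ _
      _ ≤ _ := by gcongr; exact le_add_self
  · calc (a + b) ^ q ≤ (2 * a) ^ q := by gcongr; rw [two_mul]; gcongr
      _ = 2 ^ q * a ^ q := mul_pow _ _ _
      _ ≤ _ := by gcongr; exact le_self_add

lemma lintegral_ball_norm_pow_div_lt_top (hN : 1 ≤ N) {p : ℕ} (hq : 1 ≤ q) (hp : p < N + q)
    (R : ℝ) : ∫⁻ y : Euc N in Metric.ball 0 R, ‖y‖ₑ ^ q / ‖y‖ₑ ^ p < ⊤ := by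
  have : Nonempty (Fin N) := ⟨⟨0, hN⟩⟩
  obtain ⟨e, he⟩ : ∃ e, N - 1 + q = e + p := ⟨N - 1 + q - p, by omega⟩
  obtain ⟨f, hf⟩ : ∃ f : ℝ → ℝ, ∀ t, f t = (Set.Iio R).indicator (fun t => t ^ q / t ^ p) t :=
    ⟨_, fun _ => rfl⟩
  have hInt : Integrable (fun x : Euc N => f ‖x‖) := by
    rw [integrable_fun_norm_addHaar, finrank_euclideanSpace_fin]
    have h1 : IntegrableOn (fun y : ℝ => (Set.Iio R).indicator (fun y => y ^ e) y) (Set.Ioi 0) := by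
      rw [integrableOn_indicator_iff measurableSet_Iio, Set.inter_comm, Set.Ioi_inter_Iio]
      exact ((continuous_pow e).integrableOn_Icc).mono_set Set.Ioo_subset_Icc_self
    refine h1.congr_fun (fun y hy => ?_) measurableSet_Ioi
    have hy0 : 0 < y := hy
    simp only [hf, Set.indicator, smul_eq_mul]
    split_ifs
    · rw [← mul_div_assoc, ← pow_add, he, pow_add, mul_div_assoc, div_self (by positivity), mul_one]
    · simp
  refine lt_of_le_of_lt ?_ hInt.2
  rw [← lintegral_indicator measurableSet_ball]
  refine lintegral_mono fun y => ?_
  by_cases hy : y ∈ Metric.ball (0 : Euc N) R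
  · rw [Set.indicator_of_mem hy]
    have hyR : ‖y‖ ∈ Set.Iio R := by simpa using hy
    change _ ≤ ‖f ‖y‖‖ₑ
    rw [hf, Set.indicator_of_mem hyR]
    rcases eq_or_ne y 0 with rfl | h0
    · simp [zero_pow (by omega : q ≠ 0)]
    · rw [← ofReal_norm (‖y‖ ^ q / ‖y‖ ^ p), Real.norm_of_nonneg (by positivity),
        ENNReal.ofReal_div_of_pos (by positivity), ENNReal.ofReal_pow (norm_nonneg _),
        ENNReal.ofReal_pow (norm_nonneg _), ofReal_norm]
  · rw [Set.indicator_of_notMem hy]; exact bot_le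

/-- The energy of a map which is `C^m` up to the boundary of a smooth domain is finite. -/
lemma vecEnergy_lt_top (hN : 1 ≤ N) (hq : 1 ≤ q) (hΩ : IsSmoothDomain Ω) {P : Option ℕ}
    (hkm : k ≤ m) (hPk : ∀ p ∈ P, k < m ∧ p < N + q) {u : Euc N → F}
    (hu : ContDiffOn ℝ m u (closure Ω)) : vecEnergy Ω k q P u < ⊤ := by
  have hO := hΩ.1
  have hvol : volume Ω < ⊤ := hΩ.2.1.measure_lt_top
  refine ENNReal.add_lt_top.2 ⟨ENNReal.sum_lt_top.2 fun j hj => ?_, ?_⟩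
  · obtain ⟨B, hB⟩ := hu.exists_norm_iteratedFDeriv_le hO hΩ.2.1
      (j := j) (by have := Finset.mem_range.1 hj; omega)
    calc ∫⁻ x in Ω, ‖iteratedFDeriv ℝ j u x‖ₑ ^ q ≤ ∫⁻ x in Ω, ENNReal.ofReal B ^ q := by
          refine setLIntegral_mono' hO.measurableSet fun x hx => ?_
          gcongr
          rw [← ofReal_norm]
          exact ENNReal.ofReal_le_ofReal (hB x hx)
      _ < ⊤ := by
          rw [setLIntegral_const]
          exact ENNReal.mul_lt_top (ENNReal.pow_lt_top ENNReal.ofReal_lt_top) hvol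
  · rcases P with _ | p
    · simp
    obtain ⟨hk, hp⟩ := hPk p rfl
    obtain ⟨B, hB⟩ := hu.exists_norm_iteratedFDeriv_le hO hΩ.2.1 hkm
    obtain ⟨B', hB'⟩ := hu.exists_norm_iteratedFDeriv_le hO hΩ.2.1 (j := k + 1) hk
    have huΩ := hu.mono subset_closure
    obtain ⟨L, hL0, hL⟩ := hΩ.exists_lipschitz
      (fun x hx => huΩ.differentiableAt_iteratedFDeriv hO hk hx) hB
      (fun x hx => by rw [norm_fderiv_iteratedFDeriv]; exact hB' x hx)
    obtain ⟨R, hR⟩ := hΩ.2.1.subset_ball 0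
    have hK := lintegral_ball_norm_pow_div_lt_top hN hq hp (2 * R)
    obtain ⟨G, hG⟩ : ∃ G : Euc N → ENNReal, ∀ y, G y = (Metric.ball (0 : Euc N) (2 * R)).indicator
      (fun y => ‖y‖ₑ ^ q / ‖y‖ₑ ^ p) y := ⟨_, fun _ => rfl⟩
    have hGint : ∫⁻ y, G y < ⊤ := by
      simp_rw [hG]
      rwa [lintegral_indicator measurableSet_ball]
    simp only [Option.elim_some]
    calc _ ≤ ∫⁻ x in Ω, ENNReal.ofReal L ^ q * ∫⁻ y, G y := by
          refine setLIntegral_mono' hO.measurableSet fun x hx => ?_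
          rw [← lintegral_sub_left_eq_self G x, ← lintegral_const_mul' _ _
            (ENNReal.pow_ne_top ENNReal.ofReal_ne_top)]
          refine (setLIntegral_mono' hO.measurableSet fun z hz => ?_).trans
            (setLIntegral_le_lintegral Ω _)
          have hxz : x - z ∈ Metric.ball (0 : Euc N) (2 * R) := by
            have h1 := hR hx
            have h2 := hR hz
            rw [mem_ball_zero_iff] at h1 h2 ⊢
            linarith [norm_sub_le x z]
          rw [hG, Set.indicator_of_mem hxz, ← mul_div_assoc, ← mul_pow]
          gcongr
          rw [← ofReal_norm, ← ofReal_norm, ← ENNReal.ofReal_mul hL0]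
          exact ENNReal.ofReal_le_ofReal (hL x hx z hz)
      _ < ⊤ := by
          rw [setLIntegral_const]
          exact ENNReal.mul_lt_top (ENNReal.mul_lt_top
            (ENNReal.pow_lt_top ENNReal.ofReal_lt_top) hGint) hvol

lemma ofReal_integral_pow_norm {E : Type*} [NormedAddCommGroup E] (hO : IsOpen Ω)
    {g : Euc N → E} (hg : ContinuousOn g Ω) (hfin : ∫⁻ x in Ω, ‖g x‖ₑ ^ q < ⊤) :
    ENNReal.ofReal (∫ x in Ω, ‖g x‖ ^ q) = ∫⁻ x in Ω, ‖g x‖ₑ ^ q := by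
  have hm : AEStronglyMeasurable (fun x => ‖g x‖ ^ q) (volume.restrict Ω) :=
    (hg.norm.pow q).aestronglyMeasurable hO.measurableSet
  rw [integral_eq_lintegral_of_nonneg_ae (ae_of_all _ fun x => by positivity) hm]
  have : ∀ x, ENNReal.ofReal (‖g x‖ ^ q) = ‖g x‖ₑ ^ q := fun x => by
    rw [ENNReal.ofReal_pow (norm_nonneg _), ofReal_norm]
  simp_rw [this]
  exact ENNReal.ofReal_toReal hfin.ne

lemma ofReal_integral_gagliardo {E : Type*} [NormedAddCommGroup E] (hO : IsOpen Ω) {p : ℕ}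
    (hq : 1 ≤ q) {g : Euc N → E} (hg : ContinuousOn g Ω)
    (hfin : ∫⁻ x in Ω, ∫⁻ z in Ω, ‖g x - g z‖ₑ ^ q / ‖x - z‖ₑ ^ p < ⊤) :
    ENNReal.ofReal (∫ x in Ω, ∫ z in Ω, ‖g x - g z‖ ^ q / ‖x - z‖ ^ p) =
      ∫⁻ x in Ω, ∫⁻ z in Ω, ‖g x - g z‖ₑ ^ q / ‖x - z‖ₑ ^ p := by
  obtain ⟨G, hG⟩ : ∃ G : Euc N × Euc N → ℝ, ∀ x z,
    G (x, z) = ‖g x - g z‖ ^ q / ‖x - z‖ ^ p := ⟨fun y => ‖g y.1 - g y.2‖ ^ q / ‖y.1 - y.2‖ ^ p,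
      fun _ _ => rfl⟩
  have hG0 : ∀ y, 0 ≤ G y := fun y => by rw [← Prod.mk.eta (p := y), hG]; positivity
  have hofReal : ∀ x z, ENNReal.ofReal (G (x, z)) = ‖g x - g z‖ₑ ^ q / ‖x - z‖ₑ ^ p := by
    intro x z
    rw [hG]
    rcases eq_or_ne x z with rfl | h
    · simp [zero_pow (by omega : q ≠ 0)]
    · have : 0 < ‖x - z‖ := norm_pos_iff.2 (sub_ne_zero.2 h)
      rw [ENNReal.ofReal_div_of_pos (by positivity), ENNReal.ofReal_pow (norm_nonneg _),
        ENNReal.ofReal_pow (norm_nonneg _), ofReal_norm, ofReal_norm]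
  have hmeas : AEStronglyMeasurable G ((volume.restrict Ω).prod (volume.restrict Ω)) := by
    rw [Measure.prod_restrict]
    have h1 : AEStronglyMeasurable (fun y : Euc N × Euc N => ‖g y.1 - g y.2‖ ^ q)
        ((volume.prod volume).restrict (Ω ×ˢ Ω)) := by
      refine ContinuousOn.aestronglyMeasurable ?_ (hO.measurableSet.prod hO.measurableSet)
      exact (((hg.comp continuousOn_fst fun y hy => hy.1).sub
        (hg.comp continuousOn_snd fun y hy => hy.2)).norm).pow q
    have h2 : AEStronglyMeasurable (fun y : Euc N × Euc N => (‖y.1 - y.2‖ ^ p)⁻¹)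
        ((volume.prod volume).restrict (Ω ×ˢ Ω)) := by
      refine Measurable.aestronglyMeasurable ?_
      fun_prop
    refine (h1.mul h2).congr (ae_of_all _ fun y => ?_)
    rw [← Prod.mk.eta (p := y), hG, div_eq_mul_inv]
    rfl
  have hlin : ∫⁻ y, ENNReal.ofReal (G y) ∂((volume.restrict Ω).prod (volume.restrict Ω)) =
      ∫⁻ x in Ω, ∫⁻ z in Ω, ‖g x - g z‖ₑ ^ q / ‖x - z‖ₑ ^ p := by
    rw [lintegral_prod _ hmeas.aemeasurable.ennreal_ofReal]
    simp_rw [hofReal]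
  have hInt : Integrable G ((volume.restrict Ω).prod (volume.restrict Ω)) := by
    refine ⟨hmeas, ?_⟩
    rw [hasFiniteIntegral_iff_ofReal (ae_of_all _ hG0), hlin]
    exact hfin
  have h : ∫ y, G y ∂((volume.restrict Ω).prod (volume.restrict Ω)) =
      ∫ x in Ω, ∫ z in Ω, ‖g x - g z‖ ^ q / ‖x - z‖ ^ p := by
    rw [integral_prod G hInt]
    simp_rw [hG]
  rw [← h, ofReal_integral_eq_lintegral_ofReal hInt (ae_of_all _ hG0), hlin]

end Norms

section NormComparison

variable {N m k q : ℕ} {Ω : Set (Euc N)} {F : Type*} [NormedAddCommGroup F] [NormedSpace ℝ F]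

lemma intSobNorm_nonneg (E : Set (Euc N)) (k : ℕ) (p : ℝ) (u : Euc N → F) :
    0 ≤ intSobNorm E k p u :=
  Finset.sum_nonneg fun _ _ => Real.rpow_nonneg
    (integral_nonneg fun _ => Real.rpow_nonneg (norm_nonneg _) _) _

lemma sobForm_nonneg (E : Set (Euc N)) (k q : ℕ) (P : Option ℕ) (u : Euc N → F) :
    0 ≤ sobForm E k q P u := by
  refine add_nonneg (intSobNorm_nonneg E k q u) ?_
  rcases P with _ | p
  · simp
  · exact Real.rpow_nonneg (integral_nonneg fun _ => integral_nonneg fun _ => by positivity) _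

lemma ENNReal.pow_add_pow_le_add_pow (hq : 1 ≤ q) (a b : ENNReal) :
    a ^ q + b ^ q ≤ (a + b) ^ q := by
  obtain ⟨e, rfl⟩ := Nat.exists_eq_add_of_le' hq
  rw [pow_succ, pow_succ, pow_succ, mul_add]
  gcongr
  · exact le_self_add
  · exact le_add_self

lemma ENNReal.sum_pow_le_pow_sum {ι : Type*} (hq : 1 ≤ q) (s : Finset ι) (a : ι → ENNReal) :
    ∑ i ∈ s, a i ^ q ≤ (∑ i ∈ s, a i) ^ q := by
  classical
  induction s using Finset.induction_on with
  | empty => simp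
  | insert i s hi ih =>
    rw [Finset.sum_insert hi, Finset.sum_insert hi]
    exact (add_le_add le_rfl ih).trans (ENNReal.pow_add_pow_le_add_pow hq _ _)

lemma ofReal_rpow_inv_pow {a : ℝ} (ha : 0 ≤ a) (hq : 1 ≤ q) :
    ENNReal.ofReal (a ^ (1 / (q : ℝ))) ^ q = ENNReal.ofReal a := by
  rw [← ENNReal.ofReal_pow (Real.rpow_nonneg ha _), one_div,
    Real.rpow_inv_natCast_pow ha (by omega)]

variable {P : Option ℕ} {u v w : Euc N → F}

lemma lintegral_iteratedFDeriv_le_vecEnergy {j : ℕ} (hj : j ≤ k) :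
    ∫⁻ x in Ω, ‖iteratedFDeriv ℝ j u x‖ₑ ^ q ≤ vecEnergy Ω k q P u :=
  (Finset.single_le_sum (f := fun j => ∫⁻ x in Ω, ‖iteratedFDeriv ℝ j u x‖ₑ ^ q)
    (fun _ _ => bot_le) (Finset.mem_range.2 (Nat.lt_succ_of_le hj))).trans le_self_add

lemma lintegral_gagliardo_le_vecEnergy {p : ℕ} : ∫⁻ x in Ω, ∫⁻ z in Ω,
    ‖iteratedFDeriv ℝ k u x - iteratedFDeriv ℝ k u z‖ₑ ^ q / ‖x - z‖ₑ ^ p ≤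
      vecEnergy Ω k q (some p) u := le_add_self

lemma vecEnergy_le_sobForm_pow (hO : IsOpen Ω)
    (hu : ∀ j ≤ k, ContinuousOn (iteratedFDeriv ℝ j u) Ω) (hq : 1 ≤ q)
    (hfin : vecEnergy Ω k q P u < ⊤) :
    vecEnergy Ω k q P u ≤ ENNReal.ofReal (sobForm Ω k q P u) ^ q := by
  have hA : ∀ j ∈ Finset.range (k + 1), ∫⁻ x in Ω, ‖iteratedFDeriv ℝ j u x‖ₑ ^ q =
      ENNReal.ofReal ((∫ x in Ω, ‖iteratedFDeriv ℝ j u x‖ ^ (q : ℝ)) ^ (1 / (q : ℝ))) ^ q := by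
    intro j hj
    have hj' : j ≤ k := Nat.lt_succ_iff.1 (Finset.mem_range.1 hj)
    simp only [Real.rpow_natCast]
    rw [ofReal_rpow_inv_pow (integral_nonneg fun x => by positivity) hq,
      ofReal_integral_pow_norm hO (hu j hj')
        ((lintegral_iteratedFDeriv_le_vecEnergy hj').trans_lt hfin)]
  have hsum : ∑ j ∈ Finset.range (k + 1), ∫⁻ x in Ω, ‖iteratedFDeriv ℝ j u x‖ₑ ^ q ≤
      ENNReal.ofReal (intSobNorm Ω k q u) ^ q := by
    rw [Finset.sum_congr rfl hA, intSobNorm, ENNReal.ofReal_sum_of_nonneg fun j _ =>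
      Real.rpow_nonneg (integral_nonneg fun _ => Real.rpow_nonneg (norm_nonneg _) _) _]
    exact ENNReal.sum_pow_le_pow_sum hq _ _
  rcases P with _ | p
  · simpa [vecEnergy, sobForm] using hsum
  · have hG := ofReal_integral_gagliardo hO (p := p) hq (hu k le_rfl)
      (lintegral_gagliardo_le_vecEnergy.trans_lt hfin)
    have hnn : 0 ≤ ∫ x in Ω, ∫ y in Ω,
        ‖iteratedFDeriv ℝ k u x - iteratedFDeriv ℝ k u y‖ ^ q / ‖x - y‖ ^ p :=
      integral_nonneg fun _ => integral_nonneg fun _ => by positivity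
    rw [vecEnergy, sobForm]
    simp only [Option.elim_some]
    rw [ENNReal.ofReal_add (intSobNorm_nonneg _ _ _ _) (Real.rpow_nonneg hnn _)]
    refine le_trans (add_le_add hsum (le_of_eq ?_)) (ENNReal.pow_add_pow_le_add_pow hq _ _)
    rw [ofReal_rpow_inv_pow hnn hq, hG]

lemma sobForm_le_vecEnergy (hO : IsOpen Ω)
    (hu : ∀ j ≤ k, ContinuousOn (iteratedFDeriv ℝ j u) Ω) (hq : 1 ≤ q)
    (hfin : vecEnergy Ω k q P u < ⊤) :
    sobForm Ω k q P u ≤ (k + 2) * (vecEnergy Ω k q P u).toReal ^ (1 / (q : ℝ)) := by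
  have hroot : ∀ a : ℝ, 0 ≤ a → ENNReal.ofReal a ≤ vecEnergy Ω k q P u →
      a ^ (1 / (q : ℝ)) ≤ (vecEnergy Ω k q P u).toReal ^ (1 / (q : ℝ)) := fun a ha h =>
    Real.rpow_le_rpow ha ((ENNReal.ofReal_le_iff_le_toReal hfin.ne).1 h) (by positivity)
  have hInt : intSobNorm Ω k q u ≤ (k + 1) * (vecEnergy Ω k q P u).toReal ^ (1 / (q : ℝ)) := by
    rw [intSobNorm]
    refine (Finset.sum_le_card_nsmul _ _
      ((vecEnergy Ω k q P u).toReal ^ (1 / (q : ℝ))) fun j hj => ?_).trans_eq ?_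
    · have hj' : j ≤ k := Nat.lt_succ_iff.1 (Finset.mem_range.1 hj)
      simp only [Real.rpow_natCast]
      refine hroot _ (integral_nonneg fun x => by positivity) ?_
      rw [ofReal_integral_pow_norm hO (hu j hj')
        ((lintegral_iteratedFDeriv_le_vecEnergy hj').trans_lt hfin)]
      exact lintegral_iteratedFDeriv_le_vecEnergy hj'
    · rw [Finset.card_range, nsmul_eq_mul]
      push_cast
      ring
  rw [sobForm, show ((k : ℝ) + 2) = (k + 1) + 1 by ring, add_mul ((k : ℝ) + 1), one_mul]
  refine add_le_add hInt ?_
  rcases P with _ | p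
  · simp only [Option.elim_none]
    exact Real.rpow_nonneg ENNReal.toReal_nonneg _
  · simp only [Option.elim_some]
    refine hroot _ (integral_nonneg fun _ => integral_nonneg fun _ => by positivity) ?_
    rw [ofReal_integral_gagliardo hO hq (hu k le_rfl)
      (lintegral_gagliardo_le_vecEnergy.trans_lt hfin)]
    exact lintegral_gagliardo_le_vecEnergy

lemma aemeasurable_gagliardo {E : Type*} [NormedAddCommGroup E] (hO : IsOpen Ω) (q p : ℕ)
    {g : Euc N → E} (hg : ContinuousOn g Ω) :
    AEMeasurable (fun y : Euc N × Euc N => ‖g y.1 - g y.2‖ₑ ^ q / ‖y.1 - y.2‖ₑ ^ p)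
      ((volume.restrict Ω).prod (volume.restrict Ω)) := by
  rw [Measure.prod_restrict]
  have h1 : ContinuousOn (fun y : Euc N × Euc N => ‖g y.1 - g y.2‖ₑ) (Ω ×ˢ Ω) :=
    continuous_enorm.comp_continuousOn ((hg.comp continuousOn_fst fun y hy => hy.1).sub
      (hg.comp continuousOn_snd fun y hy => hy.2))
  refine ((h1.aemeasurable (hO.measurableSet.prod hO.measurableSet)).pow_const q).div ?_
  fun_prop

lemma vecEnergy_le_of_enorm_le (hO : IsOpen Ω)
    (hu : ∀ j ≤ k, ContinuousOn (iteratedFDeriv ℝ j u) Ω)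
    (hv : ∀ j ≤ k, ContinuousOn (iteratedFDeriv ℝ j v) Ω)
    (h0 : ∀ j ≤ k, ∀ x ∈ Ω, ‖iteratedFDeriv ℝ j w x‖ₑ ≤
      ‖iteratedFDeriv ℝ j u x‖ₑ + ‖iteratedFDeriv ℝ j v x‖ₑ)
    (h1 : ∀ x ∈ Ω, ∀ z ∈ Ω, ‖iteratedFDeriv ℝ k w x - iteratedFDeriv ℝ k w z‖ₑ ≤
      ‖iteratedFDeriv ℝ k u x - iteratedFDeriv ℝ k u z‖ₑ +
        ‖iteratedFDeriv ℝ k v x - iteratedFDeriv ℝ k v z‖ₑ) :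
    vecEnergy Ω k q P w ≤ 2 ^ q * (vecEnergy Ω k q P u + vecEnergy Ω k q P v) := by
  have hpow : (2 : ENNReal) ^ q ≠ ⊤ := ENNReal.pow_ne_top (by norm_num)
  rw [vecEnergy, vecEnergy, vecEnergy, add_add_add_comm, mul_add, ← Finset.sum_add_distrib,
    Finset.mul_sum]
  refine add_le_add (Finset.sum_le_sum fun j hj => ?_) ?_
  · have hj' : j ≤ k := Nat.lt_succ_iff.1 (Finset.mem_range.1 hj)
    have hmu : AEMeasurable (fun x => ‖iteratedFDeriv ℝ j u x‖ₑ ^ q) (volume.restrict Ω) :=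
      ((continuous_enorm.comp_continuousOn (hu j hj')).aemeasurable hO.measurableSet).pow_const q
    rw [← lintegral_add_left' hmu, ← lintegral_const_mul' _ _ hpow]
    refine setLIntegral_mono' hO.measurableSet fun x hx => ?_
    exact (pow_le_pow_left' (h0 j hj' x hx) q).trans (ENNReal.add_pow_le_two_pow_mul _ _ q)
  · rcases P with _ | p
    · simp
    simp only [Option.elim_some]
    have hmu := aemeasurable_gagliardo hO q p (hu k le_rfl)
    have hmv := aemeasurable_gagliardo hO q p (hv k le_rfl)
    have hkey : ∫⁻ x in Ω, ∫⁻ z in Ω,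
        (2 : ENNReal) ^ q *
          (‖iteratedFDeriv ℝ k u x - iteratedFDeriv ℝ k u z‖ₑ ^ q / ‖x - z‖ₑ ^ p +
          ‖iteratedFDeriv ℝ k v x - iteratedFDeriv ℝ k v z‖ₑ ^ q / ‖x - z‖ₑ ^ p) =
        2 ^ q * ((∫⁻ x in Ω, ∫⁻ z in Ω,
          ‖iteratedFDeriv ℝ k u x - iteratedFDeriv ℝ k u z‖ₑ ^ q / ‖x - z‖ₑ ^ p) +
          ∫⁻ x in Ω, ∫⁻ z in Ω,
          ‖iteratedFDeriv ℝ k v x - iteratedFDeriv ℝ k v z‖ₑ ^ q / ‖x - z‖ₑ ^ p) := by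
      have hsum : AEMeasurable (fun y : Euc N × Euc N => (2 : ENNReal) ^ q *
          (‖iteratedFDeriv ℝ k u y.1 - iteratedFDeriv ℝ k u y.2‖ₑ ^ q / ‖y.1 - y.2‖ₑ ^ p +
          ‖iteratedFDeriv ℝ k v y.1 - iteratedFDeriv ℝ k v y.2‖ₑ ^ q / ‖y.1 - y.2‖ₑ ^ p))
          ((volume.restrict Ω).prod (volume.restrict Ω)) := (hmu.add hmv).const_mul _
      rw [← lintegral_prod _ hmu, ← lintegral_prod _ hmv, ← lintegral_add_left' hmu,
        ← lintegral_const_mul' _ _ hpow, lintegral_prod _ hsum]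
    rw [← hkey]
    refine setLIntegral_mono' hO.measurableSet fun x hx =>
      setLIntegral_mono' hO.measurableSet fun z hz => ?_
    rw [← ENNReal.add_div, ← mul_div_assoc]
    gcongr
    exact (pow_le_pow_left' (h1 x hx z hz) q).trans (ENNReal.add_pow_le_two_pow_mul _ _ q)

lemma iteratedFDeriv_fun_sub (hO : IsOpen Ω) (hu : ContDiffOn ℝ m u Ω) (hv : ContDiffOn ℝ m v Ω)
    {j : ℕ} (hj : j ≤ m) {x : Euc N} (hx : x ∈ Ω) :
    iteratedFDeriv ℝ j (fun y => u y - v y) x =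
      iteratedFDeriv ℝ j u x - iteratedFDeriv ℝ j v x :=
  iteratedFDeriv_sub_apply ((hu.contDiffAt (hO.mem_nhds hx)).of_le (by exact_mod_cast hj))
    ((hv.contDiffAt (hO.mem_nhds hx)).of_le (by exact_mod_cast hj))

lemma vecEnergy_sub_le (hO : IsOpen Ω) (hkm : k ≤ m) (hu : ContDiffOn ℝ m u Ω)
    (hv : ContDiffOn ℝ m v Ω) : vecEnergy Ω k q P (fun x => u x - v x) ≤
      2 ^ q * (vecEnergy Ω k q P u + vecEnergy Ω k q P v) := by
  refine vecEnergy_le_of_enorm_le hO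
    (fun j hj => hu.continuousOn_iteratedFDeriv hO (hj.trans hkm))
    (fun j hj => hv.continuousOn_iteratedFDeriv hO (hj.trans hkm)) (fun j hj x hx => ?_)
    (fun x hx z hz => ?_)
  · rw [iteratedFDeriv_fun_sub hO hu hv (hj.trans hkm) hx]
    exact enorm_sub_le
  · rw [iteratedFDeriv_fun_sub hO hu hv hkm hx, iteratedFDeriv_fun_sub hO hu hv hkm hz,
      sub_sub_sub_comm]
    exact enorm_sub_le

lemma vecEnergy_le_sub (hO : IsOpen Ω) (hkm : k ≤ m) (hu : ContDiffOn ℝ m u Ω)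
    (hv : ContDiffOn ℝ m v Ω) : vecEnergy Ω k q P u ≤
      2 ^ q * (vecEnergy Ω k q P (fun x => u x - v x) + vecEnergy Ω k q P v) := by
  have huv := hu.sub hv
  refine vecEnergy_le_of_enorm_le hO
    (fun j hj => huv.continuousOn_iteratedFDeriv hO (hj.trans hkm))
    (fun j hj => hv.continuousOn_iteratedFDeriv hO (hj.trans hkm)) (fun j hj x hx => ?_)
    (fun x hx z hz => ?_)
  · rw [iteratedFDeriv_fun_sub hO hu hv (hj.trans hkm) hx]
    exact (enorm_add_le _ _).trans' (by rw [sub_add_cancel])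
  · rw [iteratedFDeriv_fun_sub hO hu hv hkm hx, iteratedFDeriv_fun_sub hO hu hv hkm hz,
      sub_sub_sub_comm]
    exact (enorm_add_le _ _).trans' (by rw [sub_add_cancel])

lemma enorm_pderivList_clm_comp_le (hO : IsOpen Ω) (hu : ContDiffOn ℝ m u Ω) (T : F →L[ℝ] ℝ)
    (hT : ∀ z, ‖T z‖ ≤ ‖z‖) {j : ℕ} (hj : j ≤ m) (l : Fin j → Fin N) {x : Euc N} (hx : x ∈ Ω) :
    ‖pderivList (List.ofFn l) (fun y => T (u y)) x‖ₑ ≤ ‖iteratedFDeriv ℝ j u x‖ₑ := by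
  obtain ⟨W, hW⟩ : ∃ W, W = List.ofFn l := ⟨_, rfl⟩
  obtain rfl : W.length = j := by simp [hW]
  rw [← hW, pderivList_clm_comp hO hu T W hj x hx, ← ofReal_norm, ← ofReal_norm]
  exact ENNReal.ofReal_le_ofReal ((hT _).trans (norm_multilinear_basisVec_le _ _))

lemma enorm_pderivList_clm_comp_sub_le (hO : IsOpen Ω) (hu : ContDiffOn ℝ m u Ω) (T : F →L[ℝ] ℝ)
    (hT : ∀ z, ‖T z‖ ≤ ‖z‖) {j : ℕ} (hj : j ≤ m) (l : Fin j → Fin N) {x z : Euc N} (hx : x ∈ Ω)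
    (hz : z ∈ Ω) :
    ‖pderivList (List.ofFn l) (fun y => T (u y)) x -
      pderivList (List.ofFn l) (fun y => T (u y)) z‖ₑ ≤
      ‖iteratedFDeriv ℝ j u x - iteratedFDeriv ℝ j u z‖ₑ := by
  obtain ⟨W, hW⟩ : ∃ W, W = List.ofFn l := ⟨_, rfl⟩
  obtain rfl : W.length = j := by simp [hW]
  rw [← hW, pderivList_clm_comp hO hu T W hj x hx, pderivList_clm_comp hO hu T W hj z hz,
    ← map_sub, ← sub_apply, ← ofReal_norm, ← ofReal_norm]
  exact ENNReal.ofReal_le_ofReal ((hT _).trans (norm_multilinear_basisVec_le _ _))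

/-- The scalar energy of a component is controlled by the energy of the map. -/
lemma energy_clm_comp_le (hO : IsOpen Ω) (hkm : k ≤ m) (hu : ContDiffOn ℝ m u Ω) (T : F →L[ℝ] ℝ)
    (hT : ∀ z, ‖T z‖ ≤ ‖z‖) : energy Ω k q P (fun x => T (u x)) ≤
      ((∑ j ∈ Finset.range (k + 1), N ^ j : ℕ) : ENNReal) * vecEnergy Ω k q P u := by
  rw [energy, vecEnergy, mul_add, Finset.mul_sum]
  have hcard : ∀ {j}, j ≤ k → (N ^ j : ENNReal) ≤
      ((∑ j ∈ Finset.range (k + 1), N ^ j : ℕ) : ENNReal) := fun {j} hj => by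
    exact_mod_cast Finset.single_le_sum (f := fun j => N ^ j) (fun _ _ => Nat.zero_le _)
      (Finset.mem_range.2 (Nat.lt_succ_of_le hj))
  have hsum : ∀ {j}, j ≤ k → ∀ (f : (Fin j → Fin N) → ENNReal) (a : ENNReal), (∀ l, f l ≤ a) →
      ∑ l, f l ≤ ((∑ j ∈ Finset.range (k + 1), N ^ j : ℕ) : ENNReal) * a := by
    intro j hj f a hf
    refine (Finset.sum_le_card_nsmul _ _ a fun l _ => hf l).trans ?_
    rw [nsmul_eq_mul, Finset.card_univ, Fintype.card_fun, Fintype.card_fin, Fintype.card_fin]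
    push_cast
    gcongr
    exact_mod_cast hcard hj
  refine add_le_add (Finset.sum_le_sum fun j hj => ?_) ?_
  · have hj' : j ≤ k := Nat.lt_succ_iff.1 (Finset.mem_range.1 hj)
    refine hsum hj' _ _ fun l => setLIntegral_mono' hO.measurableSet fun x hx => ?_
    gcongr
    exact enorm_pderivList_clm_comp_le hO hu T hT (hj'.trans hkm) l hx
  · rcases P with _ | p
    · simp
    refine hsum le_rfl _ _ fun l => setLIntegral_mono' hO.measurableSet fun x hx =>
      setLIntegral_mono' hO.measurableSet fun z hz => ?_
    gcongr
    exact enorm_pderivList_clm_comp_sub_le hO hu T hT hkm l hx hz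

end NormComparison

section CauchySequences

variable {N m k q r n : ℕ} {Ω : Set (Euc N)} {P : Option ℕ}

lemma IsCritical.pos_order {p : ℕ} (h : IsCritical N m q k (some p)) : k < m := h.2.1

lemma energy_component_le (hO : IsOpen Ω) (hkm : k ≤ m) (hq : 1 ≤ q) {u : Euc N → Fin n → ℝ}
    (hu : ContDiffOn ℝ m u Ω) (hfin : vecEnergy Ω k q P u < ⊤) (b : Fin n) :
    energy Ω k q P (fun x => u x b) ≤ ENNReal.ofReal
      (((∑ j ∈ Finset.range (k + 1), N ^ j : ℕ) : ℝ) * sobForm Ω k q P u) ^ q := by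
  refine (energy_clm_comp_le hO hkm hu (ContinuousLinearMap.proj b)
    fun z => norm_le_pi_norm z b).trans ?_
  rw [ENNReal.ofReal_mul (Nat.cast_nonneg _), mul_pow, ENNReal.ofReal_natCast]
  refine mul_le_mul' ?_ (vecEnergy_le_sobForm_pow hO
    (fun j hj => hu.continuousOn_iteratedFDeriv hO (hj.trans hkm)) hq hfin)
  exact_mod_cast Nat.le_self_pow (by omega) _

/-- The Lipschitz-type estimate for the pairing of a Jacobian minor with a test function. -/
lemma exists_abs_sub_setIntegral_jacMinor_le (hN : 1 ≤ N) (hr : 1 ≤ r) (hrq : r ≤ q)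
    (hP : IsCritical N m q k P) (hPN : ∀ p ∈ P, p < N + q) (hΩ : IsSmoothDomain Ω)
    (β : Fin r → Fin n) :
    ∃ C : ℝ, 0 ≤ C ∧ ∀ (α : Fin m → Fin r → Fin N) (u v : Euc N → Fin n → ℝ) (ψ : Euc N → ℝ),
      ContDiffOn ℝ m u (closure Ω) → ContDiffOn ℝ m v (closure Ω) → IsCinfc Ω ψ →
      |(∫ x in Ω, jacMinor m r β α u x * ψ x) - ∫ x in Ω, jacMinor m r β α v x * ψ x| ≤
        C * sobForm Ω k q P (fun x => u x - v x) *
          (sobForm Ω k q P u ^ (r - 1) + sobForm Ω k q P v ^ (r - 1)) * supDm m ψ := by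
  have hO := hΩ.1
  have hq : 1 ≤ q := hr.trans hrq
  have hkm := hP.le
  have hPk : ∀ p ∈ P, k < m ∧ p < N + q := fun p hp =>
    ⟨IsCritical.pos_order (Option.mem_def.1 hp ▸ hP), hPN p hp⟩
  obtain ⟨C, hC, hbound⟩ := exists_abs_sub_setIntegral_slotForm_le hN hr hrq hP hΩ
  obtain ⟨D, hD⟩ : ∃ D : ℝ, D = ((∑ j ∈ Finset.range (k + 1), N ^ j : ℕ) : ℝ) := ⟨_, rfl⟩
  have hD0 : 0 ≤ D := hD ▸ Nat.cast_nonneg _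
  refine ⟨C * D * D ^ (r - 1), by positivity, fun α u v ψ hu hv hψ => ?_⟩
  have huv : ContDiffOn ℝ m (fun x => u x - v x) (closure Ω) := hu.sub hv
  have hcomp : ∀ {w : Euc N → Fin n → ℝ}, ContDiffOn ℝ m w (closure Ω) → ∀ b,
      energy Ω k q P (fun x => w x b) ≤ ENNReal.ofReal (D * sobForm Ω k q P w) ^ q :=
    fun hw b => hD ▸ energy_component_le hO hkm hq (hw.mono subset_closure)
      (vecEnergy_lt_top hN hq hΩ hkm hPk hw) b
  have hcd : ∀ {w : Euc N → Fin n → ℝ}, ContDiffOn ℝ m w (closure Ω) → ∀ b,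
      ContDiffOn ℝ m (fun x => w x b) Ω :=
    fun hw b => contDiffOn_pi.1 (hw.mono subset_closure) b
  have hD1 : ∀ w : Euc N → Fin n → ℝ, 0 ≤ D * sobForm Ω k q P w := fun w =>
    mul_nonneg hD0 (sobForm_nonneg Ω k q P w)
  have h := hbound α (fun i x => u x (β i)) (fun i x => v x (β i)) ψ _ _ _
    (fun i => hcd hu (β i)) (fun i => hcd hv (β i)) hψ (hD1 u) (hD1 v)
    (hD1 fun x => u x - v x) (fun i => hcomp hu (β i)) (fun i => hcomp hv (β i))
    (fun i => hcomp huv (β i))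
  simp only [jacMinor_eq_slotForm]
  refine h.trans_eq ?_
  rw [mul_pow, mul_pow]
  ring

lemma exists_vecEnergy_le_of_cauchy (hN : 1 ≤ N) (hq : 1 ≤ q) (hkm : k ≤ m)
    (hPk : ∀ p ∈ P, k < m ∧ p < N + q) (hΩ : IsSmoothDomain Ω) {u : ℕ → Euc N → Fin n → ℝ}
    (hu : ∀ j, ContDiffOn ℝ m (u j) (closure Ω))
    (hC : ∀ ε : ℝ, 0 < ε → ∃ K, ∀ j ≥ K, ∀ l ≥ K,
      sobForm Ω k q P (fun x => u j x - u l x) < ε) :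
    ∃ M : ENNReal, M < ⊤ ∧ ∀ j, vecEnergy Ω k q P (u j) ≤ M := by
  have hO := hΩ.1
  obtain ⟨K, hK⟩ := hC 1 one_pos
  have hfin : ∀ j, vecEnergy Ω k q P (u j) < ⊤ := fun j => vecEnergy_lt_top hN hq hΩ hkm hPk (hu j)
  refine ⟨∑ j ∈ Finset.range K, vecEnergy Ω k q P (u j) + 2 ^ q * (1 + vecEnergy Ω k q P (u K)),
    ENNReal.add_lt_top.2 ⟨ENNReal.sum_lt_top.2 fun j _ => hfin j, ENNReal.mul_lt_top
      (ENNReal.pow_lt_top (by norm_num)) (ENNReal.add_lt_top.2 ⟨by norm_num, hfin K⟩)⟩,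
    fun j => ?_⟩
  rcases lt_or_ge j K with hj | hj
  · exact (Finset.single_le_sum (f := fun j => vecEnergy Ω k q P (u j)) (fun _ _ => zero_le)
      (Finset.mem_range.2 hj)).trans le_self_add
  · refine le_trans ?_ le_add_self
    refine (vecEnergy_le_sub hO hkm ((hu j).mono subset_closure)
      ((hu K).mono subset_closure)).trans ?_
    have hsub := (hu j).sub (hu K)
    gcongr
    refine (vecEnergy_le_sobForm_pow hO (fun i hi =>
      (hsub.mono subset_closure).continuousOn_iteratedFDeriv hO (hi.trans hkm)) hq
      (vecEnergy_lt_top hN hq hΩ hkm hPk hsub)).trans ?_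
    refine pow_le_one' ?_ q
    exact ENNReal.ofReal_le_one.2 (hK j hj K le_rfl).le

lemma sobForm_le_of_vecEnergy_le (hq : 1 ≤ q) (hkm : k ≤ m) (hO : IsOpen Ω)
    {w : Euc N → Fin n → ℝ} (hw : ContDiffOn ℝ m w Ω) {M : ENNReal} (hM : M < ⊤)
    (h : vecEnergy Ω k q P w ≤ M) :
    sobForm Ω k q P w ≤ (k + 2) * M.toReal ^ (1 / (q : ℝ)) := by
  refine (sobForm_le_vecEnergy hO (fun j hj => hw.continuousOn_iteratedFDeriv hO (hj.trans hkm)) hq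
    (h.trans_lt hM)).trans ?_
  gcongr
  exact hM.ne

lemma abs_sub_le_limsup {x y a b d : ℕ → ℝ} {A B D C S L L' : ℝ} {s : ℕ} (hC : 0 ≤ C)
    (hS : 0 ≤ S) (ha : ∀ j, 0 ≤ a j) (hb : ∀ j, 0 ≤ b j) (hd : ∀ j, 0 ≤ d j)
    (haA : ∀ j, a j ≤ A) (hbB : ∀ j, b j ≤ B) (hdD : ∀ j, d j ≤ D)
    (h : ∀ j, |x j - y j| ≤ C * d j * (a j ^ s + b j ^ s) * S)
    (hx : Tendsto x atTop (𝓝 L)) (hy : Tendsto y atTop (𝓝 L')) :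
    |L - L'| ≤ C * limsup d atTop * (limsup a atTop ^ s + limsup b atTop ^ s) * S := by
  have hev : ∀ {f : ℕ → ℝ} {F : ℝ}, (∀ j, 0 ≤ f j) → (∀ j, f j ≤ F) → ∀ ε : ℝ, 0 < ε →
      ∀ᶠ j in atTop, f j ≤ limsup f atTop + ε := fun hf hF ε hε =>
    (eventually_lt_of_limsup_lt (lt_add_of_pos_right _ hε)
      (isBoundedUnder_of ⟨_, hF⟩)).mono fun _ => le_of_lt
  have hε : ∀ ε : ℝ, 0 < ε → |L - L'| ≤ C * (limsup d atTop + ε) *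
      ((limsup a atTop + ε) ^ s + (limsup b atTop + ε) ^ s) * S := by
    intro ε hε
    refine le_of_tendsto (hx.sub hy).abs ?_
    filter_upwards [hev ha haA ε hε, hev hb hbB ε hε, hev hd hdD ε hε] with j h1 h2 h3
    have := ha j
    have := hb j
    have := hd j
    refine (h j).trans ?_
    gcongr
    exact mul_nonneg hC ((hd j).trans h3)
  have hcont : Tendsto (fun ε : ℝ => C * (limsup d atTop + ε) *
      ((limsup a atTop + ε) ^ s + (limsup b atTop + ε) ^ s) * S) (𝓝[>] 0)
      (𝓝 (C * limsup d atTop * (limsup a atTop ^ s + limsup b atTop ^ s) * S)) := by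
    have : Continuous fun ε : ℝ => C * (limsup d atTop + ε) *
      ((limsup a atTop + ε) ^ s + (limsup b atTop + ε) ^ s) * S := by fun_prop
    simpa using (this.tendsto 0).mono_left nhdsWithin_le_nhds
  exact ge_of_tendsto hcont (eventually_mem_nhdsWithin.mono fun ε => hε ε)

end CauchySequences

/-- Theorem 1.1 (well-definedness of the distributional minors on `W^{m-m/q,q}`):
(i) for every `W^{m-m/q,q}`-Cauchy sequence in `C^m(Ω̄,ℝ^n)` the integrals
`∫_Ω M^β_α(D^m u_k) ψ` converge; (ii) two Cauchy sequences whose distance tends to `0`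
give the same limit; (iii) the limits satisfy the continuity estimate. -/
theorem stmt7 (N n m q : ℕ) (hN : 2 ≤ N) (hn : 1 ≤ n) (hm : 1 ≤ m)
    (hq2 : 2 ≤ q) (hq : q ≤ min n N)
    (Ω : Set (Euc N)) (hΩ : IsSmoothDomain Ω)
    (r : ℕ) (hr1 : 1 ≤ r) (hrq : r ≤ q)
    (β : Fin r → Fin n) (hβ : StrictMono β)
    (α : Fin m → Fin r → Fin N) (hα : ∀ j, StrictMono (α j)) :
    (∀ u : ℕ → Euc N → Fin n → ℝ,
      (∀ k, ContDiffOn ℝ m (u k) (closure Ω)) →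
      (∀ ε : ℝ, 0 < ε → ∃ K, ∀ j ≥ K, ∀ k ≥ K,
        sobNorm Ω ((m : ℝ) - (m : ℝ) / q) q (fun x => u j x - u k x) < ε) →
      ∀ ψ : Euc N → ℝ, IsCinfc Ω ψ →
        ∃ L : ℝ, Tendsto (fun k => ∫ x in Ω, jacMinor m r β α (u k) x * ψ x)
          atTop (𝓝 L)) ∧
    (∀ u v : ℕ → Euc N → Fin n → ℝ,
      (∀ k, ContDiffOn ℝ m (u k) (closure Ω)) →
      (∀ k, ContDiffOn ℝ m (v k) (closure Ω)) →
      (∀ ε : ℝ, 0 < ε → ∃ K, ∀ j ≥ K, ∀ k ≥ K,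
        sobNorm Ω ((m : ℝ) - (m : ℝ) / q) q (fun x => u j x - u k x) < ε) →
      (∀ ε : ℝ, 0 < ε → ∃ K, ∀ j ≥ K, ∀ k ≥ K,
        sobNorm Ω ((m : ℝ) - (m : ℝ) / q) q (fun x => v j x - v k x) < ε) →
      Tendsto (fun k => sobNorm Ω ((m : ℝ) - (m : ℝ) / q) q (fun x => u k x - v k x))
        atTop (𝓝 0) →
      ∀ ψ : Euc N → ℝ, IsCinfc Ω ψ → ∀ L L' : ℝ,
        Tendsto (fun k => ∫ x in Ω, jacMinor m r β α (u k) x * ψ x) atTop (𝓝 L) →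
        Tendsto (fun k => ∫ x in Ω, jacMinor m r β α (v k) x * ψ x) atTop (𝓝 L') →
        L = L') ∧
    (∃ C : ℝ, 0 < C ∧
      ∀ u v : ℕ → Euc N → Fin n → ℝ,
        (∀ k, ContDiffOn ℝ m (u k) (closure Ω)) →
        (∀ k, ContDiffOn ℝ m (v k) (closure Ω)) →
        (∀ ε : ℝ, 0 < ε → ∃ K, ∀ j ≥ K, ∀ k ≥ K,
          sobNorm Ω ((m : ℝ) - (m : ℝ) / q) q (fun x => u j x - u k x) < ε) →
        (∀ ε : ℝ, 0 < ε → ∃ K, ∀ j ≥ K, ∀ k ≥ K,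
          sobNorm Ω ((m : ℝ) - (m : ℝ) / q) q (fun x => v j x - v k x) < ε) →
        ∀ ψ : Euc N → ℝ, IsCinfc Ω ψ → ∀ L L' : ℝ,
          Tendsto (fun k => ∫ x in Ω, jacMinor m r β α (u k) x * ψ x) atTop (𝓝 L) →
          Tendsto (fun k => ∫ x in Ω, jacMinor m r β α (v k) x * ψ x) atTop (𝓝 L') →
          |L - L'| ≤
            C * Filter.limsup
                (fun k => sobNorm Ω ((m : ℝ) - (m : ℝ) / q) q
                  (fun x => u k x - v k x)) atTop *
              (Filter.limsup (fun k => sobNorm Ω ((m : ℝ) - (m : ℝ) / q) q (u k))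
                  atTop ^ (r - 1) +
                Filter.limsup (fun k => sobNorm Ω ((m : ℝ) - (m : ℝ) / q) q (v k))
                  atTop ^ (r - 1)) * supDm m ψ) := by
  have hN1 : 1 ≤ N := by omega
  have hq1 : 1 ≤ q := by omega
  obtain ⟨k, P, hP, hPN, hS⟩ := exists_sobNorm_eq_sobForm hm hq2 hN1
  simp only [hS]
  have hO := hΩ.1
  have hkm := hP.le
  have hPk : ∀ p ∈ P, k < m ∧ p < N + q := fun p hp =>
    ⟨IsCritical.pos_order (Option.mem_def.1 hp ▸ hP), hPN p hp⟩
  obtain ⟨C, hC, hbound⟩ := exists_abs_sub_setIntegral_jacMinor_le hN1 hr1 hrq hP hPN hΩ β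
  have hS0 : ∀ w : Euc N → Fin n → ℝ, 0 ≤ sobForm Ω k q P w := sobForm_nonneg Ω k q P
  have hlim : ∀ u v : ℕ → Euc N → Fin n → ℝ,
      (∀ j, ContDiffOn ℝ m (u j) (closure Ω)) → (∀ j, ContDiffOn ℝ m (v j) (closure Ω)) →
      (∀ ε : ℝ, 0 < ε → ∃ K, ∀ j ≥ K, ∀ l ≥ K, sobForm Ω k q P (fun x => u j x - u l x) < ε) →
      (∀ ε : ℝ, 0 < ε → ∃ K, ∀ j ≥ K, ∀ l ≥ K, sobForm Ω k q P (fun x => v j x - v l x) < ε) →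
      ∀ ψ : Euc N → ℝ, IsCinfc Ω ψ → ∀ L L' : ℝ,
        Tendsto (fun j => ∫ x in Ω, jacMinor m r β α (u j) x * ψ x) atTop (𝓝 L) →
        Tendsto (fun j => ∫ x in Ω, jacMinor m r β α (v j) x * ψ x) atTop (𝓝 L') →
        |L - L'| ≤ C * limsup (fun j => sobForm Ω k q P (fun x => u j x - v j x)) atTop *
          (limsup (fun j => sobForm Ω k q P (u j)) atTop ^ (r - 1) +
            limsup (fun j => sobForm Ω k q P (v j)) atTop ^ (r - 1)) * supDm m ψ := by
    intro u v hu hv hcu hcv ψ hψ L L' hL hL'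
    obtain ⟨A, hA, huA⟩ := exists_vecEnergy_le_of_cauchy hN1 hq1 hkm hPk hΩ hu hcu
    obtain ⟨B, hB, hvB⟩ := exists_vecEnergy_le_of_cauchy hN1 hq1 hkm hPk hΩ hv hcv
    have hu' := fun j => (hu j).mono subset_closure
    have hv' := fun j => (hv j).mono subset_closure
    have hAB : 2 ^ q * (A + B) < ⊤ :=
      ENNReal.mul_lt_top (ENNReal.pow_lt_top (by norm_num)) (ENNReal.add_lt_top.2 ⟨hA, hB⟩)
    exact abs_sub_le_limsup hC (supDm_nonneg m ψ) (fun j => hS0 (u j)) (fun j => hS0 (v j))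
      (fun j => hS0 _) (fun j => sobForm_le_of_vecEnergy_le hq1 hkm hO (hu' j) hA (huA j))
      (fun j => sobForm_le_of_vecEnergy_le hq1 hkm hO (hv' j) hB (hvB j))
      (fun j => sobForm_le_of_vecEnergy_le hq1 hkm hO ((hu' j).sub (hv' j)) hAB
        ((vecEnergy_sub_le hO hkm (hu' j) (hv' j)).trans
          (mul_le_mul_right (add_le_add (huA j) (hvB j)) _)))
      (fun j => hbound α (u j) (v j) ψ (hu j) (hv j) hψ) hL hL'
  refine ⟨fun u hu hcu ψ hψ => ?_, fun u v hu hv hcu hcv huv ψ hψ L L' hL hL' => ?_,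
    C + 1, by positivity, fun u v hu hv hcu hcv ψ hψ L L' hL hL' => ?_⟩
  · obtain ⟨A, hA, huA⟩ := exists_vecEnergy_le_of_cauchy hN1 hq1 hkm hPk hΩ hu hcu
    obtain ⟨R, hR⟩ : ∃ R : ℝ, ∀ j, sobForm Ω k q P (u j) ≤ R :=
      ⟨_, fun j => sobForm_le_of_vecEnergy_le hq1 hkm hO ((hu j).mono subset_closure) hA (huA j)⟩
    have hR0 : 0 ≤ R := (hS0 _).trans (hR 0)
    have hψ0 := supDm_nonneg m ψ
    refine cauchySeq_tendsto_of_complete (Metric.cauchySeq_iff.2 fun ε hε => ?_)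
    obtain ⟨G, hG⟩ : ∃ G : ℝ, G = C * (R ^ (r - 1) + R ^ (r - 1)) * supDm m ψ := ⟨_, rfl⟩
    have hG0 : 0 ≤ G := by rw [hG]; positivity
    obtain ⟨K, hK⟩ := hcu (ε / (G + 1)) (by positivity)
    refine ⟨K, fun i hi j hj => ?_⟩
    rw [Real.dist_eq]
    have h1 := hK i hi j hj
    have hd := hS0 fun x => u i x - u j x
    calc _ ≤ C * sobForm Ω k q P (fun x => u i x - u j x) *
          (sobForm Ω k q P (u i) ^ (r - 1) + sobForm Ω k q P (u j) ^ (r - 1)) * supDm m ψ :=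
          hbound α (u i) (u j) ψ (hu i) (hu j) hψ
      _ ≤ C * sobForm Ω k q P (fun x => u i x - u j x) *
          (R ^ (r - 1) + R ^ (r - 1)) * supDm m ψ := by
          gcongr
          exacts [hS0 _, hR i, hS0 _, hR j]
      _ = G * sobForm Ω k q P (fun x => u i x - u j x) := by rw [hG]; ring
      _ ≤ (G + 1) * sobForm Ω k q P (fun x => u i x - u j x) := by gcongr; linarith
      _ < (G + 1) * (ε / (G + 1)) := by gcongr
      _ = ε := by field_simp
  · have h := hlim u v hu hv hcu hcv ψ hψ L L' hL hL'
    rw [huv.limsup_eq, mul_zero, zero_mul, zero_mul] at h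
    exact sub_eq_zero.1 (abs_nonpos_iff.1 h)
  · refine (hlim u v hu hv hcu hcv ψ hψ L L' hL hL').trans ?_
    have hnonneg : ∀ w : ℕ → Euc N → Fin n → ℝ,
        0 ≤ limsup (fun j => sobForm Ω k q P (w j)) atTop := fun w =>
      Real.sInf_nonneg fun a ha => by
        obtain ⟨j, hj⟩ := (eventually_map.1 ha).exists
        exact (hS0 _).trans hj
    exact mul_le_mul_of_nonneg_right (mul_le_mul_of_nonneg_right (mul_le_mul_of_nonneg_right
      (le_add_of_nonneg_right zero_le_one) (hnonneg fun j x => u j x - v j x))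
      (add_nonneg (pow_nonneg (hnonneg u) _) (pow_nonneg (hnonneg v) _))) (supDm_nonneg m ψ)
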